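/- Let v₁, v₂ ∈ ℝ² be linearly independent over ℝ and let Λ = ℤ·v₁ + ℤ·v₂ be the lattice they span, so that the flat torus T = ℝ²/Λ carries the quotient metric d_T(x̄, ȳ) = inf_{λ ∈ Λ} ‖x − y − λ‖ (where ‖·‖ is the Euclidean norm). Then there exists a constant c(Λ) > 0 such that every set of N ≥ 2 distinct points in T determines at least c(Λ) · N / log N distinct distances. -/

import Mathlib

section
open MvPolynomial
noncomputable section
namespace GK

abbrev Poly := MvPolynomial (Fin 3) ℝ

abbrev WD (n : ℕ) : Submodule ℝ Poly := restrictTotalDegree (Fin 3) ℝ n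

lemma mem_WD {n : ℕ} {p : Poly} : p ∈ WD n ↔ p.totalDegree ≤ n := mem_restrictTotalDegree _ _ _

lemma finrank_WD (n : ℕ) : 6 * Module.finrank ℝ (WD n) = (n+1)*(n+2)*(n+3) := by
  have h1 : Module.finrank ℝ (WD n) = Nat.card ({s : Fin 3 →₀ ℕ | (s.sum fun _ e => e) ≤ n}) :=
    Module.finrank_eq_nat_card_basis (basisRestrictSupport ℝ _)
  have h2 : ({s : Fin 3 →₀ ℕ | (s.sum fun _ e => e) ≤ n}) =
      ((Finset.range (n+1)).biUnion fun j => (Finset.univ : Finset (Fin 3)).finsuppAntidiag j : Finset (Fin 3 →₀ ℕ)) := by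
    ext s
    simp [Finset.mem_finsuppAntidiag, Finsupp.sum_fintype]
  rw [h1, h2]
  simp only [Finset.coe_sort_coe, Nat.card_eq_fintype_card, Fintype.card_coe]
  rw [Finset.card_biUnion]
  · simp only [Finset.card_finsuppAntidiag_nat_eq_choose, Finset.card_univ, Fintype.card_fin]
    induction n with
    | zero => simp
    | succ k ih =>
      rw [Finset.sum_range_succ, mul_add, ih]
      · have : (3 + (k+1) - 1) = (k+1) + 2 := by omega
        rw [this, Nat.choose_symm_add]
        have h := Nat.choose_two_right (k+1+2)
        have h3 : 2 * (k+1+2).choose 2 = (k+3)*(k+2) := by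
          rw [h, Nat.mul_div_cancel']
          · simp
          · have := Nat.even_mul_pred_self (k+1+2)
            exact this.two_dvd
        nlinarith
      · exact Module.finrank_eq_nat_card_basis (basisRestrictSupport ℝ _)
      · ext s
        simp [Finset.mem_finsuppAntidiag, Finsupp.sum_fintype]
  · intro i _ j _ hij
    rw [Function.onFun, Finset.disjoint_left]
    intro s hs hs'
    simp [Finset.mem_finsuppAntidiag] at hs hs'
    omega

@[ext] structure Ln where
  a0 : ℝ
  a1 : ℝ
  b0 : ℝ
  b1 : ℝ

def Ln.pt (l : Ln) (t : ℝ) : Fin 3 → ℝ := ![l.a0 + t * l.b0, l.a1 + t * l.b1, t]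
def Ln.dir (l : Ln) : Fin 3 → ℝ := ![l.b0, l.b1, 1]
def Ln.on (l : Ln) (x : Fin 3 → ℝ) : Prop := x = l.pt (x 2)

def res (l : Ln) : Poly →ₐ[ℝ] Polynomial ℝ :=
  aeval ![Polynomial.C l.a0 + Polynomial.X * Polynomial.C l.b0,
    Polynomial.C l.a1 + Polynomial.X * Polynomial.C l.b1, Polynomial.X]

lemma eval_res (l : Ln) (p : Poly) (t : ℝ) : (res l p).eval t = eval (l.pt t) p := by
  induction p using MvPolynomial.induction_on with
  | C a => simp [res]
  | add p q hp hq => simp [hp, hq]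
  | mul_X p i hp =>
    rw [map_mul, Polynomial.eval_mul, hp, map_mul]
    congr 1
    fin_cases i <;> simp [res, Ln.pt] <;> ring

lemma natDegree_res (l : Ln) (p : Poly) : (res l p).natDegree ≤ p.totalDegree := by
  unfold res
  have h := aeval_natDegree_le (m := p.totalDegree) (n := 1) p le_rfl
    ![Polynomial.C l.a0 + Polynomial.X * Polynomial.C l.b0,
    Polynomial.C l.a1 + Polynomial.X * Polynomial.C l.b1, Polynomial.X] ?_
  · simpa using h
  · intro i
    fin_cases i <;> simp <;> compute_degree

lemma derivative_res (l : Ln) (p : Poly) : Polynomial.derivative (res l p) =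
    res l (∑ i, C (l.dir i) * pderiv i p) := by
  induction p using MvPolynomial.induction_on with
  | C a => simp [res]
  | add p q hp hq => simp [hp, hq, mul_add, Finset.sum_add_distrib]
  | mul_X p i hp =>
    rw [map_mul, Polynomial.derivative_mul, hp]
    simp only [Derivation.leibniz, smul_eq_mul, mul_add, Finset.sum_add_distrib, map_add]
    have e1 : (∑ x : Fin 3, C (l.dir x) * (p * (pderiv x) (X i))) = C (l.dir i) * p := by
      simp [pderiv_X, Pi.single_apply]
    have e2 : (∑ x : Fin 3, C (l.dir x) * (X i * (pderiv x) p)) = X i * ∑ x : Fin 3, C (l.dir x) * ((pderiv x) p) := by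
      rw [Finset.mul_sum]; refine Finset.sum_congr rfl fun x _ => by ring
    rw [e1, e2, map_mul, map_mul, add_comm]
    have : Polynomial.derivative (res l (X i)) = res l (C (l.dir i)) := by
      fin_cases i <;> simp [res, Ln.dir]
    rw [this]; ring

lemma res_zero_of_roots (l : Ln) (p : Poly) (S : Finset ℝ) (hS : ∀ t ∈ S, eval (l.pt t) p = 0)
    (h : p.totalDegree < S.card) : res l p = 0 := by
  by_contra hne
  have := Polynomial.card_roots' (res l p)
  have h2 : S ⊆ (res l p).roots.toFinset := by
    intro t ht
    simp [hne, eval_res, hS t ht]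
  have h3 := Finset.card_le_card h2
  have h4 := Multiset.toFinset_card_le (res l p).roots
  have := natDegree_res l p
  omega

lemma on_pt (l : Ln) (t : ℝ) : l.on (l.pt t) := by simp [Ln.on, Ln.pt]

lemma on_iff (l : Ln) (x : Fin 3 → ℝ) : l.on x ↔ x 0 = l.a0 + x 2 * l.b0 ∧ x 1 = l.a1 + x 2 * l.b1 := by
  unfold Ln.on Ln.pt
  constructor
  · intro h; constructor
    · conv_lhs => rw [h]
      simp
    · conv_lhs => rw [h]
      simp
  · rintro ⟨h0, h1⟩; ext i; fin_cases i <;> simp [h0, h1]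

lemma res_zero_of_pts (l : Ln) (p : Poly) (S : Finset (Fin 3 → ℝ)) (hl : ∀ x ∈ S, l.on x)
    (hS : ∀ x ∈ S, eval x p = 0)
    (h : p.totalDegree < S.card) : res l p = 0 := by
  apply res_zero_of_roots l p (S.image fun x => x 2)
  · intro t ht
    obtain ⟨x, hx, rfl⟩ := Finset.mem_image.1 ht
    rw [← hl x hx]; exact hS x hx
  · rwa [Finset.card_image_of_injOn]
    intro x hx y hy hxy
    simp only at hxy
    rw [hl x hx, hl y hy, hxy]

lemma eval_of_res {l : Ln} {p : Poly} (h : res l p = 0) {x} (hx : l.on x) : eval x p = 0 := by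
  rw [hx, ← eval_res, h]; simp

lemma on_unique {l m : Ln} (h : l ≠ m) {x y} (hx : l.on x) (hy : l.on y) (hx' : m.on x) (hy' : m.on y) :
    x = y := by
  rw [on_iff] at *
  by_contra hne
  have h2 : x 2 ≠ y 2 := by
    intro h2; apply hne; ext i; fin_cases i
    · simp [hx.1, hy.1, h2]
    · simp [hx.2, hy.2, h2]
    · exact h2
  apply h
  have e0 : (x 2 - y 2) * (l.b0 - m.b0) = 0 := by linarith [hx.1, hy.1, hx'.1, hy'.1]
  have e1 : (x 2 - y 2) * (l.b1 - m.b1) = 0 := by linarith [hx.2, hy.2, hx'.2, hy'.2]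
  have e0' := (mul_eq_zero.1 e0).resolve_left (sub_ne_zero.2 h2)
  have e1' := (mul_eq_zero.1 e1).resolve_left (sub_ne_zero.2 h2)
  have f0 : l.b0 = m.b0 := by linarith
  have f1 : l.b1 = m.b1 := by linarith
  ext
  · have := hx.1; rw [hx'.1, f0] at this; linarith
  · have := hx.2; rw [hx'.2, f1] at this; linarith
  · exact f0
  · exact f1

lemma plane_deg (i : Fin 3) (a b : ℝ) : (X i - C a - X 2 * C b : Poly).totalDegree ≤ 1 := by
  refine (totalDegree_sub _ _).trans (max_le ?_ ?_)
  · refine (totalDegree_sub _ _).trans (max_le ?_ ?_) <;> simp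
  · refine (totalDegree_mul _ _).trans ?_
    simp

lemma plane_lin {a b a' b' : ℝ} (h : (Polynomial.C a + Polynomial.X * Polynomial.C b - Polynomial.C a' -
      Polynomial.X * Polynomial.C b' : Polynomial ℝ) = 0) : a = a' ∧ b = b' := by
  have h0 := congrArg (Polynomial.eval 0) h
  have h1 := congrArg (Polynomial.eval 1) h
  simp at h0 h1
  constructor <;> linarith

lemma res_plane0 (l : Ln) (a b : ℝ) : res l (X 0 - C a - X 2 * C b) =
    Polynomial.C l.a0 + Polynomial.X * Polynomial.C l.b0 - Polynomial.C a - Polynomial.X * Polynomial.C b := by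
  simp [res]

lemma res_plane1 (l : Ln) (a b : ℝ) : res l (X 1 - C a - X 2 * C b) =
    Polynomial.C l.a1 + Polynomial.X * Polynomial.C l.b1 - Polynomial.C a - Polynomial.X * Polynomial.C b := by
  simp [res]

lemma exists_plane {l m : Ln} (h : l ≠ m) : ∃ u : Poly, u.totalDegree ≤ 1 ∧ res m u = 0 ∧ res l u ≠ 0 := by
  by_cases h0 : res l (X 0 - C m.a0 - X 2 * C m.b0) = 0
  · refine ⟨X 1 - C m.a1 - X 2 * C m.b1, plane_deg _ _ _, ?_, fun h1 => h ?_⟩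
    · rw [res_plane1]; ring
    · rw [res_plane0] at h0
      rw [res_plane1] at h1
      exact Ln.ext (plane_lin h0).1 (plane_lin h1).1 (plane_lin h0).2 (plane_lin h1).2
  · refine ⟨X 0 - C m.a0 - X 2 * C m.b0, plane_deg _ _ _, ?_, h0⟩
    rw [res_plane0]; ring

lemma exists_sep (l : Ln) (S : Finset Ln) (h : l ∉ S) : ∃ u : Poly, u.totalDegree ≤ S.card ∧
    (∀ m ∈ S, res m u = 0) ∧ res l u ≠ 0 := by
  classical
  have : ∀ m : Ln, ∃ u : Poly, u.totalDegree ≤ 1 ∧ (m ≠ l → res m u = 0) ∧ res l u ≠ 0 := by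
    intro m
    by_cases hm : l = m
    · exact ⟨1, by simp, fun h => (h hm.symm).elim, by simp⟩
    · obtain ⟨u, h1, h2, h3⟩ := exists_plane hm
      exact ⟨u, h1, fun _ => h2, h3⟩
  choose u h1 h2 h3 using this
  refine ⟨∏ m ∈ S, u m, ?_, ?_, ?_⟩
  · refine (totalDegree_finsetProd _ _).trans ?_
    refine (Finset.sum_le_sum fun i _ => h1 i).trans ?_
    simp
  · intro m hm
    rw [map_prod]
    exact Finset.prod_eq_zero hm (h2 m fun e => h (e ▸ hm))
  · rw [map_prod]
    exact Finset.prod_ne_zero_iff.2 fun m _ => h3 m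
end GK
end
end

section
open MvPolynomial
noncomputable section
namespace GK

lemma exists_vanish (S : Finset Ln) (D : ℕ) (h : 6 * (S.card * (D+1)) < (D+1)*(D+2)*(D+3)) :
    ∃ f : Poly, f ≠ 0 ∧ f.totalDegree ≤ D ∧ ∀ l ∈ S, res l f = 0 := by
  classical
  rw [← finrank_WD] at h
  let T : WD D →ₗ[ℝ] (S → Polynomial.degreeLT ℝ (D+1)) :=
    LinearMap.pi fun l => LinearMap.codRestrict _ ((res l.1).toLinearMap ∘ₗ (WD D).subtype) (by
      intro p
      rw [Polynomial.mem_degreeLT]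
      have h1 := natDegree_res l.1 p.1
      have h2 := mem_WD.1 p.2
      simp only [LinearMap.comp_apply, Submodule.subtype_apply, AlgHom.toLinearMap_apply]
      refine lt_of_le_of_lt Polynomial.degree_le_natDegree ?_
      exact_mod_cast Nat.lt_succ_of_le (h1.trans h2))
  have hr : Module.finrank ℝ (S → Polynomial.degreeLT ℝ (D+1)) = S.card * (D+1) := by
    rw [Module.finrank_pi_fintype]
    simp [LinearEquiv.finrank_eq (Polynomial.degreeLTEquiv ℝ (D+1))]
  have : LinearMap.ker T ≠ ⊥ := LinearMap.ker_ne_bot_of_finrank_lt (by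
    rw [hr]; omega)
  obtain ⟨p, hp, hp0⟩ := (Submodule.ne_bot_iff _).1 this
  refine ⟨p.1, by simpa using hp0, mem_WD.1 p.2, fun l hl => ?_⟩
  have := congrFun (LinearMap.mem_ker.1 hp) ⟨l, hl⟩
  exact congrArg Subtype.val this

lemma finrank_mul_WD (g : Poly) (hg : g ≠ 0) (n : ℕ) :
    Module.finrank ℝ ((WD n).map (LinearMap.mulLeft ℝ g)) = Module.finrank ℝ (WD n) :=
  (Submodule.equivMapOfInjective (LinearMap.mulLeft ℝ g) (fun _ _ h => mul_left_cancel₀ hg h) (WD n)).finrank_eq.symm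

instance (g : Poly) (n : ℕ) : Module.Finite ℝ ((WD n).map (LinearMap.mulLeft ℝ g)) :=
  Module.Finite.map _ _

lemma ideal_dim (g h : Poly) (hg : Irreducible g) (hgh : ¬ g ∣ h) (d e n : ℕ) (hd : g.totalDegree = d)
    (he : h.totalDegree = e) (hn : d + e ≤ n) :
    ∃ V : Submodule ℝ Poly, V ≤ WD n ∧ (∀ p ∈ V, ∃ a b, p = g * a + h * b) ∧
      Module.finrank ℝ (WD (n-d)) + Module.finrank ℝ (WD (n-e)) ≤
      Module.finrank ℝ V + Module.finrank ℝ (WD (n-d-e)) := by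
  have hg0 : g ≠ 0 := hg.ne_zero
  have hh0 : h ≠ 0 := fun e => hgh (e ▸ dvd_zero g)
  set A := (WD (n-d)).map (LinearMap.mulLeft ℝ g) with hA
  set B := (WD (n-e)).map (LinearMap.mulLeft ℝ h) with hB
  set E := (WD (n-d-e)).map (LinearMap.mulLeft ℝ (g*h)) with hE
  refine ⟨A ⊔ B, ?_, ?_, ?_⟩
  · refine sup_le ?_ ?_
    · rintro _ ⟨p, hp, rfl⟩
      rw [SetLike.mem_coe, mem_WD] at hp
      rw [mem_WD]
      refine (totalDegree_mul _ _).trans ?_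
      omega
    · rintro _ ⟨p, hp, rfl⟩
      rw [SetLike.mem_coe, mem_WD] at hp
      rw [mem_WD]
      refine (totalDegree_mul _ _).trans ?_
      omega
  · intro p hp
    obtain ⟨_, ⟨a, -, rfl⟩, _, ⟨b, -, rfl⟩, rfl⟩ := Submodule.mem_sup.1 hp
    exact ⟨a, b, rfl⟩
  · have h1 := Submodule.finrank_sup_add_finrank_inf_eq A B
    have h2 : A ⊓ B ≤ E := by
      rintro p ⟨⟨a, ha, hpa⟩, ⟨b, hb, hpb⟩⟩
      simp only [LinearMap.mulLeft_apply] at hpa hpb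
      have : g ∣ h * b := ⟨a, by rw [hpa, hpb]⟩
      obtain ⟨k, rfl⟩ := (hg.prime.dvd_or_dvd this).resolve_left hgh
      refine ⟨k, ?_, ?_⟩
      · rw [SetLike.mem_coe, mem_WD] at *
        by_cases hk : k = 0
        · simp [hk]
        · rw [totalDegree_mul_of_isDomain hg0 hk] at hb
          omega
      · simp only [LinearMap.mulLeft_apply]
        rw [← hpb]; ring
    have h3 := Submodule.finrank_mono h2
    have h4 := finrank_mul_WD g hg0 (n-d)
    have h5 := finrank_mul_WD h hh0 (n-e)
    have h6 := finrank_mul_WD (g*h) (mul_ne_zero hg0 hh0) (n-d-e)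
    rw [← hA] at h4
    rw [← hB] at h5
    rw [← hE] at h6
    omega

lemma bez_num (w1 w2 w3 w4 d e M : ℕ) (n : ℕ)
    (e1 : 6 * w1 = (M*M+M+d+e+1) * (M*M+M+d+e+2) * (M*M+M+d+e+3))
    (e2 : 6 * w2 = (M*M+M+e+1) * (M*M+M+e+2) * (M*M+M+e+3))
    (e3 : 6 * w3 = (M*M+M+d+1) * (M*M+M+d+2) * (M*M+M+d+3))
    (e4 : 6 * w4 = (M*M+M+1) * (M*M+M+2) * (M*M+M+3))
    (key : w2 + w3 + M * (M*M+d+e+2) ≤ w1 + w4) (hlt : d * e < M) : False := by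
  have key2 : 6 * w1 + 6 * w4 + (3 * (d*e*d) + 3 * (d*e*e)) = 6 * w2 + 6 * w3 + 6 * ((d*e) * (M*M+M+d+e+2)) := by
    rw [e1, e2, e3, e4]; ring
  have key3 : M * (M*M+d+e+2) ≤ (d*e) * (M*M+M+d+e+2) := by omega
  obtain ⟨m, rfl⟩ : ∃ m, M = m + 1 := ⟨M - 1, by omega⟩
  have key4 : (d*e) * ((m+1)*(m+1)+(m+1)+d+e+2) ≤ m * ((m+1)*(m+1)+(m+1)+d+e+2) := Nat.mul_le_mul_right _ (by omega)
  have key5 := key3.trans key4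
  ring_nf at key5
  omega

theorem bez (g h : Poly) (hg : Irreducible g) (hgh : ¬ g ∣ h) (S : Finset Ln)
    (h1 : ∀ l ∈ S, res l g = 0) (h2 : ∀ l ∈ S, res l h = 0) :
    S.card ≤ g.totalDegree * h.totalDegree := by
  classical
  by_contra hlt
  push Not at hlt
  set d := g.totalDegree with hd
  set e := h.totalDegree with he
  set M := S.card with hM
  set n := M*M + M + d + e with hn
  obtain ⟨V, hV, hV2, hdim⟩ := ideal_dim g h hg hgh d e n rfl rfl (by omega)
  have : ∀ l : Ln, ∃ u : Poly, l ∈ S → u.totalDegree + 1 ≤ M ∧ (∀ m ∈ S, m ≠ l → res m u = 0) ∧ res l u ≠ 0 := by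
    intro l
    by_cases hl : l ∈ S
    · obtain ⟨u, a, b, c⟩ := exists_sep l (S.erase l) (by simp)
      refine ⟨u, fun _ => ⟨?_, fun m hm hne => b m (by simp [hm, hne]), c⟩⟩
      have := Finset.card_erase_add_one hl
      omega
    · exact ⟨0, fun h => (hl h).elim⟩
  choose u hu using this
  let z : Polynomial ℝ →ₐ[ℝ] Poly := Polynomial.aeval (X 2)
  have hz : ∀ l q, res l (z q) = q := by
    intro l q
    have : (res l).comp z = AlgHom.id ℝ _ := by
      ext; simp [z, res]
    exact congrArg (fun f : Polynomial ℝ →ₐ[ℝ] Polynomial ℝ => f q) this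
  have hzd : ∀ q, (z q).totalDegree ≤ q.natDegree := by
    intro q
    simp only [z, Polynomial.aeval_eq_sum_range]
    refine totalDegree_finsetSum_le fun i hi => ?_
    refine (totalDegree_smul_le _ _).trans ?_
    refine (totalDegree_pow _ _).trans ?_
    simp at hi ⊢; omega
  let k := n - M + 2
  let T : (S → Polynomial.degreeLT ℝ k) →ₗ[ℝ] Poly :=
    ∑ i : S, (LinearMap.mulLeft ℝ (u i)) ∘ₗ z.toLinearMap ∘ₗ (Polynomial.degreeLT ℝ k).subtype ∘ₗ LinearMap.proj i
  have hT : ∀ q, T q = ∑ i : S, u i * z (q i).1 := by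
    intro q; simp [T]
  have hTres : ∀ q (i : S), res i (T q) = res i (u i) * (q i).1 := by
    intro q i
    rw [hT, map_sum, Finset.sum_eq_single i]
    · rw [map_mul, hz]
    · intro j _ hji
      rw [map_mul, (hu j j.2).2.1 i i.2 (fun h => hji (Subtype.ext h.symm)), zero_mul]
    · simp
  have hk0 : ∀ q, (∀ i : S, res i (T q) = 0) → q = 0 := by
    intro q hq
    funext i
    have := hq i
    rw [hTres] at this
    exact Subtype.ext ((mul_eq_zero.1 this).resolve_left (hu i i.2).2.2)
  have hTi : Function.Injective T := by
    rw [← LinearMap.ker_eq_bot, LinearMap.ker_eq_bot']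
    intro q hq
    exact hk0 q (fun i => by simp [hq])
  have hTr : LinearMap.range T ≤ WD n := by
    rintro _ ⟨q, rfl⟩
    rw [hT, mem_WD]
    refine totalDegree_finsetSum_le fun i _ => ?_
    refine (totalDegree_mul _ _).trans ?_
    have a1 := (hu i i.2).1
    have a2 := hzd (q i).1
    have a3 : (q i).1.natDegree < k ∨ (q i).1 = 0 := by
      by_cases h0 : (q i).1 = 0
      · right; exact h0
      · left
        have := Polynomial.mem_degreeLT.1 (q i).2
        exact (Polynomial.natDegree_lt_iff_degree_lt h0).2 this
    rcases a3 with a3 | a3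
    · omega
    · rw [a3]; simp; omega
  have hdis : V ⊓ LinearMap.range T = ⊥ := by
    rw [eq_bot_iff]
    rintro p ⟨hp, q, rfl⟩
    obtain ⟨a, b, hab⟩ := hV2 _ hp
    have : q = 0 := hk0 q (fun i => by rw [hab]; simp [h1 i i.2, h2 i i.2])
    simp [this]
  have hf : Module.finrank ℝ (LinearMap.range T) = M * k := by
    rw [LinearMap.finrank_range_of_inj hTi, Module.finrank_pi_fintype]
    simp [LinearEquiv.finrank_eq (Polynomial.degreeLTEquiv ℝ k), hM]
  have hfin : Module.Finite ℝ V := Submodule.finiteDimensional_of_le hV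
  have hs := Submodule.finrank_sup_add_finrank_inf_eq V (LinearMap.range T)
  rw [hdis, finrank_bot, hf] at hs
  have hsup := Submodule.finrank_mono (sup_le hV hTr)
  have e1 := finrank_WD n
  have e2 := finrank_WD (n-d)
  have e3 := finrank_WD (n-e)
  have e4 := finrank_WD (n-d-e)
  have f1 : n = (n - d - e) + d + e := by omega
  have f2 : n - d = (n - d - e) + e := by omega
  have f3 : n - e = (n - d - e) + d := by omega
  have f4 : k = M * M + d + e + 2 := by omega
  have f5 : n - d - e = M * M + M := by omega
  rw [f5] at e4 f1 f2 f3 hdim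
  rw [f2] at e2 hdim
  rw [f3] at e3 hdim
  have hs2 : Module.finrank ℝ V + M * (M*M+d+e+2) ≤ Module.finrank ℝ (WD n) := by rw [← f4]; omega
  clear hs hsup hf hdis hTr hTi hk0 hTres hT hu T hz hzd hfin
  have f6 : n = M*M+M+d+e := hn
  rw [f6] at e1 hs2
  exact bez_num _ _ _ _ _ _ _ n e1 e2 e3 e4 (by omega) hlt
end GK
end
end

section
noncomputable section
namespace GK

section BU
variable {α β : Type*}

def dd : List α → (List α → ZMod 2) → ZMod 2
  | [], _ => 0
  | x :: l, φ => φ l + dd l (fun m => φ (x :: m))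

def pr (f g : α → β) : List α → (List β → ZMod 2) → ZMod 2
  | [], _ => 0
  | x :: l, φ => φ (f x :: g x :: l.map g) + pr f g l (fun m => φ (f x :: m))

lemma dd_add (l : List α) : ∀ φ ψ : List α → ZMod 2, dd l (fun m => φ m + ψ m) = dd l φ + dd l ψ := by
  induction l with
  | nil => intro φ ψ; simp [dd]
  | cons x l ih => intro φ ψ; simp only [dd]; rw [ih]; ring

lemma pr_add (f g : α → β) (l : List α) : ∀ φ ψ : List β → ZMod 2,
    pr f g l (fun m => φ m + ψ m) = pr f g l φ + pr f g l ψ := by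
  induction l with
  | nil => intro φ ψ; simp [pr]
  | cons x l ih => intro φ ψ; simp only [pr]; rw [ih]; ring

lemma dd_map (g : α → β) (l : List α) : ∀ φ : List β → ZMod 2,
    dd (l.map g) φ = dd l (fun m => φ (m.map g)) := by
  induction l with
  | nil => intro φ; simp [dd]
  | cons x l ih => intro φ; simp only [dd, List.map_cons]; rw [ih]

lemma two_zero (a : ZMod 2) : a + a = 0 := CharTwo.add_self_eq_zero a

lemma pr_dd (f g : α → β) (l : List α) : ∀ φ : List β → ZMod 2,
    pr f g l (fun m => dd m φ) + dd l (fun m => pr f g m φ) = φ (l.map f) + φ (l.map g) := by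
  induction l with
  | nil => intro φ; simp [pr, dd, two_zero]
  | cons x l ih =>
    intro φ
    simp only [pr, dd, List.map_cons, dd_map]
    rw [pr_add, dd_add]
    have h := ih (fun m => φ (f x :: m))
    have h1 := two_zero (pr f g l φ)
    have h2 := two_zero (dd l (fun m => φ (f x :: g x :: m.map g)))
    have h3 := two_zero (φ (f x :: l.map g))
    linear_combination h + h1 + h2 + h3

lemma pr_supp (f g : α → β) (l : List α) : ∀ (φ : List β → ZMod 2),
    (∀ m : List β, m.length = l.length + 1 → (∀ y ∈ m, ∃ x ∈ l, y = f x ∨ y = g x) → φ m = 0) →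
    pr f g l φ = 0 := by
  induction l with
  | nil => intro φ _; simp [pr]
  | cons x l ih =>
    intro φ h
    simp only [pr]
    rw [h, ih, zero_add]
    · intro m hm hy
      apply h
      · simp [hm]
      · intro y hy'
        rcases List.mem_cons.1 hy' with rfl | hy'
        · exact ⟨x, by simp, by simp⟩
        · obtain ⟨a, ha, h2⟩ := hy y hy'
          exact ⟨a, by simp [ha], h2⟩
    · simp
    · intro y hy
      simp only [List.mem_cons, List.mem_map] at hy
      rcases hy with rfl | rfl | ⟨a, ha, rfl⟩
      · exact ⟨x, by simp, by simp⟩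
      · exact ⟨x, by simp, by simp⟩
      · exact ⟨a, by simp [ha], by simp⟩

lemma dd_congr (l : List α) : ∀ φ ψ : List α → ZMod 2, (∀ m, m.Sublist l → φ m = ψ m) →
    dd l φ = dd l ψ := by
  induction l with
  | nil => intro φ ψ _; simp [dd]
  | cons x l ih =>
    intro φ ψ h
    simp only [dd]
    rw [h l (by simp), ih _ (fun m => ψ (x :: m)) (fun m hm => h _ (hm.cons_cons x))]

lemma dd_perm {l l' : List α} (h : l.Perm l') : ∀ φ : Multiset α → ZMod 2,
    dd l (fun m => φ m) = dd l' (fun m => φ m) := by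
  induction h with
  | nil => intro φ; rfl
  | cons x h ih =>
    intro φ
    simp only [dd]
    rw [Multiset.coe_eq_coe.2 h]
    have := ih (fun m => φ (x ::ₘ m))
    simp only [Multiset.cons_coe] at this
    rw [this]
  | swap x y l =>
    intro φ
    simp only [dd]
    have : ∀ m : List α, (↑(y :: x :: m) : Multiset α) = ↑(x :: y :: m) := fun m =>
      Multiset.coe_eq_coe.2 (List.Perm.swap _ _ _)
    simp only [this]
    ring
  | trans _ _ h1 h2 => intro φ; rw [h1, h2]

abbrev Lb := ℕ ×ₗ Bool
def lv (x : Lb) : ℕ := (ofLex x).1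
def sg (x : Lb) : Bool := (ofLex x).2

lemma lb_ext {x y : Lb} (h : lv x = lv y) (h' : sg x = sg y) : x = y := by
  apply ofLex.injective
  exact Prod.ext h h'

open Classical in
def alt : Bool → List Lb → ZMod 2
  | _, [] => 1
  | s, x :: l => if sg x = s ∧ ∀ y ∈ l, lv x < lv y then alt (!s) l else 0

lemma alt_dd (l : List Lb) : ∀ s, l.Pairwise (fun x y => lv x ≤ lv y) →
    (∀ x ∈ l, ∀ y ∈ l, lv x = lv y → sg x = sg y) → dd l (alt s) = alt s l + alt (!s) l := by
  induction l with
  | nil => intro s _ _; simp only [dd, alt]; rfl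
  | cons x l ih =>
    intro s hs hc
    rw [List.pairwise_cons] at hs
    by_cases hx : ∀ y ∈ l, lv x < lv y
    · simp only [dd]
      have h1 : dd l (fun m => alt s (x :: m)) = if sg x = s then dd l (alt (!s)) else dd l (fun _ => 0) := by
        split_ifs with h
        · apply dd_congr
          intro m hm
          simp only [alt]
          rw [if_pos ⟨h, fun y hy => hx y (hm.subset hy)⟩]
        · apply dd_congr
          intro m hm
          simp [alt, h]
      have h0 : dd l (fun _ => (0 : ZMod 2)) = 0 := by
        have := dd_add l (fun _ => 0) (fun _ => 0)
        simpa using this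
      have h2 := ih (!s) hs.2 (fun a ha b hb => hc a (by simp [ha]) b (by simp [hb]))
      rw [h1, h2, h0]
      have hA : ∀ s, alt s (x :: l) = if sg x = s then alt (!s) l else 0 := by
        intro s
        simp only [alt]
        by_cases h : sg x = s
        · rw [if_pos ⟨h, hx⟩, if_pos h]
        · rw [if_neg (fun h' => h h'.1), if_neg h]
      rw [hA, hA]
      simp only [Bool.not_not]
      have := two_zero (alt s l)
      rcases Bool.eq_or_eq_not (sg x) s with h | h
      · simp [h]
        linear_combination this
      · simp [h]
    · have hl : ∃ l', l = x :: l' := by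
        cases l with
        | nil => simp at hx
        | cons y l' =>
          refine ⟨l', ?_⟩
          congr 1
          push Not at hx
          obtain ⟨z, hz, hzx⟩ := hx
          have h1 : lv y ≤ lv z := by
            rcases List.mem_cons.1 hz with rfl | hz
            · exact le_rfl
            · exact (List.pairwise_cons.1 hs.2).1 z hz
          have h2 := hs.1 y (by simp)
          have h3 : lv y = lv x := by omega
          exact lb_ext h3 (hc y (by simp) x (by simp) h3)
      obtain ⟨l', rfl⟩ := hl
      have hz : ∀ s m, alt s (x :: x :: m) = 0 := by
        intro s m; simp [alt]
      have h0 : dd l' (fun _ => (0 : ZMod 2)) = 0 := by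
        have := dd_add l' (fun _ => 0) (fun _ => 0)
        simpa using this
      simp only [dd, hz, h0]
      have := two_zero (alt s (x :: l'))
      linear_combination this

def fan (lab : α → Lb) (l : List α) : ZMod 2 := alt true ((↑(l.map lab) : Multiset Lb).sort (· ≤ ·))

lemma alt_not (l : List Lb) : ∀ s, alt s (l.map fun x => toLex (lv x, !sg x)) = alt (!s) l := by
  induction l with
  | nil => intro s; rfl
  | cons x l ih =>
    intro s
    simp only [List.map_cons, alt, ih]
    have : ∀ z : Lb, lv (toLex (lv z, !sg z)) = lv z := fun z => rfl
    have h2 : ∀ z : Lb, sg (toLex (lv z, !sg z)) = !sg z := fun z => rfl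
    simp only [List.mem_map, forall_exists_index, and_imp, forall_apply_eq_imp_iff₂, this, h2, Bool.not_eq_eq_eq_not]

lemma alt_length (n : ℕ) (l : List Lb) (hn : ∀ x ∈ l, lv x < n) (s : Bool) (h : alt s l ≠ 0) : l.length ≤ n := by
  have h1 : ∀ (l : List Lb) s, alt s l ≠ 0 → (l.map lv).Nodup := by
    intro l
    induction l with
    | nil => intro s _; simp
    | cons x l ih =>
      intro s h
      simp only [alt] at h
      split_ifs at h with hx
      · simp only [List.map_cons, List.nodup_cons, List.mem_map, not_exists, not_and]
        refine ⟨fun y hy e => ?_, ih _ h⟩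
        have := hx.2 y hy
        omega
      · exact (h rfl).elim
  have h2 := List.toFinset_card_of_nodup (h1 l s h)
  have h3 : (l.map lv).toFinset ⊆ Finset.range n := by
    intro k hk
    rw [List.mem_toFinset, List.mem_map] at hk
    obtain ⟨x, hx, rfl⟩ := hk
    exact Finset.mem_range.2 (hn x hx)
  have := Finset.card_le_card h3
  simp at h2 this
  omega

lemma sort_not_aux (M : Multiset Lb) (hc : ∀ x ∈ M, ∀ y ∈ M, lv x = lv y → sg x = sg y) :
    (M.map fun x => toLex (lv x, !sg x)).sort (· ≤ ·) = (M.sort (· ≤ ·)).map fun x => toLex (lv x, !sg x) := by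
  apply List.Perm.eq_of_pairwise' (r := (· ≤ ·))
  · exact Multiset.pairwise_sort _ _
  · rw [List.pairwise_map]
    refine List.Pairwise.imp_of_mem ?_ (Multiset.pairwise_sort M (· ≤ ·))
    intro a b ha hb hab
    rw [Multiset.mem_sort] at ha hb
    rw [Prod.Lex.le_iff] at hab ⊢
    rcases hab with h | ⟨h, h'⟩
    · left; exact h
    · right; refine ⟨h, ?_⟩
      have := hc a ha b hb h
      show (!sg a) ≤ (!sg b)
      rw [this]
  · rw [← Multiset.coe_eq_coe, Multiset.sort_eq, ← Multiset.map_coe, Multiset.sort_eq]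

lemma fan_dd (lab : α → Lb) (ν : α → α) (l : List α)
    (hν : ∀ x ∈ l, lab (ν x) = toLex (lv (lab x), !sg (lab x)))
    (hc : ∀ x ∈ l, ∀ y ∈ l, lv (lab x) = lv (lab y) → sg (lab x) = sg (lab y)) :
    dd l (fan lab) = fan lab l + fan lab (l.map ν) := by
  set M : Multiset Lb := ↑(l.map lab) with hM
  have hcM : ∀ x ∈ M, ∀ y ∈ M, lv x = lv y → sg x = sg y := by
    intro x hx y hy
    simp only [hM, Multiset.mem_coe, List.mem_map] at hx hy
    obtain ⟨a, ha, rfl⟩ := hx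
    obtain ⟨b, hb, rfl⟩ := hy
    exact hc a ha b hb
  have h1 : dd l (fan lab) = dd (M.sort (· ≤ ·)) (fun m => alt true ((↑m : Multiset Lb).sort (· ≤ ·))) := by
    have hp : (M.sort (· ≤ ·)).Perm (l.map lab) := by
      rw [← Multiset.coe_eq_coe, Multiset.sort_eq]
    rw [dd_perm hp (fun m => alt true (m.sort (· ≤ ·))), dd_map]
    rfl
  have h2 : dd (M.sort (· ≤ ·)) (fun m => alt true ((↑m : Multiset Lb).sort (· ≤ ·))) =
      dd (M.sort (· ≤ ·)) (alt true) := by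
    apply dd_congr
    intro m hm
    congr 1
    apply List.Perm.eq_of_pairwise' (r := (· ≤ ·))
    · exact Multiset.pairwise_sort _ _
    · exact (Multiset.pairwise_sort M (· ≤ ·)).sublist hm
    · rw [← Multiset.coe_eq_coe, Multiset.sort_eq]
  have h3 : fan lab (l.map ν) = alt false (M.sort (· ≤ ·)) := by
    unfold fan
    have : (↑((l.map ν).map lab) : Multiset Lb) = M.map fun x => toLex (lv x, !sg x) := by
      rw [hM, Multiset.map_coe, List.map_map, List.map_map]
      congr 1
      apply List.map_congr_left
      intro x hx
      exact hν x hx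
    rw [this, sort_not_aux M hcM, alt_not]
    rfl
  rw [h1, h2, h3, alt_dd]
  · rfl
  · refine (Multiset.pairwise_sort M (· ≤ ·)).imp ?_
    intro a b hab
    rw [Prod.Lex.le_iff] at hab
    rcases hab with h | h
    · exact h.le
    · exact h.1.le
  · intro x hx y hy
    rw [Multiset.mem_sort] at hx hy
    exact hcM x hx y hy

end BU
end GK
end
end

section
noncomputable section
namespace GK

section BU2
variable {m : ℕ}

def Good (k : ℕ) (δ : ℝ) (l : List (Fin m → ℝ)) : Prop :=
  l.length = k + 1 ∧ (∀ x ∈ l, ∑ i, |x i| = 1 ∧ ∀ i : Fin m, k < i.val → x i = 0) ∧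
    ∀ x ∈ l, ∀ y ∈ l, dist x y ≤ k * δ

def hmt (e : (Fin m → ℝ)) (N s : ℕ) (x : (Fin m → ℝ)) : (Fin m → ℝ) := fun i => (1 - (s:ℝ)/N) * x i + ((s:ℝ)/N) * e i

def coneC (z : (List (Fin m → ℝ) → ZMod 2) →+ ZMod 2) (e : (Fin m → ℝ)) (N : ℕ) : (List (Fin m → ℝ) → ZMod 2) →+ ZMod 2 :=
  AddMonoidHom.mk' (fun φ => ∑ s ∈ Finset.range N, z (fun l => pr (hmt e N s) (hmt e N (s+1)) l φ) +
    z (fun l => φ (e :: l.map (hmt e N N)))) (by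
    intro φ ψ
    have h1 : ∀ s, z (fun l => pr (hmt e N s) (hmt e N (s+1)) l (φ + ψ)) =
        z (fun l => pr (hmt e N s) (hmt e N (s+1)) l φ) + z (fun l => pr (hmt e N s) (hmt e N (s+1)) l ψ) := by
      intro s
      rw [← map_add]
      congr 1
      funext l
      exact pr_add _ _ _ _ _
    have h2 : z (fun l => (φ + ψ) (e :: l.map (hmt e N N))) = z (fun l => φ (e :: l.map (hmt e N N))) +
        z (fun l => ψ (e :: l.map (hmt e N N))) := by
      rw [← map_add]; rfl
    simp only [h1, h2, Finset.sum_add_distrib]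
    ring)

lemma coneC_apply (z : (List (Fin m → ℝ) → ZMod 2) →+ ZMod 2) (e : (Fin m → ℝ)) (N : ℕ) (φ : List (Fin m → ℝ) → ZMod 2) :
    coneC z e N φ = ∑ s ∈ Finset.range N, z (fun l => pr (hmt e N s) (hmt e N (s+1)) l φ) +
    z (fun l => φ (e :: l.map (hmt e N N))) := rfl

lemma coneC_dd (z : (List (Fin m → ℝ) → ZMod 2) →+ ZMod 2) (hz : ∀ φ, z (fun l => dd l φ) = 0) (e : (Fin m → ℝ)) (N : ℕ)
    (φ : List (Fin m → ℝ) → ZMod 2) : coneC z e N (fun l => dd l φ) = z φ := by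
  rw [coneC_apply]
  have h1 : ∀ s, z (fun l => pr (hmt e N s) (hmt e N (s+1)) l (fun l => dd l φ)) =
      z (fun l => φ (l.map (hmt e N (s+1)))) - z (fun l => φ (l.map (hmt e N s))) := by
    intro s
    have a := congrArg z (funext fun l => pr_dd (hmt e N s) (hmt e N (s+1)) l φ)
    have b : z (fun l => pr (hmt e N s) (hmt e N (s+1)) l (fun m => dd m φ) + dd l (fun m => pr (hmt e N s) (hmt e N (s+1)) m φ))
      = z (fun l => pr (hmt e N s) (hmt e N (s+1)) l (fun m => dd m φ)) + z (fun l => dd l (fun m => pr (hmt e N s) (hmt e N (s+1)) m φ)) := by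
      rw [← map_add]; rfl
    have c : z (fun l => φ (l.map (hmt e N s)) + φ (l.map (hmt e N (s+1)))) =
      z (fun l => φ (l.map (hmt e N s))) + z (fun l => φ (l.map (hmt e N (s+1)))) := by
      rw [← map_add]; rfl
    rw [b, c, hz, add_zero] at a
    rw [a]
    have := two_zero (z (fun l => φ (l.map (hmt e N s))))
    linear_combination this
  have h2 : z (fun l => dd (e :: l.map (hmt e N N)) φ) = z (fun l => φ (l.map (hmt e N N))) := by
    have a : (fun l => dd (e :: l.map (hmt e N N)) φ) = (fun l => φ (l.map (hmt e N N))) +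
        (fun l => dd l (fun m => φ (e :: m.map (hmt e N N)))) := by
      funext l
      simp only [dd, dd_map, Pi.add_apply]
    rw [a, map_add, hz, add_zero]
  have h0 : hmt e N 0 = id := by
    funext x i; simp [hmt]
  rw [Finset.sum_congr rfl (fun s _ => h1 s), Finset.sum_range_sub (fun s => z (fun l => φ (l.map (hmt e N s)))), h2, h0]
  simp only [List.map_id]
  have := two_zero (z (fun l => φ (l.map (hmt e N N))))
  have h3 := two_zero (z φ)
  linear_combination this - h3

lemma coneC_supp (z : (List (Fin m → ℝ) → ZMod 2) →+ ZMod 2) (k : ℕ) (δ : ℝ) (hδ : 0 ≤ δ)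
    (hz : ∀ φ, (∀ l, Good k δ l → φ l = 0) → z φ = 0) (N : ℕ) (hN : 0 < N) (hN2 : 2 ≤ δ * N) (j : Fin m)
    (hj : j.val = k + 1) (φ : List (Fin m → ℝ) → ZMod 2) (hφ : ∀ l, Good (k+1) δ l → φ l = 0) :
    coneC z (Pi.single j 1) N φ = 0 := by
  set e : (Fin m → ℝ) := Pi.single j 1 with he
  have hN' : (0:ℝ) < N := by exact_mod_cast hN
  have n1 : ∀ x : (Fin m → ℝ), (∀ i : Fin m, k < i.val → x i = 0) → ∑ i, |x i| = 1 → ∀ s ≤ N,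
      ∑ i, |hmt e N s x i| = 1 ∧ ∀ i : Fin m, k + 1 < i.val → hmt e N s x i = 0 := by
    intro x hx hx1 s hs
    have hs' : (s:ℝ)/N ≤ 1 := by rw [div_le_one hN']; exact_mod_cast hs
    have hs0 : 0 ≤ (s:ℝ)/N := by positivity
    constructor
    · have hxj : x j = 0 := hx j (by omega)
      have : ∀ i, |hmt e N s x i| = (1 - (s:ℝ)/N) * |x i| + ((s:ℝ)/N) * e i := by
        intro i
        simp only [hmt]
        by_cases hi : i = j
        · subst hi
          simp [hxj, he, abs_of_nonneg hs0]
        · simp [he, hi, abs_mul, abs_of_nonneg (sub_nonneg.2 hs')]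
      simp only [this, Finset.sum_add_distrib, ← Finset.mul_sum, hx1]
      simp [he]
    · intro i hi
      have hij : i ≠ j := by rintro rfl; omega
      simp [hmt, hx i (by omega), he, hij]
  have nb : ∀ x : (Fin m → ℝ), ∑ i, |x i| = 1 → ∀ i, |x i| ≤ 1 := by
    intro x hx i
    rw [← hx]
    exact Finset.single_le_sum (f := fun i => |x i|) (fun i _ => abs_nonneg _) (Finset.mem_univ i)
  have e1 : ∀ i, |e i| ≤ 1 := by
    intro i; by_cases h : i = j
    · subst h; simp [he]
    · simp [he, h]
  have n2 : ∀ x y : (Fin m → ℝ), ∑ i, |x i| = 1 → ∑ i, |y i| = 1 → dist x y ≤ k * δ → ∀ s t, s ≤ N → t ≤ N → s ≤ t + 1 → t ≤ s + 1 →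
      dist (hmt e N s x) (hmt e N t y) ≤ (k+1 : ℕ) * δ := by
    intro x y hx hy hxy s t hs ht hst hts
    rw [dist_pi_le_iff (by positivity)] at hxy ⊢
    intro i
    have h1 := hxy i
    rw [Real.dist_eq] at *
    have eq : hmt e N s x i - hmt e N t y i = (1 - (s:ℝ)/N) * (x i - y i) + ((s:ℝ)/N - (t:ℝ)/N) * (e i - y i) := by
      simp only [hmt]; ring
    rw [eq]
    have hs' : (s:ℝ)/N ≤ 1 := by rw [div_le_one hN']; exact_mod_cast hs
    have hs0 : 0 ≤ (s:ℝ)/N := by positivity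
    have a1 : |(1 - (s:ℝ)/N) * (x i - y i)| ≤ k * δ := by
      rw [abs_mul, abs_of_nonneg (sub_nonneg.2 hs')]
      nlinarith [abs_nonneg (x i - y i)]
    have a2 : |(s:ℝ)/N - (t:ℝ)/N| ≤ 1 / N := by
      rw [← sub_div, abs_div, abs_of_pos hN']
      gcongr
      rw [abs_le]
      have : (s:ℝ) ≤ t + 1 := by exact_mod_cast hst
      have : (t:ℝ) ≤ s + 1 := by exact_mod_cast hts
      constructor <;> linarith
    have a3 : |e i - y i| ≤ 2 := by
      have := abs_sub (e i) (y i)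
      linarith [e1 i, nb y hy i]
    have a4 : |((s:ℝ)/N - (t:ℝ)/N) * (e i - y i)| ≤ δ := by
      rw [abs_mul]
      calc _ ≤ 1 / (N:ℝ) * 2 := by gcongr
        _ ≤ δ := by rw [div_mul_eq_mul_div, div_le_iff₀ hN']; linarith
    refine (abs_add_le _ _).trans ?_
    push_cast
    linarith
  have hNN : ∀ x, hmt e N N x = e := by
    intro x; funext i; simp [hmt, div_self hN'.ne']
  rw [coneC_apply, Finset.sum_eq_zero, zero_add]
  · apply hz
    intro l hl
    apply hφ
    have hall : ∀ x ∈ (e :: l.map (hmt e N N)), x = e := by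
      intro x hx
      simp only [List.mem_cons, List.mem_map, hNN] at hx
      rcases hx with h | ⟨_, _, h⟩
      · exact h
      · exact h.symm
    refine ⟨by simp [hl.1], ?_, ?_⟩
    · intro x hx
      rw [hall x hx]
      constructor
      · rw [Finset.sum_eq_single j]
        · simp [he]
        · intro b _ hb; simp [he, hb]
        · simp
      · intro i hi
        have hij : i ≠ j := by rintro rfl; omega
        simp [he, hij]
    · intro x hx y hy
      rw [hall x hx, hall y hy, dist_self]; positivity
  · intro s hs
    rw [Finset.mem_range] at hs
    apply hz
    intro l hl
    apply pr_supp
    intro M hM hy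
    apply hφ
    have hy2 : ∀ y ∈ M, ∃ x ∈ l, ∃ t, (t = s ∨ t = s + 1) ∧ y = hmt e N t x := by
      intro y hyM
      obtain ⟨x, hx, h | h⟩ := hy y hyM
      · exact ⟨x, hx, s, by simp, h⟩
      · exact ⟨x, hx, s+1, by simp, h⟩
    refine ⟨by rw [hM, hl.1], ?_, ?_⟩
    · intro y hyM
      obtain ⟨x, hx, t, ht, rfl⟩ := hy2 y hyM
      exact n1 x (hl.2.1 x hx).2 (hl.2.1 x hx).1 t (by omega)
    · intro y hyM y' hyM'
      obtain ⟨x, hx, t, ht, rfl⟩ := hy2 y hyM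
      obtain ⟨x', hx', t', ht', rfl⟩ := hy2 y' hyM'
      exact n2 x x' (hl.2.1 x hx).1 (hl.2.1 x' hx').1 (hl.2.2 x hx x' hx') t t' (by omega) (by omega) (by omega) (by omega)

lemma good_neg {k : ℕ} {δ : ℝ} {l : List (Fin m → ℝ)} (h : Good k δ l) : Good k δ (l.map Neg.neg) := by
  refine ⟨by simp [h.1], ?_, ?_⟩
  · intro x hx
    obtain ⟨y, hy, rfl⟩ := List.mem_map.1 hx
    have := h.2.1 y hy
    exact ⟨by simpa using this.1, fun i hi => by simp [this.2 i hi]⟩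
  · intro x hx x' hx'
    obtain ⟨y, hy, rfl⟩ := List.mem_map.1 hx
    obtain ⟨y', hy', rfl⟩ := List.mem_map.1 hx'
    rw [dist_neg_neg]
    exact h.2.2 y hy y' hy'

lemma chain_exists (lab : (Fin m → ℝ) → Lb) (δ : ℝ) (hδ : 0 < δ)
    (hν : ∀ x : (Fin m → ℝ), ∑ i, |x i| = 1 → lab (-x) = toLex (lv (lab x), !sg (lab x)))
    (hc : ∀ x y : (Fin m → ℝ), ∑ i, |x i| = 1 → ∑ i, |y i| = 1 → dist x y ≤ m * δ → lv (lab x) = lv (lab y) → sg (lab x) = sg (lab y))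
    (k : ℕ) (hk : k < m) : ∃ z : (List (Fin m → ℝ) → ZMod 2) →+ ZMod 2, (∀ φ, (∀ l, Good k δ l → φ l = 0) → z φ = 0) ∧
      (∀ φ, z (fun l => φ (l.map Neg.neg)) = z φ) ∧ (∀ φ, z (fun l => dd l φ) = 0) ∧ z (fan lab) = 1 := by
  induction k with
  | zero =>
    set e : (Fin m → ℝ) := Pi.single ⟨0, hk⟩ 1 with he
    have hes : ∑ i, |e i| = 1 := by
      rw [Finset.sum_eq_single ⟨0, hk⟩]
      · simp [he]
      · intro b _ hb; simp [he, hb]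
      · simp
    have hg : Good 0 δ [e] := by
      refine ⟨by simp, ?_, ?_⟩
      · intro x hx
        rw [List.mem_singleton] at hx
        subst hx
        refine ⟨hes, fun i hi => ?_⟩
        have : i ≠ ⟨0, hk⟩ := by rintro rfl; simp at hi
        simp [he, this]
      · intro x hx y hy
        rw [List.mem_singleton] at hx hy
        simp [hx, hy]
    refine ⟨AddMonoidHom.mk' (fun φ => φ [e] + φ [-e]) (fun φ ψ => by simp only [Pi.add_apply]; ring), ?_, ?_, ?_, ?_⟩
    · intro φ h
      have h2 := h _ (good_neg hg)
      simp only [List.map_cons, List.map_nil] at h2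
      simp [h _ hg, h2]
    · intro φ
      simp [add_comm]
    · intro φ
      simp only [AddMonoidHom.mk'_apply, dd]
      have := two_zero (φ [])
      linear_combination this
    · simp only [AddMonoidHom.mk'_apply, fan, List.map_cons, List.map_nil, hν e hes]
      have : ∀ x : Lb, (↑[x] : Multiset Lb).sort (· ≤ ·) = [x] := fun x => Multiset.sort_singleton (r := (· ≤ ·)) x
      rw [this, this]
      have hs : sg (toLex (lv (lab e), !sg (lab e))) = !sg (lab e) := rfl
      simp only [alt, hs]
      cases sg (lab e) <;> simp
  | succ k ih =>
    obtain ⟨z, z1, z2, z3, z4⟩ := ih (by omega)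
    obtain ⟨N, hN⟩ := exists_nat_gt (2/δ)
    have hN0 : 0 < N := by
      have : (0:ℝ) < N := lt_trans (by positivity) hN
      exact_mod_cast this
    have hN2 : 2 ≤ δ * N := by
      rw [div_lt_iff₀ hδ] at hN; linarith
    set c := coneC z (Pi.single ⟨k+1, hk⟩ 1) N with hcdef
    have c1 := coneC_dd z z3 (Pi.single ⟨k+1, hk⟩ 1) N
    have c2 := coneC_supp z k δ hδ.le z1 N hN0 hN2 ⟨k+1, hk⟩ rfl
    rw [← hcdef] at c1 c2
    have hnn : ∀ l : List (Fin m → ℝ), (l.map Neg.neg).map Neg.neg = l := by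
      intro l; rw [List.map_map]; simp
    refine ⟨AddMonoidHom.mk' (fun φ => c φ + c (fun l => φ (l.map Neg.neg))) ?_, ?_, ?_, ?_, ?_⟩
    · intro φ ψ
      have : c (fun l => (φ + ψ) (l.map Neg.neg)) = c (fun l => φ (l.map Neg.neg)) + c (fun l => ψ (l.map Neg.neg)) := by
        rw [← map_add]; rfl
      rw [this, map_add]; ring
    · intro φ h
      simp only [AddMonoidHom.mk'_apply]
      rw [c2 _ h, c2 _ (fun l hl => h _ (good_neg hl)), add_zero]
    · intro φ
      simp only [AddMonoidHom.mk'_apply, hnn]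
      exact add_comm _ _
    · intro φ
      simp only [AddMonoidHom.mk'_apply, dd_map]
      rw [c1, c1, z2]
      exact two_zero _
    · simp only [AddMonoidHom.mk'_apply]
      rw [← map_add, ← z4, ← c1, ← sub_eq_zero, ← map_sub]
      apply c2
      intro l hl
      simp only [Pi.sub_apply, Pi.add_apply]
      rw [fan_dd lab Neg.neg l, sub_self]
      · intro x hx; exact hν x (hl.2.1 x hx).1
      · intro x hx y hy
        refine hc x y (hl.2.1 x hx).1 (hl.2.1 y hy).1 ((hl.2.2 x hx y hy).trans ?_)
        gcongr

end BU2

theorem borsuk_ulam (n : ℕ) (g : (Fin (n+1) → ℝ) → (Fin n → ℝ)) (hg : Continuous g)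
    (hodd : ∀ x, g (-x) = - g x) : ∃ x, ∑ i, |x i| = 1 ∧ g x = 0 := by
  classical
  by_contra hno
  push Not at hno
  set K : Set (Fin (n+1) → ℝ) := {x | ∑ i, |x i| = 1} with hK
  have hKc : IsCompact K := by
    apply Metric.isCompact_of_isClosed_isBounded
    · exact isClosed_eq (by fun_prop) continuous_const
    · refine (Metric.isBounded_closedBall (x := (0 : Fin (n+1) → ℝ)) (r := 1)).subset ?_
      intro x hx
      rw [mem_closedBall_zero_iff, pi_norm_le_iff_of_nonneg zero_le_one]
      intro i
      have hx' : ∑ i, |x i| = 1 := hx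
      rw [Real.norm_eq_abs, ← hx']
      exact Finset.single_le_sum (f := fun i => |x i|) (fun i _ => abs_nonneg _) (Finset.mem_univ i)
  have hKne : K.Nonempty := ⟨Pi.single 0 1, by
    show ∑ i, |(Pi.single 0 1 : Fin (n+1) → ℝ) i| = 1
    rw [Finset.sum_eq_single 0]
    · simp
    · intro b _ hb; simp [hb]
    · simp⟩
  obtain ⟨x0, hx0, hmin⟩ := hKc.exists_isMinOn hKne (hg.norm.continuousOn)
  set η := ‖g x0‖ with hη
  have hηpos : 0 < η := norm_pos_iff.2 (hno x0 hx0)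
  have hle : ∀ x ∈ K, η ≤ ‖g x‖ := fun x hx => hmin hx
  have hex : ∀ x ∈ K, ∃ i, η / 2 ≤ |g x i| := by
    intro x hx
    by_contra h
    push Not at h
    have h1 : ‖g x‖ ≤ η / 2 := by
      rw [pi_norm_le_iff_of_nonneg (by positivity)]
      intro i; rw [Real.norm_eq_abs]; exact (h i).le
    linarith [hle x hx]
  obtain ⟨i0, -⟩ := hex x0 hx0
  have : Nonempty (Fin n) := ⟨i0⟩
  let idx : (Fin (n+1) → ℝ) → Fin n := fun x => Classical.epsilon (fun i => η / 2 ≤ |g x i|)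
  have hidx : ∀ x ∈ K, η / 2 ≤ |g x (idx x)| := fun x hx => Classical.epsilon_spec (hex x hx)
  have hidxneg : ∀ x, idx (-x) = idx x := by
    intro x; simp only [idx, hodd, Pi.neg_apply, abs_neg]
  let lab : (Fin (n+1) → ℝ) → Lb := fun x => toLex ((idx x).val, decide (0 < g x (idx x)))
  obtain ⟨ε, hε, hu⟩ := Metric.uniformContinuousOn_iff.1 (hKc.uniformContinuousOn_of_continuous hg.continuousOn) η hηpos
  have hδ : 0 < ε / (2 * (n+1)) := by positivity
  have hB : ∀ x : Fin (n+1) → ℝ, ∑ i, |x i| = 1 → lab (-x) = toLex (lv (lab x), !sg (lab x)) := by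
    intro x hx
    have h1 : lv (lab x) = (idx x).val := rfl
    have h2 : sg (lab x) = decide (0 < g x (idx x)) := rfl
    rw [h1, h2]
    simp only [lab, hidxneg, hodd]
    congr 2
    have := hidx x hx
    have hne : g x (idx x) ≠ 0 := by
      intro h; rw [h, abs_zero] at this; linarith
    rcases lt_or_gt_of_ne hne with h | h
    · simp [h, h.le]
    · simp [h, h.le]
  have hC : ∀ x y : Fin (n+1) → ℝ, ∑ i, |x i| = 1 → ∑ i, |y i| = 1 → dist x y ≤ ((n+1 : ℕ) : ℝ) * (ε / (2*(n+1))) →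
      lv (lab x) = lv (lab y) → sg (lab x) = sg (lab y) := by
    intro x y hx hy hd hl
    have h1 : idx x = idx y := Fin.ext hl
    have h2 : dist x y < ε := by
      refine lt_of_le_of_lt hd ?_
      push_cast
      rw [← mul_div_assoc, div_lt_iff₀ (by positivity)]
      nlinarith
    have h3 := (dist_pi_lt_iff hηpos).1 (hu x hx y hy h2) (idx y)
    rw [Real.dist_eq, abs_lt] at h3
    have hxv := hidx x hx
    have hyv := hidx y hy
    rw [h1] at hxv
    show decide (0 < g x (idx x)) = decide (0 < g y (idx y))
    rw [h1]
    congr 1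
    apply propext
    rw [le_abs] at hxv hyv
    constructor
    · intro h
      rcases hyv with h' | h'
      · linarith
      · rcases hxv with h'' | h'' <;> linarith
    · intro h
      rcases hxv with h' | h'
      · linarith
      · rcases hyv with h'' | h'' <;> linarith
  obtain ⟨z, z1, -, -, z4⟩ := chain_exists lab (ε / (2*(n+1))) hδ hB hC n (by omega)
  · rw [z1] at z4
    · exact zero_ne_one z4
    · intro l hl
      by_contra hne
      have := alt_length n _ ?_ _ hne
      · simp [hl.1] at this
      · intro x hx
        simp only [Multiset.mem_sort, Multiset.mem_coe, List.mem_map] at hx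
        obtain ⟨y, -, rfl⟩ := hx
        exact (idx y).2
end GK
end
end

section
open MvPolynomial
noncomputable section
namespace GK

def clamp (t : ℝ) : ℝ := max (-1) (min 1 t)

lemma clamp_neg (t : ℝ) : clamp (-t) = - clamp t := by
  unfold clamp
  rcases le_total t 1 with h | h <;> rcases le_total (-1) t with h' | h'
  · rw [min_eq_right h, max_eq_right h', min_eq_right (by linarith), max_eq_right (by linarith)]
  · rw [min_eq_right h, max_eq_left h', min_eq_left (by linarith), max_eq_right (by linarith)]; ring
  · rw [min_eq_left h, max_eq_right (by norm_num : (-1:ℝ) ≤ 1), min_eq_right (by linarith), max_eq_left (by linarith)]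
  · linarith

lemma clamp_ge (t : ℝ) : -1 ≤ clamp t := le_max_left _ _
lemma clamp_one {t : ℝ} (h : 1 ≤ t) : clamp t = 1 := by
  unfold clamp; rw [min_eq_left h]; norm_num

lemma clamp_cont : Continuous clamp := by unfold clamp; fun_prop

lemma count_pos (S : Finset (Fin 3 → ℝ)) (f : Poly) (c : (Fin 3 → ℝ) → ℝ) (h0 : ∑ x ∈ S, c x = 0)
    (h1 : ∀ x, -1 ≤ c x) (h2 : ∀ x ∈ S, 0 < eval x f → c x = 1) :
    2 * (S.filter fun x => 0 < eval x f).card ≤ S.card := by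
  have h3 := Finset.sum_filter_add_sum_filter_not S (fun x => 0 < eval x f) c
  have h4 : ∑ x ∈ S.filter (fun x => 0 < eval x f), c x = (S.filter fun x => 0 < eval x f).card := by
    rw [Finset.sum_congr rfl (g := fun _ => (1:ℝ))]
    · simp
    · intro x hx; rw [Finset.mem_filter] at hx; exact h2 x hx.1 hx.2
  have h5 : -((S.filter fun x => ¬ 0 < eval x f).card : ℝ) ≤ ∑ x ∈ S.filter (fun x => ¬ 0 < eval x f), c x := by
    have := Finset.card_nsmul_le_sum (S.filter fun x => ¬ 0 < eval x f) c (-1) (fun x _ => h1 x)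
    simpa using this
  have h6 := Finset.card_filter_add_card_filter_not (s := S) (fun x => 0 < eval x f)
  have h7 : ((S.filter fun x => 0 < eval x f).card : ℝ) ≤ (S.filter fun x => ¬ 0 < eval x f).card := by linarith
  have h8 : (S.filter fun x => 0 < eval x f).card ≤ (S.filter fun x => ¬ 0 < eval x f).card := by exact_mod_cast h7
  omega

theorem ham_sandwich {n D : ℕ} (hD : n < Module.finrank ℝ (WD D)) (S : Fin n → Finset (Fin 3 → ℝ)) :
    ∃ f : Poly, f ≠ 0 ∧ f.totalDegree ≤ D ∧ ∀ i, 2 * ((S i).filter fun x => 0 < eval x f).card ≤ (S i).card ∧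
      2 * ((S i).filter fun x => eval x f < 0).card ≤ (S i).card := by
  classical
  let b := Module.finBasis ℝ (WD D)
  let v : Fin (n+1) → Poly := fun i => (b (Fin.castLE hD i)).1
  have hv : LinearIndependent ℝ v := by
    have h1 : LinearIndependent ℝ (fun i => b (Fin.castLE hD i)) :=
      b.linearIndependent.comp _ (Fin.castLE_injective _)
    exact h1.map' (WD D).subtype (Submodule.ker_subtype _)
  let L : (Fin (n+1) → ℝ) → Poly := fun c => ∑ i, c i • v i
  have hLe : ∀ c x, eval x (L c) = ∑ i, c i * eval x (v i) := by
    intro c x; simp [L, smul_eval]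
  have hLc : ∀ x, Continuous fun c => eval x (L c) := by
    intro x; simp only [hLe]; fun_prop
  have hBU : ∀ k : ℕ, ∃ c : Fin (n+1) → ℝ, ∑ i, |c i| = 1 ∧
      (fun i : Fin n => ∑ x ∈ S i, clamp (k * eval x (L c))) = 0 := by
    intro k
    apply borsuk_ulam n (fun c i => ∑ x ∈ S i, clamp (k * eval x (L c)))
    · refine continuous_pi fun i => continuous_finsetSum _ fun x _ => clamp_cont.comp (continuous_const.mul (hLc x))
    · intro c
      funext i
      simp only [Pi.neg_apply]
      rw [← Finset.sum_neg_distrib]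
      refine Finset.sum_congr rfl fun x _ => ?_
      rw [← clamp_neg]
      congr 1
      rw [hLe, hLe, ← mul_neg, ← Finset.sum_neg_distrib]
      simp
  choose c hc1 hc2 using hBU
  have hKc : IsCompact {x : Fin (n+1) → ℝ | ∑ i, |x i| = 1} := by
    apply Metric.isCompact_of_isClosed_isBounded
    · exact isClosed_eq (by fun_prop) continuous_const
    · refine (Metric.isBounded_closedBall (x := (0 : Fin (n+1) → ℝ)) (r := 1)).subset ?_
      intro x hx
      rw [mem_closedBall_zero_iff, pi_norm_le_iff_of_nonneg zero_le_one]
      intro i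
      have hx' : ∑ i, |x i| = 1 := hx
      rw [Real.norm_eq_abs, ← hx']
      exact Finset.single_le_sum (f := fun i => |x i|) (fun i _ => abs_nonneg _) (Finset.mem_univ i)
  obtain ⟨a, ha, φ, hφ, hlim⟩ := hKc.tendsto_subseq hc1
  have hφt : Filter.Tendsto (fun j => (φ j : ℝ)) Filter.atTop Filter.atTop :=
    tendsto_natCast_atTop_atTop.comp hφ.tendsto_atTop
  have hpos : ∀ x, 0 < eval x (L a) → ∀ᶠ j in Filter.atTop, 1 ≤ (φ j : ℝ) * eval x (L (c (φ j))) := by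
    intro x hx
    have : Filter.Tendsto (fun j => (φ j : ℝ) * eval x (L (c (φ j)))) Filter.atTop Filter.atTop :=
      hφt.atTop_mul_pos hx (((hLc x).tendsto a).comp hlim)
    exact this.eventually_ge_atTop 1
  have hneg : ∀ x, eval x (L a) < 0 → ∀ᶠ j in Filter.atTop, 1 ≤ -((φ j : ℝ) * eval x (L (c (φ j)))) := by
    intro x hx
    have : Filter.Tendsto (fun j => (φ j : ℝ) * eval x (L (c (φ j)))) Filter.atTop Filter.atBot :=
      hφt.atTop_mul_neg hx (((hLc x).tendsto a).comp hlim)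
    filter_upwards [this.eventually_le_atBot (-1)] with j hj
    linarith
  refine ⟨L a, ?_, ?_, ?_⟩
  · intro h0
    have h1 : ∀ i, a i = 0 := Fintype.linearIndependent_iff.1 hv a h0
    have h2 : ∑ i, |a i| = 1 := ha
    simp [h1] at h2
  · refine totalDegree_finsetSum_le fun i _ => (totalDegree_smul_le _ _).trans ?_
    exact mem_WD.1 (b (Fin.castLE hD i)).2
  · intro i
    constructor
    · have : ∀ᶠ j in Filter.atTop, ∀ x ∈ S i, 0 < eval x (L a) → 1 ≤ (φ j : ℝ) * eval x (L (c (φ j))) := by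
        rw [Filter.eventually_all_finset]
        intro x _
        by_cases hx : 0 < eval x (L a)
        · filter_upwards [hpos x hx] with j hj _ using hj
        · exact Filter.Eventually.of_forall fun j h => (hx h).elim
      obtain ⟨j, hj⟩ := this.exists
      refine count_pos (S i) (L a) _ (congrFun (hc2 (φ j)) i) (fun x => clamp_ge _) (fun x hx h => clamp_one (hj x hx h))
    · have : ∀ᶠ j in Filter.atTop, ∀ x ∈ S i, eval x (L a) < 0 → 1 ≤ -((φ j : ℝ) * eval x (L (c (φ j)))) := by
        rw [Filter.eventually_all_finset]
        intro x _
        by_cases hx : eval x (L a) < 0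
        · filter_upwards [hneg x hx] with j hj _ using hj
        · exact Filter.Eventually.of_forall fun j h => (hx h).elim
      obtain ⟨j, hj⟩ := this.exists
      have h0 : ∑ x ∈ S i, clamp (-((φ j : ℝ) * eval x (L (c (φ j))))) = 0 := by
        simp only [clamp_neg, Finset.sum_neg_distrib, neg_eq_zero]
        exact congrFun (hc2 (φ j)) i
      have := count_pos (S i) (-(L a)) _ h0 (fun x => clamp_ge _) (fun x hx h => clamp_one (hj x hx (by simpa using h)))
      simpa using this

lemma ham_sandwich' {ι : Type} [Fintype ι] {D : ℕ} (hD : Fintype.card ι < Module.finrank ℝ (WD D))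
    (S : ι → Finset (Fin 3 → ℝ)) :
    ∃ f : Poly, f ≠ 0 ∧ f.totalDegree ≤ D ∧ ∀ i, 2 * ((S i).filter fun x => 0 < eval x f).card ≤ (S i).card ∧
      2 * ((S i).filter fun x => eval x f < 0).card ≤ (S i).card := by
  obtain ⟨f, h1, h2, h3⟩ := ham_sandwich hD (fun i => S ((Fintype.equivFin ι).symm i))
  refine ⟨f, h1, h2, fun i => ?_⟩
  have := h3 (Fintype.equivFin ι i)
  simpa using this

def cell (F : ℕ → Poly) (J : ℕ) (x : Fin 3 → ℝ) : Fin J → Bool := fun j => decide (0 < eval x (F j))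

lemma partition_aux (S : Finset (Fin 3 → ℝ)) (J : ℕ) : ∃ F : ℕ → Poly,
    (∀ j < J, F j ≠ 0 ∧ (F j).totalDegree ≤ 2 * 2 ^ ((j+2)/3)) ∧
    ∀ σ : Fin J → Bool, (S.filter fun x => (∀ j < J, eval x (F j) ≠ 0) ∧ cell F J x = σ).card * 2 ^ J ≤ S.card := by
  classical
  induction J with
  | zero => exact ⟨fun _ => 0, by simp, fun σ => by simp [Finset.card_filter_le]⟩
  | succ J ih =>
    obtain ⟨F, h1, h2⟩ := ih
    have hD : Fintype.card (Fin J → Bool) < Module.finrank ℝ (WD (2 * 2 ^ ((J+2)/3))) := by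
      have e := finrank_WD (2 * 2 ^ ((J+2)/3))
      have : (2:ℕ)^J ≤ (2 ^ ((J+2)/3))^3 := by
        rw [← pow_mul]; exact Nat.pow_le_pow_right (by norm_num) (by omega)
      have h8 : 6 * Fintype.card (Fin J → Bool) < (2 * 2 ^ ((J+2)/3)+1)*(2 * 2 ^ ((J+2)/3)+2)*(2 * 2 ^ ((J+2)/3)+3) := by
        simp only [Fintype.card_fun, Fintype.card_bool, Fintype.card_fin]
        generalize 2 ^ ((J+2)/3) = u at *
        calc 6 * 2^J ≤ 6 * u^3 := by omega
          _ < _ := by ring_nf; nlinarith [Nat.zero_le (u^3), Nat.zero_le (u^2)]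
      omega
    obtain ⟨f, f1, f2, f3⟩ := ham_sandwich' hD (fun σ => S.filter fun x => (∀ j < J, eval x (F j) ≠ 0) ∧ cell F J x = σ)
    refine ⟨Function.update F J f, ?_, ?_⟩
    · intro j hj
      by_cases hjJ : j = J
      · subst hjJ; simp [f1, f2]
      · rw [Function.update_of_ne hjJ]; exact h1 j (by omega)
    · intro σ
      have h4 := h2 (fun j => σ j.castSucc)
      have h5 := f3 (fun j => σ j.castSucc)
      have hlt : ∀ j < J, Function.update F J f j = F j := fun j hj => Function.update_of_ne (by omega) _ _
      have hsub : ∃ T : Finset (Fin 3 → ℝ), (S.filter fun x => (∀ j < J + 1, eval x (Function.update F J f j) ≠ 0) ∧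
          cell (Function.update F J f) (J+1) x = σ) ⊆ T ∧
          2 * T.card ≤ (S.filter fun x => (∀ j < J, eval x (F j) ≠ 0) ∧ cell F J x = fun j => σ j.castSucc).card := by
        have hcell : ∀ x, cell (Function.update F J f) (J+1) x = σ → cell F J x = (fun j => σ j.castSucc) ∧
            decide (0 < eval x f) = σ (Fin.last J) := by
          intro x hx
          constructor
          · funext j
            have := congrFun hx j.castSucc
            simp only [cell] at this ⊢
            rw [← this]
            simp [hlt j j.2]
          · have := congrFun hx (Fin.last J)
            simpa [cell] using this
        cases hσ : σ (Fin.last J) with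
        | true =>
          refine ⟨_, ?_, h5.1⟩
          intro x hx
          rw [Finset.mem_filter] at hx ⊢
          rw [Finset.mem_filter]
          obtain ⟨a, b, c⟩ := hx
          have := hcell x c
          rw [hσ] at this
          exact ⟨⟨a, fun j hj => by rw [← hlt j hj]; exact b j (by omega), this.1⟩, by simpa using this.2⟩
        | false =>
          refine ⟨_, ?_, h5.2⟩
          intro x hx
          rw [Finset.mem_filter] at hx ⊢
          rw [Finset.mem_filter]
          obtain ⟨a, b, c⟩ := hx
          have := hcell x c
          rw [hσ] at this
          have hb := b J (by omega)
          simp only [Function.update_self] at hb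
          exact ⟨⟨a, fun j hj => by rw [← hlt j hj]; exact b j (by omega), this.1⟩,
            lt_of_le_of_ne (by simpa using this.2) hb⟩
      obtain ⟨T, hT1, hT2⟩ := hsub
      have h6 := Finset.card_le_card hT1
      calc _ ≤ T.card * 2 ^ (J+1) := Nat.mul_le_mul_right _ h6
        _ = (2 * T.card) * 2^J := by ring
        _ ≤ _ := (Nat.mul_le_mul_right _ hT2).trans h4

lemma line_cells (F : ℕ → Poly) (J : ℕ) (l : Ln) (T : Finset (Fin 3 → ℝ)) (hl : ∀ x ∈ T, l.on x)
    (hT : ∀ x ∈ T, ∀ j < J, eval x (F j) ≠ 0) :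
    (T.image (cell F J)).card ≤ (∏ j ∈ Finset.range J, F j).totalDegree + 1 := by
  classical
  rcases T.eq_empty_or_nonempty with rfl | ⟨x0, hx0⟩
  · simp
  set f := ∏ j ∈ Finset.range J, F j with hf
  have hres : res l f ≠ 0 := by
    intro h
    have := eval_of_res h (hl x0 hx0)
    rw [hf, map_prod, Finset.prod_eq_zero_iff] at this
    obtain ⟨j, hj, h0⟩ := this
    exact hT x0 hx0 j (Finset.mem_range.1 hj) h0
  let ρ : (Fin 3 → ℝ) → ℕ := fun x => ((res l f).roots.toFinset.filter fun r => r < x 2).card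
  have hρ : ∀ x, ρ x ≤ f.totalDegree := by
    intro x
    refine (Finset.card_filter_le _ _).trans ((Multiset.toFinset_card_le _).trans ?_)
    exact (Polynomial.card_roots' _).trans (natDegree_res l f)
  have key : ∀ x ∈ T, ∀ y ∈ T, x 2 ≤ y 2 → ρ x = ρ y → cell F J x = cell F J y := by
    intro x hx y hy hxy hr
    have hnoroot : ∀ t, x 2 ≤ t → t ≤ y 2 → (res l f).eval t ≠ 0 := by
      intro t h1 h2 h0
      have hty : t ≠ y 2 := by
        rintro rfl
        rw [eval_res, ← hl y hy, hf, map_prod, Finset.prod_eq_zero_iff] at h0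
        obtain ⟨j, hj, h0⟩ := h0
        exact hT y hy j (Finset.mem_range.1 hj) h0
      have hss : ((res l f).roots.toFinset.filter fun r => r < x 2) ⊂ ((res l f).roots.toFinset.filter fun r => r < y 2) := by
        rw [Finset.ssubset_iff_of_subset]
        · refine ⟨t, ?_, ?_⟩
          · simp [hres, h0, lt_of_le_of_ne h2 hty]
          · simp [h1]
        · intro r hr
          rw [Finset.mem_filter] at *
          exact ⟨hr.1, lt_of_lt_of_le hr.2 hxy⟩
      have := Finset.card_lt_card hss
      simp only [ρ] at hr
      omega
    have hnr : ∀ j < J, ∀ t, x 2 ≤ t → t ≤ y 2 → (res l (F j)).eval t ≠ 0 := by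
      intro j hj t h1 h2 h0
      apply hnoroot t h1 h2
      rw [hf, map_prod, Polynomial.eval_prod]
      exact Finset.prod_eq_zero (Finset.mem_range.2 hj) h0
    funext j
    have hc : ContinuousOn (fun t => (res l (F j)).eval t) (Set.Icc (x 2) (y 2)) :=
      (Polynomial.continuous _).continuousOn
    have ex : eval x (F j) = (res l (F j)).eval (x 2) := by rw [eval_res, ← hl x hx]
    have ey : eval y (F j) = (res l (F j)).eval (y 2) := by rw [eval_res, ← hl y hy]
    simp only [cell]
    rw [ex, ey]
    congr 1
    apply propext
    have hx0 := hnr j j.2 (x 2) le_rfl hxy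
    have hy0 := hnr j j.2 (y 2) hxy le_rfl
    constructor
    · intro h
      by_contra h'
      obtain ⟨t, ht, h0⟩ := intermediate_value_Icc' hxy hc ⟨not_lt.1 h', h.le⟩
      exact hnr j j.2 t ht.1 ht.2 h0
    · intro h
      by_contra h'
      obtain ⟨t, ht, h0⟩ := intermediate_value_Icc hxy hc ⟨not_lt.1 h', h.le⟩
      exact hnr j j.2 t ht.1 ht.2 h0
  have key2 : ∀ x ∈ T, ∀ y ∈ T, ρ x = ρ y → cell F J x = cell F J y := by
    intro x hx y hy h
    rcases le_total (x 2) (y 2) with h' | h'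
    · exact key x hx y hy h' h
    · exact (key y hy x hx h' h.symm).symm
  have h1 : (T.image (cell F J)).card ≤ (T.image ρ).card := by
    choose! s hs using fun (σ : Fin J → Bool) (h : σ ∈ T.image (cell F J)) => Finset.mem_image.1 h
    refine Finset.card_le_card_of_injOn (fun σ => ρ (s σ)) ?_ ?_
    · intro σ hσ
      exact Finset.mem_image_of_mem _ (hs σ hσ).1
    · intro σ hσ τ hτ h
      rw [← (hs σ hσ).2, ← (hs τ hτ).2]
      exact key2 _ (hs σ hσ).1 _ (hs τ hτ).1 h
  have h2 : T.image ρ ⊆ Finset.range (f.totalDegree + 1) := by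
    intro k hk
    obtain ⟨x, _, rfl⟩ := Finset.mem_image.1 hk
    exact Finset.mem_range.2 (Nat.lt_succ_of_le (hρ x))
  have := Finset.card_le_card h2
  rw [Finset.card_range] at this
  omega

theorem partition_thm (S : Finset (Fin 3 → ℝ)) (m : ℕ) : ∃ (f : Poly) (cl : (Fin 3 → ℝ) → (Fin (3*m) → Bool)),
    f ≠ 0 ∧ f.totalDegree ≤ 12 * 2 ^ m ∧
    (∀ σ, (S.filter fun x => eval x f ≠ 0 ∧ cl x = σ).card * 8 ^ m ≤ S.card) ∧
    ∀ (l : Ln) (T : Finset (Fin 3 → ℝ)), (∀ x ∈ T, l.on x) → (∀ x ∈ T, eval x f ≠ 0) →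
      (T.image cl).card ≤ 12 * 2 ^ m + 1 := by
  classical
  obtain ⟨F, h1, h2⟩ := partition_aux S (3*m)
  have hne : ∀ x, eval x (∏ j ∈ Finset.range (3*m), F j) ≠ 0 ↔ ∀ j < 3*m, eval x (F j) ≠ 0 := by
    intro x
    rw [map_prod, Finset.prod_ne_zero_iff]
    simp
  have hdeg : (∏ j ∈ Finset.range (3*m), F j).totalDegree ≤ 12 * 2 ^ m := by
    refine (totalDegree_finsetProd _ _).trans ?_
    refine (Finset.sum_le_sum (g := fun j => 2 * 2 ^ ((j+2)/3)) fun j hj => (h1 j (Finset.mem_range.1 hj)).2).trans ?_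
    have : ∀ m : ℕ, ∑ j ∈ Finset.range (3*m), 2 * 2 ^ ((j+2)/3) + 10 ≤ 12 * 2 ^ m := by
      intro m
      induction m with
      | zero => simp
      | succ m ih =>
        rw [show 3 * (m+1) = 3*m+1+1+1 by ring, Finset.sum_range_succ, Finset.sum_range_succ, Finset.sum_range_succ,
          show (3*m+2)/3 = m by omega, show (3*m+1+2)/3 = m+1 by omega, show (3*m+1+1+2)/3 = m+1 by omega]
        ring_nf at ih ⊢
        omega
    have := this m
    omega
  refine ⟨∏ j ∈ Finset.range (3*m), F j, cell F (3*m), ?_, hdeg, ?_, ?_⟩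
  · exact Finset.prod_ne_zero_iff.2 fun j hj => (h1 j (Finset.mem_range.1 hj)).1
  · intro σ
    simp only [hne]
    have := h2 σ
    rwa [pow_mul] at this
  · intro l T hl hT
    have := line_cells F (3*m) l T hl (fun x hx => (hne x).1 (hT x hx))
    omega
end GK
end
end

section
open MvPolynomial
noncomputable section
namespace GK

lemma dual_hom {K : Type} [Field K] [Algebra ℝ K] (π : Poly →ₐ[ℝ] K) (u : Fin 3 → K) :
    ∃ φ : Poly →ₐ[ℝ] TrivSqZeroExt K K, ∀ F, (φ F).fst = π F ∧ (φ F).snd = ∑ i, π (pderiv i F) * u i := by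
  refine ⟨aeval fun i => TrivSqZeroExt.inl (π (X i)) + TrivSqZeroExt.inr (u i), fun F => ?_⟩
  induction F using MvPolynomial.induction_on with
  | C a =>
    simp only [← MvPolynomial.algebraMap_eq, AlgHom.commutes]
    simp [TrivSqZeroExt.algebraMap_eq_inl']
  | add p q hp hq => exact ⟨by rw [map_add, TrivSqZeroExt.fst_add, hp.1, hq.1, map_add],
      by rw [map_add, TrivSqZeroExt.snd_add, hp.2, hq.2]; simp only [map_add, add_mul, Finset.sum_add_distrib]⟩
  | mul_X p i hp =>
    rw [map_mul, TrivSqZeroExt.snd_mul, TrivSqZeroExt.fst_mul, hp.1, hp.2, aeval_X]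
    refine ⟨by simp, ?_⟩
    simp only [Derivation.leibniz, smul_eq_mul, map_add, map_mul, add_mul, Finset.sum_add_distrib, pderiv_X, Pi.single_apply, MulOpposite.smul_eq_mul_unop, MulOpposite.unop_op]
    congr 1
    · simp
    · rw [Finset.sum_mul]; exact Finset.sum_congr rfl fun x _ => by simp; ring

lemma der_of_dual {K : Type} [Field K] [Algebra ℝ K] (φ : K →+* TrivSqZeroExt K K) (h3 : ∀ z, (φ z).fst = z)
    (hr : ∀ r : ℝ, φ (algebraMap ℝ K r) = algebraMap ℝ _ r) : ∃ δ : Derivation ℝ K K, ∀ z, δ z = (φ z).snd := by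
  refine ⟨Derivation.mk' { toFun := fun z => (φ z).snd, map_add' := by simp, map_smul' := ?_ } ?_, ?_⟩
  · intro r z
    simp only [Algebra.smul_def, map_mul, hr, RingHom.id_apply]
    rw [TrivSqZeroExt.algebraMap_eq_inl']
    simp
  · intro a b
    simp only [LinearMap.coe_mk, AddHom.coe_mk, map_mul, TrivSqZeroExt.snd_mul, h3]
    simp [mul_comm]
  · intro z
    rfl

lemma der_loc {B K : Type} [CommRing B] [IsDomain B] [Field K] [Algebra B K] [IsFractionRing B K] [Algebra ℝ K]
    (φ : B →+* TrivSqZeroExt K K) (h1 : ∀ b, (φ b).fst = algebraMap B K b)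
    (hr : ∀ r : ℝ, ∃ b, algebraMap B K b = algebraMap ℝ K r ∧ φ b = algebraMap ℝ _ r) :
    ∃ δ : Derivation ℝ K K, ∀ b, δ (algebraMap B K b) = (φ b).snd := by
  let φ2 : K →+* TrivSqZeroExt K K := IsLocalization.lift (M := nonZeroDivisors B) (g := φ) (by
    rintro ⟨y, hy⟩
    rw [TrivSqZeroExt.isUnit_iff_isUnit_fst, h1, isUnit_iff_ne_zero]
    exact IsFractionRing.to_map_ne_zero_of_mem_nonZeroDivisors hy)
  have h2 : ∀ b, φ2 (algebraMap B K b) = φ b := fun b => IsLocalization.lift_eq _ _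
  have h3 : ∀ z, (φ2 z).fst = z := by
    have : (TrivSqZeroExt.fstHom ℝ K K : TrivSqZeroExt K K →+* K).comp φ2 = RingHom.id K := by
      apply IsLocalization.ringHom_ext (nonZeroDivisors B)
      ext y
      change (φ2 (algebraMap B K y)).fst = algebraMap B K y
      rw [h2, h1]
    intro z
    exact congrArg (fun f => f z) this
  obtain ⟨δ, hδ⟩ := der_of_dual φ2 h3 (by
    intro r
    obtain ⟨b, hb, hb'⟩ := hr r
    rw [← hb, h2, hb'])
  exact ⟨δ, fun b => by rw [hδ, h2]⟩

lemma exists_K (g : Poly) (hg : Irreducible g) : ∃ (K : Type) (_ : Field K) (_ : Algebra ℝ K) (π : Poly →ₐ[ℝ] K),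
    (∀ F, π F = 0 ↔ g ∣ F) ∧ (∀ z : K, ∃ F G, π G ≠ 0 ∧ z * π G = π F) ∧
    ∀ u : Fin 3 → K, ∑ i, π (pderiv i g) * u i = 0 →
      ∃ δ : Derivation ℝ K K, ∀ F, δ (π F) = ∑ i, π (pderiv i F) * u i := by
  have hp : (Ideal.span {g}).IsPrime := (Ideal.span_singleton_prime hg.ne_zero).2 hg.prime
  have : IsDomain (Poly ⧸ Ideal.span {g}) := Ideal.Quotient.isDomain _
  let π : Poly →ₐ[ℝ] FractionRing (Poly ⧸ Ideal.span {g}) :=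
    (IsScalarTower.toAlgHom ℝ (Poly ⧸ Ideal.span {g}) _).comp (Ideal.Quotient.mkₐ ℝ (Ideal.span {g}))
  have hπ : ∀ F, π F = algebraMap (Poly ⧸ Ideal.span {g}) _ (Ideal.Quotient.mk _ F) := fun F => rfl
  have hker : ∀ F, π F = 0 ↔ g ∣ F := by
    intro F
    rw [hπ, map_eq_zero_iff _ (IsFractionRing.injective _ _), Ideal.Quotient.eq_zero_iff_mem, Ideal.mem_span_singleton]
  refine ⟨FractionRing (Poly ⧸ Ideal.span {g}), inferInstance, inferInstance, π, hker, ?_, ?_⟩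
  · intro z
    obtain ⟨a, b, hb, rfl⟩ := IsFractionRing.div_surjective (A := Poly ⧸ Ideal.span {g}) z
    obtain ⟨F, rfl⟩ := Ideal.Quotient.mk_surjective a
    obtain ⟨G, rfl⟩ := Ideal.Quotient.mk_surjective b
    have h0 : π G ≠ 0 := by
      rw [hπ]
      exact IsFractionRing.to_map_ne_zero_of_mem_nonZeroDivisors hb
    refine ⟨F, G, h0, ?_⟩
    rw [hπ] at *
    rw [hπ, div_mul_cancel₀ _ h0]
  · intro u hu
    obtain ⟨φ, hφ⟩ := dual_hom π u
    have hφg : φ g = 0 := by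
      ext
      · rw [(hφ g).1, (hker g).2 dvd_rfl]; rfl
      · rw [(hφ g).2, hu]; rfl
    obtain ⟨δ, hδ⟩ := der_loc (K := FractionRing (Poly ⧸ Ideal.span {g})) (Ideal.Quotient.lift (Ideal.span {g}) (φ : Poly →+* _) (by
      intro a ha
      rw [Ideal.mem_span_singleton] at ha
      obtain ⟨c, rfl⟩ := ha
      change φ _ = 0
      rw [map_mul, hφg, zero_mul])) (by
        intro b
        obtain ⟨G, rfl⟩ := Ideal.Quotient.mk_surjective b
        exact (hφ G).1) (by
        intro r
        refine ⟨Ideal.Quotient.mk _ (C r), rfl, ?_⟩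
        exact AlgHom.commutes φ r)
    refine ⟨δ, fun F => ?_⟩
    rw [hπ, hδ]
    exact (hφ F).2

end GK
end
end

section
open MvPolynomial
noncomputable section
namespace GK

section
variable {K : Type} [Field K] [Algebra ℝ K] (δ₁ δ₂ : Derivation ℝ K K)

lemma psi_alg {h11 h12 h22 b11 b12 b21 b22 : K} (h2 : (2:K) ≠ 0) (hd : h11 * h22 - h12 ^ 2 ≠ 0)
    (e1 : 3 * b12 * h11 - b21 * h11 = 2 * b11 * h12) (e3 : 3 * b21 * h22 - b12 * h22 = 2 * b22 * h12)
    (e2 : 2 * b12 * h12 + b22 * h11 = b11 * h22 + 2 * b21 * h12) :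
    ∃ ψ : K, ψ = (b11 * h22 - 2 * b12 * h12 + b22 * h11) / (2 * (h11 * h22 - h12 ^ 2)) ∧
      b11 = ψ * h11 ∧ b12 = ψ * h12 ∧ b21 = ψ * h12 ∧ b22 = ψ * h22 := by
  have hS : b12 = b21 := by
    have : (2 * 2) * (h11 * h22 - h12 ^ 2) * (b12 - b21) = 0 := by linear_combination h22 * e1 - h11 * e3 - 2 * h12 * e2
    have := (mul_eq_zero.1 this).resolve_left (mul_ne_zero (mul_ne_zero h2 h2) hd)
    exact sub_eq_zero.1 this
  subst hS
  have f1 : b12 * h11 = b11 * h12 := by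
    apply mul_left_cancel₀ h2; linear_combination e1
  have f3 : b12 * h22 = b22 * h12 := by
    apply mul_left_cancel₀ h2; linear_combination e3
  have f2 : b22 * h11 = b11 * h22 := by linear_combination e2
  have hd2 : 2 * (h11 * h22 - h12 ^ 2) ≠ 0 := mul_ne_zero h2 hd
  refine ⟨_, rfl, ?_, ?_, ?_, ?_⟩ <;> rw [div_mul_eq_mul_div, eq_div_iff hd2]
  · linear_combination 2 * h12 * f1 - h11 * f2
  · linear_combination h22 * f1 + h11 * f3 
  · linear_combination h22 * f1 + h11 * f3
  · linear_combination h22 * f2 + 2 * h12 * f3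

lemma psi_der (hc : ∀ z, δ₁ (δ₂ z) = δ₂ (δ₁ z)) {h11 h12 h22 l1 l2 ψ : K} (h2 : (2:K) ≠ 0)
    (hd : h11 * h22 - h12 ^ 2 ≠ 0)
    (hψ : ψ = ((δ₁ l1 - l1 ^ 2) * h22 - 2 * (δ₂ l1 - l1 * l2) * h12 + (δ₂ l2 - l2 ^ 2) * h11) / (2 * (h11 * h22 - h12 ^ 2)))
    (t1 : δ₁ h11 = 3 * l1 * h11) (t2 : δ₂ h11 = 2 * l1 * h12 + l2 * h11)
    (t2' : δ₁ h12 = 2 * l1 * h12 + l2 * h11) (t3 : δ₂ h12 = l1 * h22 + 2 * l2 * h12)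
    (t3' : δ₁ h22 = l1 * h22 + 2 * l2 * h12) (t4 : δ₂ h22 = 3 * l2 * h22) :
    (δ₁ l1 = l1 ^ 2 + ψ * h11 ∧ δ₂ l1 = l1 * l2 + ψ * h12 ∧ δ₁ l2 = l1 * l2 + ψ * h12 ∧ δ₂ l2 = l2 ^ 2 + ψ * h22) ∧
    δ₁ ψ = ψ * l1 ∧ δ₂ ψ = ψ * l2 := by
  have n2 : ∀ δ : Derivation ℝ K K, δ (2:K) = 0 := fun δ => by
    have := δ.map_natCast 2; simpa using this
  have n3 : ∀ δ : Derivation ℝ K K, δ (3:K) = 0 := fun δ => by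
    have := δ.map_natCast 3; simpa using this
  have e1 := hc h11
  have e2 := hc h12
  have e3 := hc h22
  rw [t1, t2] at e1
  rw [t2', t3] at e2
  rw [t3', t4] at e3
  simp only [map_add, Derivation.leibniz, smul_eq_mul, n2, n3, t1, t2, t2', t3, t3', t4, mul_zero, add_zero] at e1 e2 e3
  obtain ⟨ψ', hψ', q1, q2, q3, q4⟩ := psi_alg (b11 := δ₁ l1 - l1 ^ 2) (b12 := δ₂ l1 - l1 * l2) (b21 := δ₁ l2 - l1 * l2)
    (b22 := δ₂ l2 - l2 ^ 2) h2 hd (by linear_combination -e1) (by linear_combination e3) (by linear_combination -e2)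
  rw [← hψ] at hψ'
  subst hψ'
  have r1 : δ₁ l1 = l1 ^ 2 + ψ' * h11 := by linear_combination q1
  have r2 : δ₂ l1 = l1 * l2 + ψ' * h12 := by linear_combination q2
  have r3 : δ₁ l2 = l1 * l2 + ψ' * h12 := by linear_combination q3
  have r4 : δ₂ l2 = l2 ^ 2 + ψ' * h22 := by linear_combination q4
  refine ⟨⟨r1, r2, r3, r4⟩, ?_⟩
  have s1 := hc l1
  have s2 := hc l2
  rw [r1, r2] at s1
  rw [r3, r4] at s2
  simp only [map_add, Derivation.leibniz, Derivation.leibniz_pow, smul_eq_mul, t1, t2, t2', t3, t3', t4, r1, r2, r3, r4, nsmul_eq_mul, pow_one, Nat.cast_ofNat, Nat.add_one_sub_one] at s1 s2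
  have u1 : (δ₁ ψ' - ψ' * l1) * h12 = (δ₂ ψ' - ψ' * l2) * h11 := by linear_combination s1
  have u2 : (δ₁ ψ' - ψ' * l1) * h22 = (δ₂ ψ' - ψ' * l2) * h12 := by linear_combination s2
  constructor
  · have : (h11 * h22 - h12 ^ 2) * (δ₁ ψ' - ψ' * l1) = 0 := by linear_combination h11 * u2 - h12 * u1
    exact sub_eq_zero.1 ((mul_eq_zero.1 this).resolve_left hd)
  · have : (h11 * h22 - h12 ^ 2) * (δ₂ ψ' - ψ' * l2) = 0 := by linear_combination h12 * u2 - h22 * u1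
    exact sub_eq_zero.1 ((mul_eq_zero.1 this).resolve_left hd)

def qf (h11 h12 h22 l1 l2 ψ p1 p2 η1 η2 e : K) : K :=
  (e - p1 * η1 - p2 * η2) * (1 - l1 * η1 - l2 * η2) * 2
    - (h11 * η1 ^ 2 + 2 * h12 * η1 * η2 + h22 * η2 ^ 2) - ψ * (e - p1 * η1 - p2 * η2) ^ 2

lemma qf_der (δ : Derivation ℝ K K) {h11 h12 h22 l1 l2 ψ p1 p2 η1 η2 e : K}
    (hp1 : δ p1 = h11) (hp2 : δ p2 = h12) (he : δ e = -p1) (h1 : δ η1 = -1) (h2 : δ η2 = 0)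
    (t1 : δ h11 = 3 * l1 * h11) (t2' : δ h12 = 2 * l1 * h12 + l2 * h11)
    (t3' : δ h22 = l1 * h22 + 2 * l2 * h12) (r1 : δ l1 = l1 ^ 2 + ψ * h11) (r2 : δ l2 = l1 * l2 + ψ * h12)
    (hψ : δ ψ = ψ * l1) :
    δ (qf h11 h12 h22 l1 l2 ψ p1 p2 η1 η2 e) = l1 * qf h11 h12 h22 l1 l2 ψ p1 p2 η1 η2 e := by
  have n2 : δ (2:K) = 0 := by
    have := δ.map_natCast 2; simpa using this
  unfold qf
  simp only [map_sub, map_add, Derivation.leibniz, Derivation.leibniz_pow, smul_eq_mul, nsmul_eq_mul, pow_one, Nat.cast_ofNat, Nat.add_one_sub_one,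
    n2, hp1, hp2, he, h1, h2, t1, t2', t3', r1, r2, hψ, Derivation.map_one_eq_zero]
  ring
end

end GK
end
end

section
open MvPolynomial
noncomputable section
namespace GK

lemma pd_comm (i j : Fin 3) (F : Poly) : pderiv i (pderiv j F) = pderiv j (pderiv i F) := by
  have : ⁅pderiv (R := ℝ) i, pderiv (R := ℝ) j⁆ = 0 := by
    apply derivation_ext
    intro k
    simp [Derivation.commutator_apply, pderiv_X, Pi.single_apply]
    split_ifs <;> simp
  have h := congrArg (fun D => D F) this
  simp [Derivation.commutator_apply] at h
  exact sub_eq_zero.1 h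

def dv (g : Poly) (c j : Fin 3) (F : Poly) : Poly := pderiv c g * pderiv j F - pderiv j g * pderiv c F
def nn (n : ℕ) (g : Poly) (c j : Fin 3) (F : Poly) : Poly := pderiv c g * dv g c j F - (n : Poly) * F * dv g c j (pderiv c g)
def hh (g : Poly) (c i j : Fin 3) : Poly := nn 1 g c j (-pderiv i g)
def tt (g : Poly) (c i j k : Fin 3) : Poly := nn 3 g c k (hh g c i j)

lemma pd_nat (i : Fin 3) (n : ℕ) : pderiv i (n : Poly) = 0 := by
  exact Derivation.map_natCast _ _

lemma nn_comm (n : ℕ) (g : Poly) (c i j : Fin 3) (F : Poly) :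
    nn (n+2) g c i (nn n g c j F) = nn (n+2) g c j (nn n g c i F) := by
  unfold nn dv
  simp only [map_sub, Derivation.leibniz, smul_eq_mul, pd_nat, Nat.cast_add, Nat.cast_ofNat]
  rw [pd_comm j i F, pd_comm c i F, pd_comm c j F, pd_comm c i (pderiv c g), pd_comm c j (pderiv c g), pd_comm j i (pderiv c g),
    pd_comm j i g, pd_comm c i g, pd_comm c j g]
  simp only [pd_comm i j]
  ring

lemma dv_comm (g : Poly) (c i j : Fin 3) (F : Poly) :
    nn 1 g c i (dv g c j F) = nn 1 g c j (dv g c i F) := by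
  unfold nn dv
  simp only [map_sub, Derivation.leibniz, smul_eq_mul, Nat.cast_one]
  simp only [pd_comm i j, pd_comm c i, pd_comm c j]
  ring

lemma hh_comm (g : Poly) (c i j : Fin 3) : hh g c i j = hh g c j i := by
  unfold hh nn dv
  simp only [map_neg, pd_comm i j, pd_comm c i, pd_comm c j, Nat.cast_one]
  ring

lemma tt_comm1 (g : Poly) (c i j k : Fin 3) : tt g c i j k = tt g c j i k := by
  unfold tt; rw [hh_comm]
lemma tt_comm2 (g : Poly) (c i j k : Fin 3) : tt g c i j k = tt g c i k j := by
  unfold tt hh; rw [nn_comm 1]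

lemma pd_deg' (g : Poly) (i : Fin 3) : (pderiv i g).totalDegree ≤ g.totalDegree - 1 := by
  rw [g.as_sum, map_sum]
  refine totalDegree_finsetSum_le fun m hm => ?_
  rw [← g.as_sum, pderiv_monomial]
  by_cases hi : m i = 0
  · simp [hi]
  · refine (totalDegree_monomial_le _ _).trans ?_
    have h1 := le_totalDegree hm
    have h2 : m = (m - Finsupp.single i 1) + Finsupp.single i 1 := by
      ext j; by_cases hj : j = i
      · subst hj; simp; omega
      · simp [Ne.symm hj]
    have h3 : (m.sum fun _ e => e) = ((m - Finsupp.single i 1).sum fun _ e => e) + 1 := by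
      conv_lhs => rw [h2]
      rw [Finsupp.sum_add_index'] <;> simp
    have h4 : ((m - Finsupp.single i 1).sum fun _ => id) = ((m - Finsupp.single i 1).sum fun _ e => e) := rfl
    omega

lemma pd_deg (g : Poly) (i : Fin 3) : (pderiv i g).totalDegree ≤ g.totalDegree := (pd_deg' g i).trans (Nat.sub_le _ _)

lemma dv_deg {g F : Poly} {c j : Fin 3} {n : ℕ} (hF : F.totalDegree ≤ n) : (dv g c j F).totalDegree ≤ g.totalDegree + n := by
  unfold dv
  refine (totalDegree_sub _ _).trans (max_le ?_ ?_) <;> refine (totalDegree_mul _ _).trans (add_le_add (pd_deg _ _) ((pd_deg _ _).trans hF))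

lemma nn_deg {k : ℕ} {g F : Poly} {c j : Fin 3} {n : ℕ} (hF : F.totalDegree ≤ n) : (nn k g c j F).totalDegree ≤ 2 * g.totalDegree + n := by
  unfold nn
  refine (totalDegree_sub _ _).trans (max_le ?_ ?_)
  · refine (totalDegree_mul _ _).trans ((add_le_add (pd_deg _ _) (dv_deg hF)).trans (by omega))
  · refine (totalDegree_mul _ _).trans ((add_le_add ((totalDegree_mul _ _).trans (add_le_add le_rfl hF)) (dv_deg (pd_deg g c))).trans ?_)
    have : totalDegree (k : Poly) = 0 := by
      rw [← map_natCast (C : ℝ →+* Poly)]; exact totalDegree_C _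
    omega

lemma hh_deg (g : Poly) (c i j : Fin 3) : (hh g c i j).totalDegree ≤ 3 * g.totalDegree := by
  have : (-pderiv i g).totalDegree ≤ g.totalDegree := by rw [totalDegree_neg]; exact pd_deg _ _
  refine (nn_deg this).trans (by omega)

lemma tt_deg (g : Poly) (c i j k : Fin 3) : (tt g c i j k).totalDegree ≤ 5 * g.totalDegree := by
  refine (nn_deg (hh_deg _ _ _ _)).trans (by omega)

lemma nn_lin (n : ℕ) (g : Poly) (c j : Fin 3) (F F' : Poly) (a b : ℝ) :
    nn n g c j (C a * F + C b * F') = C a * nn n g c j F + C b * nn n g c j F' := by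
  unfold nn dv
  simp only [map_add, Derivation.leibniz, smul_eq_mul, pderiv_C]
  ring

structure Idx (a b c : Fin 3) : Prop where
  sum : ∀ {M : Type} [AddCommMonoid M] (f : Fin 3 → M), ∑ i, f i = f a + f b + f c
  cov : ∀ i, i = a ∨ i = b ∨ i = c
  ab : a ≠ b
  ac : a ≠ c
  bc : b ≠ c

lemma exists_idx (c : Fin 3) : ∃ a b, Idx a b c := by
  fin_cases c
  · exact ⟨1, 2, ⟨fun f => by rw [Fin.sum_univ_three]; simp only [Fin.zero_eta]; rw [add_assoc, add_comm], by decide, by decide, by decide, by decide⟩⟩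
  · exact ⟨0, 2, ⟨fun f => by rw [Fin.sum_univ_three]; simp only [Fin.mk_one]; rw [add_right_comm], by decide, by decide, by decide, by decide⟩⟩
  · exact ⟨0, 1, ⟨fun f => by rw [Fin.sum_univ_three]; rfl, by decide, by decide, by decide, by decide⟩⟩

section
variable {g : Poly} {a b c : Fin 3} (I : Idx a b c) {l : Ln} (hl : res l g = 0)
include I hl

lemma line1 : res l (C (l.dir a) * -pderiv a g + C (l.dir b) * -pderiv b g) = res l (C (l.dir c)) * res l (pderiv c g) := by
  have h := derivative_res l g
  rw [hl, I.sum] at h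
  simp only [map_add, map_mul, map_neg, Polynomial.derivative_zero] at h ⊢
  linear_combination h

lemma line_dv (F : Poly) : res l (pderiv c g) * Polynomial.derivative (res l F) =
    res l (C (l.dir a) * dv g c a F + C (l.dir b) * dv g c b F) := by
  have h1 := line1 I hl
  rw [derivative_res, I.sum]
  unfold dv
  simp only [map_add, map_mul, map_neg, map_sub] at h1 ⊢
  linear_combination -res l (pderiv c F) * h1

lemma line_nn (n : ℕ) (F : Poly) : res l (C (l.dir a) * nn n g c a F + C (l.dir b) * nn n g c b F) =
    res l (pderiv c g) * (res l (pderiv c g) * Polynomial.derivative (res l F) - (n : Polynomial ℝ) * res l F * Polynomial.derivative (res l (pderiv c g))) := by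
  have h1 := line_dv I hl F
  have h2 := line_dv I hl (pderiv c g)
  unfold nn
  simp only [map_add, map_mul, map_natCast, map_sub] at h1 h2 ⊢
  linear_combination -res l (pderiv c g) * h1 + (n : Polynomial ℝ) * res l F * h2

lemma line_hh : res l (C (l.dir a) * (C (l.dir a) * hh g c a a + C (l.dir b) * hh g c b a) +
    C (l.dir b) * (C (l.dir a) * hh g c a b + C (l.dir b) * hh g c b b)) = 0 := by
  unfold hh
  rw [← nn_lin, ← nn_lin, line_nn I hl, line1 I hl]
  have : res l (C (l.dir c)) = Polynomial.C (l.dir c) := by simp [res]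
  rw [this, Polynomial.derivative_mul, Polynomial.derivative_C]
  push_cast
  ring

lemma line_tt : res l (C (l.dir a) * (C (l.dir a) * (C (l.dir a) * tt g c a a a + C (l.dir b) * tt g c b a a) +
    C (l.dir b) * (C (l.dir a) * tt g c a b a + C (l.dir b) * tt g c b b a)) +
    C (l.dir b) * (C (l.dir a) * (C (l.dir a) * tt g c a a b + C (l.dir b) * tt g c b a b) +
    C (l.dir b) * (C (l.dir a) * tt g c a b b + C (l.dir b) * tt g c b b b))) = 0 := by
  unfold tt
  rw [← nn_lin, ← nn_lin, ← nn_lin, ← nn_lin, ← nn_lin, ← nn_lin, line_nn I hl, line_hh I hl]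
  simp
end

end GK
end
end

section
open MvPolynomial
noncomputable section
namespace GK

section
variable {h11 h12 h22 t111 t112 t122 t222 v1 v2 w1 w2 : ℝ} (hD : v1 * w2 - v2 * w1 ≠ 0)
  (e1 : v1 ^ 2 * h11 + 2 * v1 * v2 * h12 + v2 ^ 2 * h22 = 0) (e2 : w1 ^ 2 * h11 + 2 * w1 * w2 * h12 + w2 ^ 2 * h22 = 0)
include hD e1 e2

lemma pt_h : ∃ β, h11 = v2 * w2 * β ∧ 2 * h12 = - (v1 * w2 + v2 * w1) * β ∧ h22 = v1 * w1 * β := by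
  refine ⟨-2 * (v1 * w1 * h11 + (v1 * w2 + v2 * w1) * h12 + v2 * w2 * h22) / (v1 * w2 - v2 * w1) ^ 2, ?_, ?_, ?_⟩ <;>
  rw [mul_div_assoc', eq_div_iff (pow_ne_zero 2 hD)]
  · linear_combination w2 ^ 2 * e1 + v2 ^ 2 * e2
  · linear_combination -2 * w1 * w2 * e1 - 2 * v1 * v2 * e2
  · linear_combination w1 ^ 2 * e1 + v1 ^ 2 * e2

lemma pt_det (hd : h11 * h22 - h12 ^ 2 = 0) : h11 = 0 ∧ h12 = 0 ∧ h22 = 0 := by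
  obtain ⟨β, r1, r2, r3⟩ := pt_h hD e1 e2
  have : (v1 * w2 - v2 * w1) ^ 2 * β ^ 2 = 0 := by
    have : h12 = - (v1 * w2 + v2 * w1) * β / 2 := by linarith
    rw [r1, r3, this] at hd
    linear_combination -4 * hd
  have hb : β = 0 := by
    have := (mul_eq_zero.1 this).resolve_left (pow_ne_zero 2 hD)
    exact pow_eq_zero_iff (by norm_num) |>.1 this
  subst hb
  refine ⟨by simpa using r1, by simpa using r2, by simpa using r3⟩

variable (f1 : v1 ^ 3 * t111 + 3 * v1 ^ 2 * v2 * t112 + 3 * v1 * v2 ^ 2 * t122 + v2 ^ 3 * t222 = 0)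
  (f2 : w1 ^ 3 * t111 + 3 * w1 ^ 2 * w2 * t112 + 3 * w1 * w2 ^ 2 * t122 + w2 ^ 3 * t222 = 0)
include f1 f2

omit e1 e2 in
lemma pt_t : ∃ x y, t111 = v2 * w2 * x ∧ 3 * t112 = - (v1 * w2 + v2 * w1) * x + v2 * w2 * y ∧
    3 * t122 = v1 * w1 * x - (v1 * w2 + v2 * w1) * y ∧ t222 = v1 * w1 * y := by
  refine ⟨-3 * (w2 * (v1 ^ 2 * w1 * t111 + (v1 ^ 2 * w2 + 2 * v1 * v2 * w1) * t112 + (v2 ^ 2 * w1 + 2 * v1 * v2 * w2) * t122 + v2 ^ 2 * w2 * t222)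
     - v2 * (w1 ^ 2 * v1 * t111 + (w1 ^ 2 * v2 + 2 * w1 * w2 * v1) * t112 + (w2 ^ 2 * v1 + 2 * w1 * w2 * v2) * t122 + w2 ^ 2 * v2 * t222)) / (v1 * w2 - v2 * w1) ^ 3,
     3 * (w1 * (v1 ^ 2 * w1 * t111 + (v1 ^ 2 * w2 + 2 * v1 * v2 * w1) * t112 + (v2 ^ 2 * w1 + 2 * v1 * v2 * w2) * t122 + v2 ^ 2 * w2 * t222)
     - v1 * (w1 ^ 2 * v1 * t111 + (w1 ^ 2 * v2 + 2 * w1 * w2 * v1) * t112 + (w2 ^ 2 * v1 + 2 * w1 * w2 * v2) * t122 + w2 ^ 2 * v2 * t222)) / (v1 * w2 - v2 * w1) ^ 3, ?_, ?_, ?_, ?_⟩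
  · rw [mul_div_assoc', eq_div_iff (pow_ne_zero 3 hD)]
    linear_combination w2 ^ 3 * f1 - v2 ^ 3 * f2
  · rw [mul_div_assoc', mul_div_assoc', ← add_div, eq_div_iff (pow_ne_zero 3 hD)]
    linear_combination -3 * w1 * w2 ^ 2 * f1 + 3 * v1 * v2 ^ 2 * f2
  · rw [mul_div_assoc', mul_div_assoc', ← sub_div, eq_div_iff (pow_ne_zero 3 hD)]
    linear_combination 3 * w1 ^ 2 * w2 * f1 - 3 * v1 ^ 2 * v2 * f2
  · rw [mul_div_assoc', eq_div_iff (pow_ne_zero 3 hD)]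
    linear_combination - w1 ^ 3 * f1 + v1 ^ 3 * f2

end

section
variable {R : Type} [CommRing R]
def mu1 (h11 h12 h22 t111 t112 t122 : R) : R := h22 * t111 - 2 * h12 * t112 + h11 * t122
def w1 (h11 h12 h22 t111 t112 t122 : R) : R :=
  4 * (h11 * h22 - h12 ^ 2) * t111 - 3 * mu1 h11 h12 h22 t111 t112 t122 * h11
def w2 (h11 h12 h22 t111 t112 t122 t222 : R) : R :=
  4 * (h11 * h22 - h12 ^ 2) * t112 - (2 * mu1 h11 h12 h22 t111 t112 t122 * h12 + mu1 h22 h12 h11 t222 t122 t112 * h11)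
end

lemma pt_w {h11 h12 h22 t111 t112 t122 t222 v1 v2 w1 w2 : ℝ} (hD : v1 * w2 - v2 * w1 ≠ 0)
  (e1 : v1 ^ 2 * h11 + 2 * v1 * v2 * h12 + v2 ^ 2 * h22 = 0) (e2 : w1 ^ 2 * h11 + 2 * w1 * w2 * h12 + w2 ^ 2 * h22 = 0)
  (f1 : v1 ^ 3 * t111 + 3 * v1 ^ 2 * v2 * t112 + 3 * v1 * v2 ^ 2 * t122 + v2 ^ 3 * t222 = 0)
  (f2 : w1 ^ 3 * t111 + 3 * w1 ^ 2 * w2 * t112 + 3 * w1 * w2 ^ 2 * t122 + w2 ^ 3 * t222 = 0) :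
  GK.w1 h11 h12 h22 t111 t112 t122 = 0 ∧ GK.w2 h11 h12 h22 t111 t112 t122 t222 = 0 ∧
  GK.w2 h22 h12 h11 t222 t122 t112 t111 = 0 ∧ GK.w1 h22 h12 h11 t222 t122 t112 = 0 := by
  obtain ⟨β, r1, r2, r3⟩ := pt_h hD e1 e2
  obtain ⟨x, y, s1, s2, s3, s4⟩ := pt_t hD f1 f2
  have r2' : h12 = - (v1 * w2 + v2 * w1) * β / 2 := by linarith
  have s2' : t112 = (- (v1 * w2 + v2 * w1) * x + v2 * w2 * y) / 3 := by linarith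
  have s3' : t122 = (v1 * w1 * x - (v1 * w2 + v2 * w1) * y) / 3 := by linarith
  subst r1 r2' r3 s1 s2' s3' s4
  unfold GK.w1 GK.w2 mu1
  refine ⟨by ring, by ring, by ring, by ring⟩

def crs (g : Poly) (l : Ln) (x : Fin 3 → ℝ) : Prop := l.on x ∧ ∃ m, m ≠ l ∧ res m g = 0 ∧ m.on x

def rich (g : Poly) (S : Finset Ln) : Prop := 12 * g.totalDegree ^ 2 < S.card ∧
  ∀ l ∈ S, res l g = 0 ∧ ∃ P : Finset (Fin 3 → ℝ), 12 * g.totalDegree < P.card ∧ ∀ x ∈ P, crs g l x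

lemma pd_ndvd {g : Poly} {c : Fin 3} (hc : pderiv c g ≠ 0) : ¬ g ∣ pderiv c g := by
  intro h
  have h1 := totalDegree_le_of_dvd_of_isDomain h hc
  have h2 := pd_deg' g c
  have h3 : g.totalDegree = 0 := by omega
  rw [totalDegree_eq_zero_iff_eq_C.1 h3, pderiv_C] at hc
  exact hc rfl

lemma van {g : Poly} (hg : Irreducible g) {c : Fin 3} (hc : pderiv c g ≠ 0) {S : Finset Ln} (hS : rich g S) {E : Poly}
    (hE : E.totalDegree ≤ 11 * g.totalDegree)
    (h : ∀ l x, res l g = 0 → crs g l x → eval x (pderiv c g) ≠ 0 → eval x E = 0) : g ∣ E := by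
  by_contra hne
  have h1 : ¬ g ∣ pderiv c g * E := fun hd => (hg.prime.2.2 _ _ hd).elim (pd_ndvd hc) hne
  have hdeg : (pderiv c g * E).totalDegree ≤ 12 * g.totalDegree := by
    refine (totalDegree_mul _ _).trans ?_
    have := pd_deg g c
    omega
  have h2 := bez g _ hg h1 S (fun l hl => (hS.2 l hl).1) (by
    intro l hl
    obtain ⟨hl1, P, hP, hP2⟩ := hS.2 l hl
    refine res_zero_of_pts l _ P (fun x hx => (hP2 x hx).1) ?_ (by omega)
    intro x hx
    rw [map_mul]
    by_cases h0 : eval x (pderiv c g) = 0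
    · rw [h0, zero_mul]
    · rw [h l x hl1 (hP2 x hx) h0, mul_zero])
  have := hS.1
  have : g.totalDegree * (pderiv c g * E).totalDegree ≤ g.totalDegree * (12 * g.totalDegree) := Nat.mul_le_mul_left _ hdeg
  nlinarith

lemma crs_dir {g : Poly} {a b c : Fin 3} (I : Idx a b c) {l m : Ln} (hl : res l g = 0) (hm : res m g = 0) (hne : m ≠ l)
    {x : Fin 3 → ℝ} (hx : l.on x) (hx' : m.on x) (h0 : eval x (pderiv c g) ≠ 0) :
    l.dir a * m.dir b - l.dir b * m.dir a ≠ 0 := by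
  have key : ∀ l : Ln, res l g = 0 → l.on x → l.dir c * eval x (pderiv c g) = - (l.dir a * eval x (pderiv a g)) - l.dir b * eval x (pderiv b g) := by
    intro l hl hx
    have h1 := line1 I hl
    have h2 := congrArg (Polynomial.eval (x 2)) h1
    rw [Polynomial.eval_mul, eval_res, eval_res, eval_res, ← hx] at h2
    simp at h2
    linarith
  intro hD
  have k1 := key l hl hx
  have k2 := key m hm hx'
  have hac : l.dir a * m.dir c - l.dir c * m.dir a = 0 := by
    apply (mul_eq_zero.1 _).resolve_left h0
    linear_combination l.dir a * k2 - m.dir a * k1 - eval x (pderiv b g) * hD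
  have hbc : l.dir b * m.dir c - l.dir c * m.dir b = 0 := by
    apply (mul_eq_zero.1 _).resolve_left h0
    linear_combination l.dir b * k2 - m.dir b * k1 + eval x (pderiv a g) * hD
  have hall : ∀ i j, l.dir i * m.dir j = l.dir j * m.dir i := by
    intro i j
    rcases I.cov i with rfl | rfl | rfl <;> rcases I.cov j with rfl | rfl | rfl <;> first | rfl | linarith
  have h20 := hall 0 2
  have h21 := hall 1 2
  simp [Ln.dir] at h20 h21
  apply hne
  rw [on_iff] at hx hx'
  have g1 := hx.1; have g2 := hx.2; have g3 := hx'.1; have g4 := hx'.2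
  rw [h20] at g1
  rw [h21] at g2
  ext <;> linarith

lemma ev_hh {g : Poly} {a b c : Fin 3} (I : Idx a b c) {l : Ln} (hl : res l g = 0) {x : Fin 3 → ℝ} (hx : l.on x) :
    l.dir a ^ 2 * eval x (hh g c a a) + 2 * l.dir a * l.dir b * eval x (hh g c a b) + l.dir b ^ 2 * eval x (hh g c b b) = 0 := by
  have h := eval_of_res (line_hh I hl) hx
  rw [hh_comm g c b a] at h
  simp at h
  linear_combination h

lemma ev_tt {g : Poly} {a b c : Fin 3} (I : Idx a b c) {l : Ln} (hl : res l g = 0) {x : Fin 3 → ℝ} (hx : l.on x) :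
    l.dir a ^ 3 * eval x (tt g c a a a) + 3 * l.dir a ^ 2 * l.dir b * eval x (tt g c a a b) +
    3 * l.dir a * l.dir b ^ 2 * eval x (tt g c a b b) + l.dir b ^ 3 * eval x (tt g c b b b) = 0 := by
  have h := eval_of_res (line_tt I hl) hx
  rw [tt_comm1 g c b a a, tt_comm2 g c a b a, tt_comm2 g c b b a, tt_comm1 g c b a b] at h
  simp at h
  linear_combination h

end GK
end
end

section
open MvPolynomial
noncomputable section
namespace GK

lemma td_mul {f g : Poly} {m n : ℕ} (hf : f.totalDegree ≤ m) (hg : g.totalDegree ≤ n) : (f * g).totalDegree ≤ m + n :=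
  (totalDegree_mul _ _).trans (add_le_add hf hg)
lemma td_add {f g : Poly} {m : ℕ} (hf : f.totalDegree ≤ m) (hg : g.totalDegree ≤ m) : (f + g).totalDegree ≤ m :=
  (totalDegree_add _ _).trans (max_le hf hg)
lemma td_sub {f g : Poly} {m : ℕ} (hf : f.totalDegree ≤ m) (hg : g.totalDegree ≤ m) : (f - g).totalDegree ≤ m :=
  (totalDegree_sub _ _).trans (max_le hf hg)
lemma td_ofNat (n : ℕ) [n.AtLeastTwo] : (OfNat.ofNat n : Poly).totalDegree ≤ 0 := by
  have : (OfNat.ofNat n : Poly) = C (OfNat.ofNat n) := (map_ofNat C n).symm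
  rw [this, totalDegree_C]

lemma det_deg {h11 h12 h22 : Poly} {d : ℕ} (a1 : h11.totalDegree ≤ 3 * d) (a2 : h12.totalDegree ≤ 3 * d)
    (a3 : h22.totalDegree ≤ 3 * d) : (h11 * h22 - h12 ^ 2).totalDegree ≤ 6 * d := by
  rw [pow_two]
  exact td_sub ((td_mul a1 a3).trans (by omega)) ((td_mul a2 a2).trans (by omega))

lemma mu_deg {h11 h12 h22 t111 t112 t122 : Poly} {d : ℕ} (a1 : h11.totalDegree ≤ 3 * d) (a2 : h12.totalDegree ≤ 3 * d)
    (a3 : h22.totalDegree ≤ 3 * d) (b1 : t111.totalDegree ≤ 5 * d) (b2 : t112.totalDegree ≤ 5 * d) (b3 : t122.totalDegree ≤ 5 * d) :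
    (mu1 h11 h12 h22 t111 t112 t122).totalDegree ≤ 8 * d :=
  td_add (td_sub ((td_mul a3 b1).trans (by omega)) ((td_mul (td_mul (td_ofNat 2) a2) b2).trans (by omega))) ((td_mul a1 b3).trans (by omega))

lemma w1_deg {h11 h12 h22 t111 t112 t122 : Poly} {d : ℕ} (a1 : h11.totalDegree ≤ 3 * d) (a2 : h12.totalDegree ≤ 3 * d)
    (a3 : h22.totalDegree ≤ 3 * d) (b1 : t111.totalDegree ≤ 5 * d) (b2 : t112.totalDegree ≤ 5 * d) (b3 : t122.totalDegree ≤ 5 * d) :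
    (w1 h11 h12 h22 t111 t112 t122).totalDegree ≤ 11 * d :=
  td_sub ((td_mul (td_mul (td_ofNat 4) (det_deg a1 a2 a3)) b1).trans (by omega))
    ((td_mul (td_mul (td_ofNat 3) (mu_deg a1 a2 a3 b1 b2 b3)) a1).trans (by omega))

lemma w2_deg {h11 h12 h22 t111 t112 t122 t222 : Poly} {d : ℕ} (a1 : h11.totalDegree ≤ 3 * d) (a2 : h12.totalDegree ≤ 3 * d)
    (a3 : h22.totalDegree ≤ 3 * d) (b1 : t111.totalDegree ≤ 5 * d) (b2 : t112.totalDegree ≤ 5 * d) (b3 : t122.totalDegree ≤ 5 * d)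
    (b4 : t222.totalDegree ≤ 5 * d) :
    (w2 h11 h12 h22 t111 t112 t122 t222).totalDegree ≤ 11 * d :=
  td_sub ((td_mul (td_mul (td_ofNat 4) (det_deg a1 a2 a3)) b2).trans (by omega))
    (td_add ((td_mul (td_mul (td_ofNat 2) (mu_deg a1 a2 a3 b1 b2 b3)) a2).trans (by omega))
    ((td_mul (mu_deg a3 a2 a1 b4 b3 b2) a1).trans (by omega)))

lemma map_w1 {R S : Type} [CommRing R] [CommRing S] (φ : R →+* S) (h11 h12 h22 t111 t112 t122 : R) :
    φ (w1 h11 h12 h22 t111 t112 t122) = w1 (φ h11) (φ h12) (φ h22) (φ t111) (φ t112) (φ t122) := by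
  simp [w1, mu1, map_ofNat]
lemma map_w2 {R S : Type} [CommRing R] [CommRing S] (φ : R →+* S) (h11 h12 h22 t111 t112 t122 t222 : R) :
    φ (w2 h11 h12 h22 t111 t112 t122 t222) = w2 (φ h11) (φ h12) (φ h22) (φ t111) (φ t112) (φ t122) (φ t222) := by
  simp [w2, mu1, map_ofNat]

def pdet (g : Poly) (a b c : Fin 3) : Poly := hh g c a a * hh g c b b - hh g c a b ^ 2

section
variable {g : Poly} (hg : Irreducible g) {a b c : Fin 3} (I : Idx a b c) (hc : pderiv c g ≠ 0) {S : Finset Ln} (hS : rich g S)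
include hg I hc hS

lemma dvd_ws : g ∣ w1 (hh g c a a) (hh g c a b) (hh g c b b) (tt g c a a a) (tt g c a a b) (tt g c a b b) ∧
    g ∣ w2 (hh g c a a) (hh g c a b) (hh g c b b) (tt g c a a a) (tt g c a a b) (tt g c a b b) (tt g c b b b) ∧
    g ∣ w2 (hh g c b b) (hh g c a b) (hh g c a a) (tt g c b b b) (tt g c a b b) (tt g c a a b) (tt g c a a a) ∧
    g ∣ w1 (hh g c b b) (hh g c a b) (hh g c a a) (tt g c b b b) (tt g c a b b) (tt g c a a b) := by
  have key : ∀ l x, res l g = 0 → crs g l x → eval x (pderiv c g) ≠ 0 →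
      w1 (eval x (hh g c a a)) (eval x (hh g c a b)) (eval x (hh g c b b)) (eval x (tt g c a a a)) (eval x (tt g c a a b)) (eval x (tt g c a b b)) = 0 ∧
      w2 (eval x (hh g c a a)) (eval x (hh g c a b)) (eval x (hh g c b b)) (eval x (tt g c a a a)) (eval x (tt g c a a b)) (eval x (tt g c a b b)) (eval x (tt g c b b b)) = 0 ∧
      w2 (eval x (hh g c b b)) (eval x (hh g c a b)) (eval x (hh g c a a)) (eval x (tt g c b b b)) (eval x (tt g c a b b)) (eval x (tt g c a a b)) (eval x (tt g c a a a)) = 0 ∧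
      w1 (eval x (hh g c b b)) (eval x (hh g c a b)) (eval x (hh g c a a)) (eval x (tt g c b b b)) (eval x (tt g c a b b)) (eval x (tt g c a a b)) = 0 := by
    rintro l x h1 ⟨h2, m, hm, hmg, hmx⟩ h3
    exact pt_w (crs_dir I h1 hmg hm h2 hmx h3) (ev_hh I h1 h2) (ev_hh I hmg hmx) (ev_tt I h1 h2) (ev_tt I hmg hmx)
  refine ⟨van hg hc hS (w1_deg (hh_deg _ _ _ _) (hh_deg _ _ _ _) (hh_deg _ _ _ _) (tt_deg _ _ _ _ _) (tt_deg _ _ _ _ _) (tt_deg _ _ _ _ _)) ?_,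
    van hg hc hS (w2_deg (hh_deg _ _ _ _) (hh_deg _ _ _ _) (hh_deg _ _ _ _) (tt_deg _ _ _ _ _) (tt_deg _ _ _ _ _) (tt_deg _ _ _ _ _) (tt_deg _ _ _ _ _)) ?_,
    van hg hc hS (w2_deg (hh_deg _ _ _ _) (hh_deg _ _ _ _) (hh_deg _ _ _ _) (tt_deg _ _ _ _ _) (tt_deg _ _ _ _ _) (tt_deg _ _ _ _ _) (tt_deg _ _ _ _ _)) ?_,
    van hg hc hS (w1_deg (hh_deg _ _ _ _) (hh_deg _ _ _ _) (hh_deg _ _ _ _) (tt_deg _ _ _ _ _) (tt_deg _ _ _ _ _) (tt_deg _ _ _ _ _)) ?_⟩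
  · intro l x h1 h2 h3; rw [map_w1]; exact (key l x h1 h2 h3).1
  · intro l x h1 h2 h3; rw [map_w2]; exact (key l x h1 h2 h3).2.1
  · intro l x h1 h2 h3; rw [map_w2]; exact (key l x h1 h2 h3).2.2.1
  · intro l x h1 h2 h3; rw [map_w1]; exact (key l x h1 h2 h3).2.2.2

lemma dvd_flat (hd : g ∣ pdet g a b c) : g ∣ hh g c a a ∧ g ∣ hh g c a b ∧ g ∣ hh g c b b := by
  have key : ∀ l x, res l g = 0 → crs g l x → eval x (pderiv c g) ≠ 0 →
      eval x (hh g c a a) = 0 ∧ eval x (hh g c a b) = 0 ∧ eval x (hh g c b b) = 0 := by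
    rintro l x h1 ⟨h2, m, hm, hmg, hmx⟩ h3
    refine pt_det (crs_dir I h1 hmg hm h2 hmx h3) (ev_hh I h1 h2) (ev_hh I hmg hmx) ?_
    obtain ⟨k, hk⟩ := hd
    have : eval x (pdet g a b c) = 0 := by rw [hk, map_mul, eval_of_res h1 h2, zero_mul]
    rw [pdet, map_sub, map_mul, map_pow] at this
    exact this
  refine ⟨van hg hc hS ((hh_deg _ _ _ _).trans (by omega)) ?_, van hg hc hS ((hh_deg _ _ _ _).trans (by omega)) ?_, van hg hc hS ((hh_deg _ _ _ _).trans (by omega)) ?_⟩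
  · intro l x h1 h2 h3; exact (key l x h1 h2 h3).1
  · intro l x h1 h2 h3; exact (key l x h1 h2 h3).2.1
  · intro l x h1 h2 h3; exact (key l x h1 h2 h3).2.2
end

lemma der_frac {K : Type} [Field K] [Algebra ℝ K] (π : Poly →ₐ[ℝ] K) (δ : Derivation ℝ K K) {g : Poly} {c j : Fin 3}
    (h0 : π (pderiv c g) ≠ 0) (hδ : ∀ F, δ (π F) = π (dv g c j F) / π (pderiv c g)) (n : ℕ) (F : Poly) :
    δ (π F / π (pderiv c g) ^ (n+1)) = π (nn (n+1) g c j F) / π (pderiv c g) ^ (n+3) := by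
  have h1 : π F = (π F / π (pderiv c g) ^ (n+1)) * π (pderiv c g) ^ (n+1) := by field_simp
  have h2 := congrArg δ h1
  rw [Derivation.leibniz, hδ, Derivation.leibniz_pow, hδ] at h2
  simp only [smul_eq_mul, nsmul_eq_mul, Nat.add_one_sub_one] at h2
  generalize δ (π F / π (pderiv c g) ^ (n+1)) = y at h2 ⊢
  unfold nn
  simp only [map_sub, map_mul, map_natCast]
  field_simp at h2 ⊢
  apply mul_left_cancel₀ (pow_ne_zero n h0)
  linear_combination -h2

lemma kfield {g : Poly} (hg : Irreducible g) {a b c : Fin 3} (I : Idx a b c) (hc : pderiv c g ≠ 0) :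
    ∃ (K : Type) (_ : Field K) (_ : Algebra ℝ K) (π : Poly →ₐ[ℝ] K) (δ₁ δ₂ : Derivation ℝ K K),
    (∀ F, π F = 0 ↔ g ∣ F) ∧ (∀ F, δ₁ (π F) = π (dv g c a F) / π (pderiv c g)) ∧
    (∀ F, δ₂ (π F) = π (dv g c b F) / π (pderiv c g)) ∧ ∀ z, δ₁ (δ₂ z) = δ₂ (δ₁ z) := by
  obtain ⟨K, i1, i2, π, hk, hgen, hex⟩ := exists_K g hg
  have h0 : π (pderiv c g) ≠ 0 := fun h => pd_ndvd hc ((hk _).1 h)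
  have ex : ∀ j, j ≠ c → ∃ δ : Derivation ℝ K K, ∀ F, δ (π F) = π (dv g c j F) / π (pderiv c g) := by
    intro j hj
    have hs : ∀ F, ∑ i, π (pderiv i F) * (if i = c then - π (pderiv j g) / π (pderiv c g) else if i = j then 1 else 0) =
        π (dv g c j F) / π (pderiv c g) := by
      intro F
      rw [I.sum, dv]
      rcases I.cov j with rfl | rfl | rfl
      · simp [I.ac, I.bc, I.ab.symm]; field_simp; ring
      · simp [I.ac, I.bc, I.ab]; field_simp; ring
      · exact absurd rfl hj
    obtain ⟨δ, hδ⟩ := hex _ ((hs g).trans (by simp [dv, mul_comm]))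
    exact ⟨δ, fun F => (hδ F).trans (hs F)⟩
  obtain ⟨δ₁, h1⟩ := ex a I.ac
  obtain ⟨δ₂, h2⟩ := ex b I.bc
  refine ⟨K, i1, i2, π, δ₁, δ₂, hk, h1, h2, ?_⟩
  have hE : ∀ F, ⁅δ₁, δ₂⁆ (π F) = 0 := by
    intro F
    rw [Derivation.commutator_apply, h1, h2]
    have e1 := der_frac π δ₁ h0 h1 0 (dv g c b F)
    have e2 := der_frac π δ₂ h0 h2 0 (dv g c a F)
    simp only [zero_add, pow_one] at e1 e2
    rw [e1, e2, dv_comm, sub_self]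
  intro z
  rw [← sub_eq_zero, ← Derivation.commutator_apply]
  obtain ⟨F, G, hG, hz⟩ := hgen z
  have := congrArg (⁅δ₁, δ₂⁆ : Derivation ℝ K K) hz
  rw [Derivation.leibniz, hE, hE, smul_zero, zero_add, smul_eq_mul] at this
  exact (mul_eq_zero.1 this).resolve_left hG

end GK
end
end

section
open MvPolynomial
noncomputable section
namespace GK

def qF {R : Type} [CommRing R] (S h11 h12 h22 l1 l2 ψ p1 p2 η1 η2 e : R) : R :=
  (S * e - p1 * η1 - p2 * η2) * (S - l1 * η1 - l2 * η2) * 2 * S - S ^ 2 * (h11 * η1 ^ 2 + 2 * h12 * η1 * η2 + h22 * η2 ^ 2)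
    - ψ * (S * e - p1 * η1 - p2 * η2) ^ 2

lemma map_qF {R T : Type} [CommRing R] [CommRing T] (φ : R →+* T) (S h11 h12 h22 l1 l2 ψ p1 p2 η1 η2 e : R) :
    φ (qF S h11 h12 h22 l1 l2 ψ p1 p2 η1 η2 e) = qF (φ S) (φ h11) (φ h12) (φ h22) (φ l1) (φ l2) (φ ψ) (φ p1) (φ p2) (φ η1) (φ η2) (φ e) := by
  simp [qF, map_ofNat]

def InA {K : Type} [Field K] [Algebra ℝ K] (π : Poly →ₐ[ℝ] K) (s : Poly) (u : K) : Prop := ∃ (n : ℕ) (F : Poly), u * π s ^ n = π F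

section
variable {K : Type} [Field K] [Algebra ℝ K] {π : Poly →ₐ[ℝ] K} {s : Poly}

lemma InA.poly (F : Poly) : InA π s (π F) := ⟨0, F, by simp⟩
lemma InA.add {u v : K} (hu : InA π s u) (hv : InA π s v) : InA π s (u + v) := by
  obtain ⟨n, F, hF⟩ := hu
  obtain ⟨m, G, hG⟩ := hv
  refine ⟨n + m, F * s ^ m + G * s ^ n, ?_⟩
  simp only [map_add, map_mul, map_pow, ← hF, ← hG]
  ring
lemma InA.mul {u v : K} (hu : InA π s u) (hv : InA π s v) : InA π s (u * v) := by
  obtain ⟨n, F, hF⟩ := hu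
  obtain ⟨m, G, hG⟩ := hv
  refine ⟨n + m, F * G, ?_⟩
  simp only [map_mul, ← hF, ← hG]
  ring
lemma InA.pow {u : K} (hu : InA π s u) (n : ℕ) : InA π s (u ^ n) := by
  induction n with
  | zero => exact ⟨0, 1, by simp⟩
  | succ k ih => rw [pow_succ]; exact ih.mul hu
lemma InA.real (r : ℝ) : InA π s (algebraMap ℝ K r) := by
  have := InA.poly (π := π) (s := s) (C r)
  rwa [← MvPolynomial.algebraMap_eq, AlgHom.commutes] at this
lemma InA.neg {u : K} (hu : InA π s u) : InA π s (-u) := by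
  have := (InA.real (π := π) (s := s) (-1)).mul hu
  simpa using this
lemma InA.sub {u v : K} (hu : InA π s u) (hv : InA π s v) : InA π s (u - v) := by
  rw [sub_eq_add_neg]; exact hu.add hv.neg
lemma InA.nat (n : ℕ) : InA π s (n : K) := by
  have := InA.real (π := π) (s := s) n
  rwa [map_natCast] at this
lemma InA.ofNat (n : ℕ) [n.AtLeastTwo] : InA π s (OfNat.ofNat n : K) := by
  have := InA.real (π := π) (s := s) (OfNat.ofNat n)
  rwa [map_ofNat] at this
lemma InA.cancel {u : K} {n : ℕ} (hu : InA π s (u * π s ^ n)) : InA π s u := by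
  obtain ⟨m, F, hF⟩ := hu
  exact ⟨n + m, F, by rw [← hF]; ring⟩
lemma InA.inv {q : Poly} {t : Poly} (hq : π q ≠ 0) (h : s = q * t) : InA π s (π q)⁻¹ := by
  refine ⟨1, t, ?_⟩
  rw [h, map_mul]; field_simp

lemma InA.der {u : K} (hu : InA π s u) (δ : Derivation ℝ K K) (hδ : ∀ F, InA π s (δ (π F))) : InA π s (δ u) := by
  obtain ⟨n, F, hF⟩ := hu
  have h := congrArg δ hF
  rw [Derivation.leibniz, Derivation.leibniz_pow] at h
  simp only [smul_eq_mul, nsmul_eq_mul] at h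
  apply InA.cancel (n := n + 1)
  have : δ u * π s ^ (n + 1) = δ (π F) * π s - (n : K) * π F * δ (π s) := by
    rw [← hF, ← hF] at *
    rcases n with _ | n
    · simp at h ⊢
    · simp only [Nat.add_one_sub_one] at h
      rw [← h]; ring
  rw [this]
  exact ((hδ F).mul (InA.poly _)).sub (((InA.nat n).mul (InA.poly F)).mul (hδ s))

lemma InA.common {ι : Type} [Fintype ι] (u : ι → K) (h : ∀ i, InA π s (u i)) :
    ∃ (n : ℕ) (F : ι → Poly), ∀ i, π (F i) = π (s ^ n) * u i := by
  classical
  choose n F hF using h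
  refine ⟨∑ i, n i, fun i => F i * s ^ (∑ j ∈ Finset.univ.erase i, n j), fun i => ?_⟩
  rw [map_mul, ← hF, ← Finset.add_sum_erase _ _ (Finset.mem_univ i), pow_add, map_mul, map_pow, map_pow]
  ring
end

section
variable {K : Type} [Field K] [Algebra ℝ K] {π : Poly →ₐ[ℝ] K} (δ₁ δ₂ : Derivation ℝ K K)
    {g : Poly} {a b c : Fin 3} (I : Idx a b c) (hk : ∀ F, π F = 0 ↔ g ∣ F)
    (hδ₁ : ∀ F, δ₁ (π F) = π (dv g c a F) / π (pderiv c g))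
    (hδ₂ : ∀ F, δ₂ (π F) = π (dv g c b F) / π (pderiv c g))

def kp (π : Poly →ₐ[ℝ] K) (g : Poly) (c i : Fin 3) : K := π (-pderiv i g) / π (pderiv c g) ^ 1
def kh (π : Poly →ₐ[ℝ] K) (g : Poly) (c i j : Fin 3) : K := π (hh g c i j) / π (pderiv c g) ^ 3
def kt (π : Poly →ₐ[ℝ] K) (g : Poly) (c i j k : Fin 3) : K := π (tt g c i j k) / π (pderiv c g) ^ 5

def QQ (π : Poly →ₐ[ℝ] K) (g : Poly) (a b c : Fin 3) (l1 l2 ψ : K) (ξ : Fin 3 → ℝ) : K :=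
  qf (kh π g c a a) (kh π g c a b) (kh π g c b b) l1 l2 ψ (kp π g c a) (kp π g c b)
    (algebraMap ℝ K (ξ a) - π (X a)) (algebraMap ℝ K (ξ b) - π (X b)) (algebraMap ℝ K (ξ c) - π (X c))

lemma der_kp (h0 : π (pderiv c g) ≠ 0) (δ : Derivation ℝ K K) (j : Fin 3) (hδ : ∀ F, δ (π F) = π (dv g c j F) / π (pderiv c g)) (i : Fin 3) :
    δ (kp π g c i) = kh π g c i j := der_frac π δ h0 hδ 0 _
lemma der_kh (h0 : π (pderiv c g) ≠ 0) (δ : Derivation ℝ K K) (j : Fin 3) (hδ : ∀ F, δ (π F) = π (dv g c j F) / π (pderiv c g)) (i i' : Fin 3) :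
    δ (kh π g c i i') = kt π g c i i' j := der_frac π δ h0 hδ 2 _
lemma der_X (δ : Derivation ℝ K K) (j : Fin 3) (h0 : π (pderiv c g) ≠ 0) (hjc : j ≠ c) (hδ : ∀ F, δ (π F) = π (dv g c j F) / π (pderiv c g)) (i : Fin 3) (hic : i ≠ c) (r : ℝ) :
    δ (algebraMap ℝ K r - π (X i)) = if i = j then -1 else 0 := by
  rw [map_sub, Derivation.map_algebraMap, hδ, dv, pderiv_X_of_ne hic]
  split_ifs with h
  · subst h; rw [pderiv_X_self]; simp [h0]
  · rw [pderiv_X_of_ne h]; simp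
lemma der_Xc (δ : Derivation ℝ K K) (j : Fin 3) (hjc : j ≠ c) (hδ : ∀ F, δ (π F) = π (dv g c j F) / π (pderiv c g)) (r : ℝ) :
    δ (algebraMap ℝ K r - π (X c)) = - kp π g c j := by
  rw [map_sub, Derivation.map_algebraMap, hδ, dv, pderiv_X_self, pderiv_X_of_ne hjc.symm, kp]
  simp

lemma qf_swap (h11 h12 h22 l1 l2 ψ p1 p2 η1 η2 e : K) : qf h11 h12 h22 l1 l2 ψ p1 p2 η1 η2 e = qf h22 h12 h11 l2 l1 ψ p2 p1 η2 η1 e := by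
  unfold qf; ring

include I hδ₁ hδ₂ in
lemma QQ_der (h0 : π (pderiv c g) ≠ 0) {l1 l2 ψ : K}
    (t1 : kt π g c a a a = 3 * l1 * kh π g c a a) (t2 : kt π g c a a b = 2 * l1 * kh π g c a b + l2 * kh π g c a a)
    (t3 : kt π g c a b b = l1 * kh π g c b b + 2 * l2 * kh π g c a b) (t4 : kt π g c b b b = 3 * l2 * kh π g c b b)
    (r : δ₁ l1 = l1 ^ 2 + ψ * kh π g c a a ∧ δ₂ l1 = l1 * l2 + ψ * kh π g c a b ∧ δ₁ l2 = l1 * l2 + ψ * kh π g c a b ∧ δ₂ l2 = l2 ^ 2 + ψ * kh π g c b b)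
    (hψ : δ₁ ψ = ψ * l1 ∧ δ₂ ψ = ψ * l2) (ξ : Fin 3 → ℝ) :
    δ₁ (QQ π g a b c l1 l2 ψ ξ) = l1 * QQ π g a b c l1 l2 ψ ξ ∧ δ₂ (QQ π g a b c l1 l2 ψ ξ) = l2 * QQ π g a b c l1 l2 ψ ξ := by
  constructor
  · refine qf_der δ₁ (der_kp h0 δ₁ a hδ₁ a) ?_ (der_Xc δ₁ a I.ac hδ₁ _) ?_ ?_ ?_ ?_ ?_ r.1 r.2.2.1 hψ.1
    · rw [der_kp h0 δ₁ a hδ₁ b, kh, kh, hh_comm]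
    · rw [der_X δ₁ a h0 I.ac hδ₁ a I.ac, if_pos rfl]
    · rw [der_X δ₁ a h0 I.ac hδ₁ b I.bc, if_neg I.ab.symm]
    · rw [der_kh h0 δ₁ a hδ₁, t1]
    · rw [der_kh h0 δ₁ a hδ₁, ← t2, kt, kt, tt_comm2]
    · rw [der_kh h0 δ₁ a hδ₁, ← t3, kt, kt, tt_comm2, tt_comm1]
  · unfold QQ
    rw [qf_swap]
    refine qf_der δ₂ (der_kp h0 δ₂ b hδ₂ b) (der_kp h0 δ₂ b hδ₂ a) (der_Xc δ₂ b I.bc hδ₂ _) ?_ ?_ ?_ ?_ ?_ r.2.2.2 (r.2.1.trans (by ring)) hψ.2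
    · rw [der_X δ₂ b h0 I.bc hδ₂ b I.bc, if_pos rfl]
    · rw [der_X δ₂ b h0 I.bc hδ₂ a I.ac, if_neg I.ab]
    · rw [der_kh h0 δ₂ b hδ₂, t4]
    · rw [der_kh h0 δ₂ b hδ₂, t3]; ring
    · rw [der_kh h0 δ₂ b hδ₂, t2]; ring
end

def FF (s : Poly) (n : ℕ) (v : Fin 8 → Poly) (a b c : Fin 3) (ξ : Fin 3 → ℝ) : Poly :=
  qF (s ^ n) (v 0) (v 1) (v 2) (v 3) (v 4) (v 5) (v 6) (v 7) (C (ξ a) - X a) (C (ξ b) - X b) (C (ξ c) - X c)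

lemma FF_QQ {K : Type} [Field K] [Algebra ℝ K] (π : Poly →ₐ[ℝ] K) {g : Poly} {a b c : Fin 3} (s : Poly) (n : ℕ) (v : Fin 8 → Poly) (l1 l2 ψ : K)
    (hv : ∀ i, π (v i) = π (s ^ n) * ![kh π g c a a, kh π g c a b, kh π g c b b, l1, l2, ψ, kp π g c a, kp π g c b] i) (ξ : Fin 3 → ℝ) :
    π (FF s n v a b c ξ) = π (s ^ n) ^ 3 * QQ π g a b c l1 l2 ψ ξ := by
  have := map_qF (π : Poly →+* K) (s ^ n) (v 0) (v 1) (v 2) (v 3) (v 4) (v 5) (v 6) (v 7) (C (ξ a) - X a) (C (ξ b) - X b) (C (ξ c) - X c)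
  simp only [RingHom.coe_coe, hv] at this
  have hC : ∀ r, π (C r) = algebraMap ℝ K r := fun r => by rw [← MvPolynomial.algebraMap_eq, AlgHom.commutes]
  rw [FF, this, QQ, map_sub, map_sub, map_sub, hC, hC, hC, qF, qf]
  simp only [Matrix.cons_val]
  ring

lemma FF_wr {K : Type} [Field K] [Algebra ℝ K] (π : Poly →ₐ[ℝ] K) {g : Poly} {c j : Fin 3} (hk : ∀ F, π F = 0 ↔ g ∣ F)
    (h0 : π (pderiv c g) ≠ 0) (δ : Derivation ℝ K K) (hδ : ∀ F, δ (π F) = π (dv g c j F) / π (pderiv c g)) (F F' : Poly) (σ q q' l : K)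
    (hF : π F = σ * q) (hF' : π F' = σ * q') (hq : δ q = l * q) (hq' : δ q' = l * q') : g ∣ F * dv g c j F' - F' * dv g c j F := by
  rw [← hk, map_sub, map_mul, map_mul]
  have e : ∀ G, π (dv g c j G) = δ (π G) * π (pderiv c g) := fun G => by rw [hδ]; field_simp
  rw [e, e, hF, hF', Derivation.leibniz, Derivation.leibniz, hq, hq']
  simp only [smul_eq_mul]
  ring

lemma quad_pack {g : Poly} (hg : Irreducible g) {a b c : Fin 3} (I : Idx a b c) (hc : pderiv c g ≠ 0) {S : Finset Ln} (hS : rich g S) :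
    ∃ (s : Poly) (n : ℕ) (v : Fin 8 → Poly), ¬ g ∣ s ∧ s.totalDegree ≤ 7 * g.totalDegree ∧ pderiv c g ∣ s ∧
      ∀ ξ ξ', g ∣ FF s n v a b c ξ * dv g c a (FF s n v a b c ξ') - FF s n v a b c ξ' * dv g c a (FF s n v a b c ξ) ∧
        g ∣ FF s n v a b c ξ * dv g c b (FF s n v a b c ξ') - FF s n v a b c ξ' * dv g c b (FF s n v a b c ξ) := by
  obtain ⟨K, i1, i2, π, δ₁, δ₂, hk, hδ₁, hδ₂, hcomm⟩ := kfield hg I hc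
  have h0 : π (pderiv c g) ≠ 0 := fun h => pd_ndvd hc ((hk _).1 h)
  have two : (2:K) ≠ 0 := by
    have : algebraMap ℝ K 2 ≠ 0 := by
      rw [Ne, map_eq_zero_iff _ (algebraMap ℝ K).injective]; norm_num
    rwa [map_ofNat] at this
  suffices H : ∃ (s : Poly) (l1 l2 ψ : K), ¬ g ∣ s ∧ s.totalDegree ≤ 7 * g.totalDegree ∧ pderiv c g ∣ s ∧ InA π s l1 ∧ InA π s l2 ∧ InA π s ψ ∧
      ∀ ξ, δ₁ (QQ π g a b c l1 l2 ψ ξ) = l1 * QQ π g a b c l1 l2 ψ ξ ∧ δ₂ (QQ π g a b c l1 l2 ψ ξ) = l2 * QQ π g a b c l1 l2 ψ ξ by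
    obtain ⟨s, l1, l2, ψ, hs1, hs2, ⟨t, hs3⟩, a1, a2, a3, hQ⟩ := H
    have hi : InA π s (π (pderiv c g))⁻¹ := InA.inv h0 hs3
    have hp : ∀ i, InA π s (kp π g c i) := fun i => by
      rw [kp, div_eq_mul_inv, pow_one]; exact (InA.poly _).mul hi
    have hh' : ∀ i j, InA π s (kh π g c i j) := fun i j => by
      rw [kh, div_eq_mul_inv, ← inv_pow]; exact (InA.poly _).mul (hi.pow 3)
    obtain ⟨n, v, hv⟩ := InA.common (π := π) (s := s) ![kh π g c a a, kh π g c a b, kh π g c b b, l1, l2, ψ, kp π g c a, kp π g c b] (by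
      intro i
      fin_cases i
      · exact hh' _ _
      · exact hh' _ _
      · exact hh' _ _
      · exact a1
      · exact a2
      · exact a3
      · exact hp _
      · exact hp _)
    refine ⟨s, n, v, hs1, hs2, ⟨t, hs3⟩, fun ξ ξ' => ⟨?_, ?_⟩⟩
    · exact FF_wr π hk h0 δ₁ hδ₁ _ _ _ _ _ l1 (FF_QQ π s n v l1 l2 ψ hv ξ) (FF_QQ π s n v l1 l2 ψ hv ξ') (hQ ξ).1 (hQ ξ').1
    · exact FF_wr π hk h0 δ₂ hδ₂ _ _ _ _ _ l2 (FF_QQ π s n v l1 l2 ψ hv ξ) (FF_QQ π s n v l1 l2 ψ hv ξ') (hQ ξ).2 (hQ ξ').2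
  by_cases hd : g ∣ pdet g a b c
  · obtain ⟨f1, f2, f3⟩ := dvd_flat hg I hc hS hd
    have k1 : kh π g c a a = 0 := by rw [kh, (hk _).2 f1, zero_div]
    have k2 : kh π g c a b = 0 := by rw [kh, (hk _).2 f2, zero_div]
    have k3 : kh π g c b b = 0 := by rw [kh, (hk _).2 f3, zero_div]
    have z : InA π (pderiv c g) (0:K) := by have := InA.poly (π := π) (s := pderiv c g) 0; rwa [map_zero] at this
    refine ⟨pderiv c g, 0, 0, 0, pd_ndvd hc, (pd_deg g c).trans (by omega), dvd_rfl, z, z, z, ?_⟩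
    refine QQ_der δ₁ δ₂ I hδ₁ hδ₂ h0 ?_ ?_ ?_ ?_ ?_ ?_
    · rw [← der_kh h0 δ₁ a hδ₁, k1]; simp
    · rw [← der_kh h0 δ₂ b hδ₂, k1]; simp
    · rw [← der_kh h0 δ₂ b hδ₂, k2]; simp
    · rw [← der_kh h0 δ₂ b hδ₂, k3]; simp
    · simp
    · simp
  · have hd0 : π (pdet g a b c) ≠ 0 := fun h => hd ((hk _).1 h)
    have hs0 : π (pderiv c g * pdet g a b c) ≠ 0 := by rw [map_mul]; exact mul_ne_zero h0 hd0
    have hdet : kh π g c a a * kh π g c b b - kh π g c a b ^ 2 = π (pdet g a b c) / π (pderiv c g) ^ 6 := by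
      unfold kh pdet
      simp only [map_sub, map_mul, map_pow]
      field_simp
    have hdet0 : kh π g c a a * kh π g c b b - kh π g c a b ^ 2 ≠ 0 := by
      rw [hdet]; exact div_ne_zero hd0 (pow_ne_zero _ h0)
    obtain ⟨f1, f2, f3, f4⟩ := dvd_ws hg I hc hS
    rw [← hk, ← AlgHom.coe_toRingHom] at f1 f2 f3 f4
    rw [map_w1] at f1 f4
    rw [map_w2] at f2 f3
    simp only [AlgHom.coe_toRingHom] at f1 f2 f3 f4
    set l1 : K := mu1 (kh π g c a a) (kh π g c a b) (kh π g c b b) (kt π g c a a a) (kt π g c a a b) (kt π g c a b b) /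
      (4 * (kh π g c a a * kh π g c b b - kh π g c a b ^ 2)) with hl1
    set l2 : K := mu1 (kh π g c b b) (kh π g c a b) (kh π g c a a) (kt π g c b b b) (kt π g c a b b) (kt π g c a a b) /
      (4 * (kh π g c a a * kh π g c b b - kh π g c a b ^ 2)) with hl2
    have four : (4:K) ≠ 0 := by have := mul_ne_zero two two; norm_num at this; exact this
    have m1 : 4 * (kh π g c a a * kh π g c b b - kh π g c a b ^ 2) * l1 = mu1 (kh π g c a a) (kh π g c a b) (kh π g c b b) (kt π g c a a a) (kt π g c a a b) (kt π g c a b b) := by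
      rw [hl1]; field_simp
    have m2 : 4 * (kh π g c a a * kh π g c b b - kh π g c a b ^ 2) * l2 = mu1 (kh π g c b b) (kh π g c a b) (kh π g c a a) (kt π g c b b b) (kt π g c a b b) (kt π g c a a b) := by
      rw [hl2]; field_simp
    have eh : ∀ i j, π (hh g c i j) = kh π g c i j * π (pderiv c g) ^ 3 := fun i j => by rw [kh]; field_simp
    have et : ∀ i j k, π (tt g c i j k) = kt π g c i j k * π (pderiv c g) ^ 5 := fun i j k => by rw [kt]; field_simp
    simp only [eh, et] at f1 f2 f3 f4
    clear_value l1 l2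
    have sc := mul_ne_zero (mul_ne_zero four hdet0) (pow_ne_zero 11 h0)
    have t1 : kt π g c a a a = 3 * l1 * kh π g c a a := by
      apply mul_left_cancel₀ sc
      rw [w1, mu1] at f1
      rw [mu1] at m1
      linear_combination f1 - 3 * kh π g c a a * π (pderiv c g) ^ 11 * m1
    have t4 : kt π g c b b b = 3 * l2 * kh π g c b b := by
      apply mul_left_cancel₀ sc
      rw [w1, mu1] at f4
      rw [mu1] at m2
      linear_combination f4 - 3 * kh π g c b b * π (pderiv c g) ^ 11 * m2
    have t2 : kt π g c a a b = 2 * l1 * kh π g c a b + l2 * kh π g c a a := by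
      apply mul_left_cancel₀ sc
      rw [w2, mu1, mu1] at f2
      rw [mu1] at m1 m2
      linear_combination f2 - 2 * kh π g c a b * π (pderiv c g) ^ 11 * m1 - kh π g c a a * π (pderiv c g) ^ 11 * m2
    have t3 : kt π g c a b b = l1 * kh π g c b b + 2 * l2 * kh π g c a b := by
      apply mul_left_cancel₀ sc
      rw [w2, mu1, mu1] at f3
      rw [mu1] at m1 m2
      linear_combination f3 - 2 * kh π g c a b * π (pderiv c g) ^ 11 * m2 - kh π g c b b * π (pderiv c g) ^ 11 * m1
    obtain ⟨r, hψ⟩ := psi_der δ₁ δ₂ hcomm (h11 := kh π g c a a) (h12 := kh π g c a b) (h22 := kh π g c b b) (l1 := l1) (l2 := l2) two hdet0 rfl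
      (by rw [der_kh h0 δ₁ a hδ₁, t1]) (by rw [der_kh h0 δ₂ b hδ₂, t2]) (by rw [der_kh h0 δ₁ a hδ₁, ← t2, kt, kt, tt_comm2])
      (by rw [der_kh h0 δ₂ b hδ₂, t3]) (by rw [der_kh h0 δ₁ a hδ₁, ← t3, kt, kt, tt_comm2, tt_comm1]) (by rw [der_kh h0 δ₂ b hδ₂, t4])
    have hi : InA π (pderiv c g * pdet g a b c) (π (pderiv c g))⁻¹ := InA.inv h0 rfl
    have hi2 : InA π (pderiv c g * pdet g a b c) (π (pdet g a b c))⁻¹ := InA.inv hd0 (mul_comm _ _)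
    have hdi : InA π (pderiv c g * pdet g a b c) (kh π g c a a * kh π g c b b - kh π g c a b ^ 2)⁻¹ := by
      rw [hdet, inv_div, div_eq_mul_inv]; exact ((InA.poly _).pow 6).mul hi2
    have hh' : ∀ i j, InA π (pderiv c g * pdet g a b c) (kh π g c i j) := fun i j => by
      rw [kh, div_eq_mul_inv, ← inv_pow]; exact (InA.poly _).mul (hi.pow 3)
    have ht' : ∀ i j k, InA π (pderiv c g * pdet g a b c) (kt π g c i j k) := fun i j k => by
      rw [kt, div_eq_mul_inv, ← inv_pow]; exact (InA.poly _).mul (hi.pow 5)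
    have hr2 : InA π (pderiv c g * pdet g a b c) (2:K)⁻¹ := by
      have := InA.real (π := π) (s := pderiv c g * pdet g a b c) (2⁻¹)
      rwa [map_inv₀, map_ofNat] at this
    have hr4 : InA π (pderiv c g * pdet g a b c) (4:K)⁻¹ := by
      have := InA.real (π := π) (s := pderiv c g * pdet g a b c) (4⁻¹)
      rwa [map_inv₀, map_ofNat] at this
    have hmu : ∀ {x1 x2 x3 y1 y2 y3 : K}, InA π (pderiv c g * pdet g a b c) x1 → InA π (pderiv c g * pdet g a b c) x2 → InA π (pderiv c g * pdet g a b c) x3 →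
        InA π (pderiv c g * pdet g a b c) y1 → InA π (pderiv c g * pdet g a b c) y2 → InA π (pderiv c g * pdet g a b c) y3 →
        InA π (pderiv c g * pdet g a b c) (mu1 x1 x2 x3 y1 y2 y3) := fun b1 b2 b3 c1 c2 c3 =>
      ((b3.mul c1).sub (((InA.ofNat 2).mul b2).mul c2)).add (b1.mul c3)
    have A1 : InA π (pderiv c g * pdet g a b c) l1 := by
      rw [hl1, div_eq_mul_inv, mul_inv]
      exact (hmu (hh' _ _) (hh' _ _) (hh' _ _) (ht' _ _ _) (ht' _ _ _) (ht' _ _ _)).mul (hr4.mul hdi)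
    have A2 : InA π (pderiv c g * pdet g a b c) l2 := by
      rw [hl2, div_eq_mul_inv, mul_inv]
      exact (hmu (hh' _ _) (hh' _ _) (hh' _ _) (ht' _ _ _) (ht' _ _ _) (ht' _ _ _)).mul (hr4.mul hdi)
    have D1 : ∀ F, InA π (pderiv c g * pdet g a b c) (δ₁ (π F)) := fun F => by
      rw [hδ₁, div_eq_mul_inv]; exact (InA.poly _).mul hi
    have D2 : ∀ F, InA π (pderiv c g * pdet g a b c) (δ₂ (π F)) := fun F => by
      rw [hδ₂, div_eq_mul_inv]; exact (InA.poly _).mul hi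
    refine ⟨pderiv c g * pdet g a b c, l1, l2, _, fun h => hs0 ((hk _).2 h), ?_, dvd_mul_right _ _, A1, A2, ?_,
      QQ_der δ₁ δ₂ I hδ₁ hδ₂ h0 t1 t2 t3 t4 r hψ⟩
    · refine (td_mul (pd_deg g c) (det_deg (d := g.totalDegree) (hh_deg _ _ _ _) (hh_deg _ _ _ _) (hh_deg _ _ _ _))).trans (by omega)
    · rw [div_eq_mul_inv, mul_inv]
      refine InA.mul ?_ (hr2.mul hdi)
      exact ((((A1.der δ₁ D1).sub (A1.pow 2)).mul (hh' _ _)).sub (((InA.ofNat 2).mul ((A1.der δ₂ D2).sub (A1.mul A2))).mul (hh' _ _))).add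
        (((A2.der δ₂ D2).sub (A2.pow 2)).mul (hh' _ _))

end GK
end
end

section
open MvPolynomial
noncomputable section
namespace GK

lemma wr_aux (u h : Polynomial ℝ) (hw : Polynomial.derivative u * h = u * Polynomial.derivative h) (t : ℝ) (hu : u.eval t = 0) (hh : h.eval t ≠ 0) :
    u = 0 := by
  by_contra hne
  have hr : u.IsRoot t := hu
  have h1 := Polynomial.derivative_rootMultiplicity_of_root hr
  have hh0 : h ≠ 0 := by rintro rfl; simp at hh
  have hpos := (Polynomial.rootMultiplicity_pos hne).2 hr
  have hud : Polynomial.derivative u ≠ 0 := by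
    intro h0
    obtain ⟨r, rfl⟩ : ∃ r, u = Polynomial.C r := ⟨_, Polynomial.eq_C_of_derivative_eq_zero h0⟩
    simp at hu hne
    exact hne hu
  have hh1 : h.rootMultiplicity t = 0 := Polynomial.rootMultiplicity_eq_zero hh
  have h2 : (Polynomial.derivative u * h).rootMultiplicity t = u.rootMultiplicity t - 1 := by
    rw [Polynomial.rootMultiplicity_mul (mul_ne_zero hud hh0), h1, hh1, add_zero]
  have h3 : u.rootMultiplicity t ≤ (u * Polynomial.derivative h).rootMultiplicity t := by
    have : u * Polynomial.derivative h ≠ 0 := by rw [← hw]; exact mul_ne_zero hud hh0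
    rw [Polynomial.rootMultiplicity_mul this]; omega
  rw [← hw, h2] at h3
  omega

lemma wr_poly (f h : Polynomial ℝ) (hw : f * Polynomial.derivative h = h * Polynomial.derivative f) (s t : ℝ) :
    f.eval s * h.eval t = f.eval t * h.eval s := by
  by_cases h1 : h.eval t = 0
  · by_cases h2 : f.eval t = 0
    · simp [h1, h2]
    · have := wr_aux h f (by linear_combination hw) t h1 h2
      simp [this]
  · have := wr_aux (Polynomial.C (h.eval t) * f - Polynomial.C (f.eval t) * h) h (by
      simp only [Polynomial.derivative_sub, Polynomial.derivative_mul, Polynomial.derivative_C]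
      linear_combination - Polynomial.C (h.eval t) * hw) t (by simp; ring) h1
    have := congrArg (Polynomial.eval s) this
    simp at this
    linarith

def qP (s : Poly) (n : ℕ) (v : Fin 8 → Poly) (a b c : Fin 3) (x : Fin 3 → ℝ) : Poly :=
  qF (C (eval x (s ^ n))) (C (eval x (v 0))) (C (eval x (v 1))) (C (eval x (v 2))) (C (eval x (v 3))) (C (eval x (v 4)))
   (C (eval x (v 5))) (C (eval x (v 6))) (C (eval x (v 7))) (X a - C (x a)) (X b - C (x b)) (X c - C (x c))

lemma qP_eval (s : Poly) (n : ℕ) (v : Fin 8 → Poly) (a b c : Fin 3) (x ξ : Fin 3 → ℝ) :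
    eval ξ (qP s n v a b c x) = eval x (FF s n v a b c ξ) := by
  rw [qP, FF, map_qF, map_qF]
  simp

lemma qP_deg (s : Poly) (n : ℕ) (v : Fin 8 → Poly) (a b c : Fin 3) (x : Fin 3 → ℝ) : (qP s n v a b c x).totalDegree ≤ 2 := by
  have hC : ∀ r : ℝ, (C r : Poly).totalDegree ≤ 0 := fun r => by simp
  have hX : ∀ i r, (X i - C r : Poly).totalDegree ≤ 1 := fun i r => td_sub (by simp) (by simp)
  have h1 : ∀ r r' i t, (C r * (X i - C t) : Poly).totalDegree ≤ 1 ∧ True ∨ r' = r := fun r r' i t => Or.inl ⟨(td_mul (hC r) (hX i t)).trans (by norm_num), trivial⟩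
  have h1 : ∀ r i t, (C r * (X i - C t) : Poly).totalDegree ≤ 1 := fun r i t => (td_mul (hC r) (hX i t)).trans (by norm_num)
  have h3 : ∀ i t, ((X i - C t) ^ 2 : Poly).totalDegree ≤ 2 := fun i t => by rw [pow_two]; exact td_mul (hX _ _) (hX _ _)
  unfold qP qF
  have hk : ∀ r r' r'' : ℝ, (C r * (X c - C (x c)) - C r' * (X a - C (x a)) - C r'' * (X b - C (x b)) : Poly).totalDegree ≤ 1 :=
    fun r r' r'' => td_sub (td_sub (h1 _ _ _) (h1 _ _ _)) (h1 _ _ _)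
  have hl : ∀ r r' r'' : ℝ, (C r - C r' * (X a - C (x a)) - C r'' * (X b - C (x b)) : Poly).totalDegree ≤ 1 :=
    fun r r' r'' => td_sub (td_sub ((hC _).trans (by norm_num)) (h1 _ _ _)) (h1 _ _ _)
  refine td_sub (td_sub ?_ ?_) ?_
  · exact (td_mul (td_mul (td_mul (hk _ _ _) (hl _ _ _)) (td_ofNat 2)) (hC _)).trans (by norm_num)
  · rw [← map_pow]
    refine (td_mul (hC _) (td_add (td_add ?_ ?_) ?_)).trans (by norm_num : 0 + 2 ≤ 2)
    · exact (td_mul (hC _) (h3 _ _)).trans (by norm_num)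
    · exact (td_mul (td_mul (td_mul (td_ofNat 2) (hC _)) (hX _ _)) (hX _ _)).trans (by norm_num)
    · exact (td_mul (hC _) (h3 _ _)).trans (by norm_num)
  · rw [pow_two]
    exact (td_mul (hC _) (td_mul (hk _ _ _) (hk _ _ _))).trans (by norm_num)

lemma FF_self (s : Poly) (n : ℕ) (v : Fin 8 → Poly) (a b c : Fin 3) (x : Fin 3 → ℝ) : eval x (FF s n v a b c x) = 0 := by
  rw [FF, map_qF]
  simp [qF]

lemma FF_ne {a b c : Fin 3} (I : Idx a b c) (s : Poly) (n : ℕ) (v : Fin 8 → Poly) (x : Fin 3 → ℝ) (hs : eval x s ≠ 0) :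
    ∃ ξ, eval x (FF s n v a b c ξ) ≠ 0 := by
  by_contra! hne
  have key : ∀ t : ℝ, 2 * t * (eval x s ^ n) ^ 3 - eval x (v 5) * (eval x s ^ n * t) ^ 2 = 0 := by
    intro t
    have := hne (Function.update x c (x c + t))
    rw [FF, map_qF] at this
    simp [qF, Function.update_of_ne I.ac, Function.update_of_ne I.bc] at this
    linear_combination this
  have h1 := key 1
  have h2 := key (-1)
  have : (eval x s ^ n) ^ 3 = 0 := by linear_combination (h1 - h2) / 4
  exact pow_ne_zero 3 (pow_ne_zero n hs) this

section
variable {g : Poly} {a b c : Fin 3} (I : Idx a b c) {s : Poly} {n : ℕ} {v : Fin 8 → Poly}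
  (hs : pderiv c g ∣ s) (hF : ∀ ξ ξ', g ∣ FF s n v a b c ξ * dv g c a (FF s n v a b c ξ') - FF s n v a b c ξ' * dv g c a (FF s n v a b c ξ) ∧
        g ∣ FF s n v a b c ξ * dv g c b (FF s n v a b c ξ') - FF s n v a b c ξ' * dv g c b (FF s n v a b c ξ))
  {l : Ln} (hl : res l g = 0)
include I hs hF hl

lemma line_prop {x y : Fin 3 → ℝ} (hx : l.on x) (hy : l.on y) (h0 : eval y s ≠ 0) (ξ ξ' : Fin 3 → ℝ) :
    eval x (FF s n v a b c ξ) * eval y (FF s n v a b c ξ') = eval y (FF s n v a b c ξ) * eval x (FF s n v a b c ξ') := by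
  have hgc : res l (pderiv c g) ≠ 0 := by
    intro h
    obtain ⟨t, rfl⟩ := hs
    apply h0
    rw [map_mul, eval_of_res h hy, zero_mul]
  have e : ∀ G, g ∣ G → res l G = 0 := by
    rintro G ⟨k, rfl⟩; rw [map_mul, hl, zero_mul]
  have e1 := e _ (hF ξ ξ').1
  have e2 := e _ (hF ξ ξ').2
  generalize FF s n v a b c ξ = F at *
  generalize FF s n v a b c ξ' = F' at *
  have hw := wr_poly (res l F) (res l F') (by
    apply mul_left_cancel₀ hgc
    have d1 := line_dv I hl F
    have d2 := line_dv I hl F'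
    simp only [map_sub, map_add, map_mul] at e1 e2 d1 d2
    linear_combination res l F * d2 - res l F' * d1 + res l (C (l.dir a)) * e1 + res l (C (l.dir b)) * e2) (x 2) (y 2)
  rw [eval_res, eval_res, eval_res, eval_res, ← hx, ← hy] at hw
  exact hw

lemma line_in {y : Fin 3 → ℝ} (hy : l.on y) (h0 : eval y s ≠ 0) : res l (qP s n v a b c y) = 0 := by
  have hs0 : res l s ≠ 0 := fun h => h0 (eval_of_res h hy)
  apply (mul_eq_zero.1 _).resolve_left hs0
  rw [← map_mul]
  apply Polynomial.funext
  intro t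
  rw [eval_res, map_mul, qP_eval, Polynomial.eval_zero]
  by_cases hz : eval (l.pt t) s = 0
  · rw [hz, zero_mul]
  · obtain ⟨ξ, hξ⟩ := FF_ne I s n v _ hz
    have := line_prop I hs hF hl hy (on_pt l t) hz (l.pt t) ξ
    rw [FF_self, zero_mul] at this
    rw [(mul_eq_zero.1 this).resolve_right hξ, mul_zero]

lemma line_in2 {x y : Fin 3 → ℝ} (hx : l.on x) (hy : l.on y) (h0 : eval y s ≠ 0) {m : Ln}
    (hm : res m (qP s n v a b c y) = 0) : res m (qP s n v a b c x) = 0 := by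
  obtain ⟨ξ, hξ⟩ := FF_ne I s n v _ h0
  apply Polynomial.funext
  intro t
  have h1 : eval (m.pt t) (qP s n v a b c y) = 0 := eval_of_res hm (on_pt m t)
  rw [eval_res, qP_eval, Polynomial.eval_zero]
  rw [qP_eval] at h1
  have := line_prop I hs hF hl hx hy h0 (m.pt t) ξ
  rw [h1, zero_mul] at this
  exact (mul_eq_zero.1 this).resolve_right hξ
end

lemma exists_line (x y : Fin 3 → ℝ) (h : x 2 ≠ y 2) : ∃ l : Ln, l.on x ∧ l.on y := by
  have h' : y 2 - x 2 ≠ 0 := sub_ne_zero.2 h.symm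
  refine ⟨⟨x 0 - x 2 * ((y 0 - x 0) / (y 2 - x 2)), x 1 - x 2 * ((y 1 - x 1) / (y 2 - x 2)), (y 0 - x 0) / (y 2 - x 2), (y 1 - x 1) / (y 2 - x 2)⟩, ?_, ?_⟩ <;>
  rw [on_iff] <;> constructor <;> simp only <;> field_simp <;> ring

lemma exists_pd {g : Poly} (hg : Irreducible g) : ∃ c, pderiv c g ≠ 0 := by
  by_contra! hz
  have hl : ∀ x y : Fin 3 → ℝ, x 2 ≠ y 2 → eval x g = eval y g := by
    intro x y hxy
    obtain ⟨l, hx, hy⟩ := exists_line x y hxy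
    have h := derivative_res l g
    simp only [hz, mul_zero, Finset.sum_const_zero, map_zero] at h
    have h2 := Polynomial.eq_C_of_derivative_eq_zero h
    rw [hx, hy, ← eval_res, ← eval_res, h2]; simp
  have hc : ∀ x, eval x g = eval ![0,0,0] g := by
    intro x
    by_cases h : x 2 = 0
    · rw [hl x ![0,0,1] (by simp [h]), hl ![0,0,1] ![0,0,0] (by simp)]
    · exact hl x _ (by simpa using h)
  have : g = C (eval ![0,0,0] g) := MvPolynomial.funext fun x => by rw [hc x, eval_C]
  apply hg.not_isUnit
  rw [this]
  apply IsUnit.map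
  rw [isUnit_iff_ne_zero]
  intro h0
  rw [h0, C_0] at this
  exact hg.ne_zero this

lemma deg_pos {g : Poly} (hg : Irreducible g) : 0 < g.totalDegree := by
  by_contra h
  have h0 : g.totalDegree = 0 := by omega
  obtain ⟨c, hc⟩ := exists_pd hg
  rw [totalDegree_eq_zero_iff_eq_C.1 h0, pderiv_C] at hc
  exact hc rfl

theorem lemY {g : Poly} (hg : Irreducible g) {S : Finset Ln} (hS : rich g S) : g.totalDegree ≤ 2 := by
  classical
  obtain ⟨c, hc⟩ := exists_pd hg
  obtain ⟨a, b, I⟩ := exists_idx c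
  obtain ⟨s, n, v, h1, h2, h3, hF⟩ := quad_pack hg I hc hS
  have hdpos := deg_pos hg
  have : ∃ l ∈ S, res l s ≠ 0 := by
    by_contra! hne
    have hb := bez g s hg h1 S (fun l hl => (hS.2 l hl).1) hne
    have h4 : g.totalDegree * s.totalDegree ≤ g.totalDegree * (7 * g.totalDegree) := Nat.mul_le_mul_left _ h2
    have := hS.1
    nlinarith
  obtain ⟨l, hl, hls⟩ := this
  obtain ⟨hlg, P, hP, hP2⟩ := hS.2 l hl
  have hbad : (P.filter fun x => eval x s = 0).card ≤ s.totalDegree := by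
    by_contra! hlt
    exact hls (res_zero_of_pts l s _ (fun x hx => (hP2 x (Finset.mem_filter.1 hx).1).1) (fun x hx => (Finset.mem_filter.1 hx).2) hlt)
  have hsum := Finset.card_filter_add_card_filter_not (s := P) (fun x => eval x s = 0)
  set Q := P.filter fun x => ¬ eval x s = 0 with hQ
  have hQc : 2 * g.totalDegree < Q.card := by omega
  have hQ2 : ∀ x ∈ Q, crs g l x ∧ eval x s ≠ 0 := fun x hx => ⟨hP2 x (Finset.mem_filter.1 hx).1, (Finset.mem_filter.1 hx).2⟩
  obtain ⟨x0, hx0⟩ : Q.Nonempty := Finset.card_pos.1 (by omega)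
  have hex : ∀ x : Fin 3 → ℝ, ∃ m : Ln, x ∈ Q → m ≠ l ∧ res m g = 0 ∧ m.on x := by
    intro x
    by_cases hx : x ∈ Q
    · obtain ⟨m, hm⟩ := (hQ2 x hx).1.2
      exact ⟨m, fun _ => hm⟩
    · exact ⟨l, fun h => (hx h).elim⟩
  choose M hM using hex
  have hinj : Set.InjOn M (Q : Set (Fin 3 → ℝ)) := by
    intro x hx y hy hxy
    have hm := hM x hx
    have hm' := hM y hy
    rw [← hxy] at hm'
    exact on_unique hm.1 hm.2.2 hm'.2.2 (hQ2 x hx).1.1 (hQ2 y hy).1.1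
  have hdvd : g ∣ qP s n v a b c x0 := by
    by_contra hnd
    have hb := bez g _ hg hnd (Q.image M) (by
      intro m hm
      obtain ⟨x, hx, rfl⟩ := Finset.mem_image.1 hm
      exact (hM x hx).2.1) (by
      intro m hm
      obtain ⟨x, hx, rfl⟩ := Finset.mem_image.1 hm
      exact line_in2 I h3 hF hlg (hQ2 x0 hx0).1.1 (hQ2 x hx).1.1 (hQ2 x hx).2 (line_in I h3 hF (hM x hx).2.1 (hM x hx).2.2 (hQ2 x hx).2))
    rw [Finset.card_image_of_injOn hinj] at hb
    have := qP_deg s n v a b c x0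
    have : g.totalDegree * (qP s n v a b c x0).totalDegree ≤ g.totalDegree * 2 := Nat.mul_le_mul_left _ this
    omega
  have hne : qP s n v a b c x0 ≠ 0 := by
    intro h0
    obtain ⟨ξ, hξ⟩ := FF_ne I s n v x0 (hQ2 x0 hx0).2
    rw [← qP_eval, h0, map_zero] at hξ
    exact hξ rfl
  exact (totalDegree_le_of_dvd_of_isDomain hdvd hne).trans (qP_deg _ _ _ _ _ _ _)

end GK
end
end

section
open MvPolynomial
noncomputable section
namespace GK

lemma exists_factors (f : Poly) : f ≠ 0 → ∃ G : Finset Poly, (∀ g ∈ G, Irreducible g) ∧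
    (∀ g ∈ G, ∀ h ∈ G, g ≠ h → ¬ g ∣ h) ∧ (∑ g ∈ G, g.totalDegree ≤ f.totalDegree) ∧
    ∀ l : Ln, res l f = 0 → ∃ g ∈ G, res l g = 0 := by
  classical
  refine WfDvdMonoid.induction_on_irreducible f (fun h => (h rfl).elim) ?_ ?_
  · intro u hu _
    refine ⟨∅, by simp, by simp, by simp, ?_⟩
    intro l hl
    exact absurd hl ((hu.map (res l)).ne_zero)
  · intro a i ha hi ih _
    obtain ⟨G, h1, h2, h3, h4⟩ := ih ha
    have hd : (i * a).totalDegree = i.totalDegree + a.totalDegree :=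
      totalDegree_mul_of_isDomain hi.ne_zero ha
    by_cases hx : ∃ g ∈ G, Associated i g
    · obtain ⟨g, hg, hag⟩ := hx
      refine ⟨G, h1, h2, by omega, ?_⟩
      intro l hl
      rw [map_mul, mul_eq_zero] at hl
      rcases hl with hl | hl
      · obtain ⟨c, hc⟩ := hag.dvd
        exact ⟨g, hg, by rw [hc, map_mul, hl, zero_mul]⟩
      · exact h4 l hl
    · push Not at hx
      have hiG : i ∉ G := fun h => hx i h (Associated.refl i)
      refine ⟨insert i G, ?_, ?_, ?_, ?_⟩
      · intro g hg
        rcases Finset.mem_insert.1 hg with rfl | hg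
        · exact hi
        · exact h1 g hg
      · intro g hg h hh hne hdv
        rcases Finset.mem_insert.1 hg with rfl | hg' <;> rcases Finset.mem_insert.1 hh with rfl | hh'
        · exact hne rfl
        · exact hx h hh' (hi.associated_of_dvd (h1 h hh') hdv)
        · exact hx g hg' ((h1 g hg').associated_of_dvd hi hdv).symm
        · exact h2 g hg' h hh' hne hdv
      · rw [Finset.sum_insert hiG]; omega
      · intro l hl
        rw [map_mul, mul_eq_zero] at hl
        rcases hl with hl | hl
        · exact ⟨i, Finset.mem_insert_self _ _, hl⟩
        · obtain ⟨g, hg, h⟩ := h4 l hl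
          exact ⟨g, Finset.mem_insert_of_mem hg, h⟩

theorem lemX (f : Poly) (hf : f ≠ 0) (D K : ℕ) (hD : f.totalDegree ≤ D) (S : Finset Ln)
    (hS : ∀ l ∈ S, res l f = 0) (P : Ln → Finset (Fin 3 → ℝ))
    (hP : ∀ l ∈ S, ∀ x ∈ P l, l.on x ∧ ∃ m ∈ S, m ≠ l ∧ m.on x)
    (hτ : ∀ l ∈ S, 13 * D + K < (P l).card)
    (hK : ∀ g : Poly, Irreducible g → g.totalDegree ≤ 2 → ∀ l ∈ S, res l g = 0 →
      ∀ Q ⊆ P l, (∀ x ∈ Q, ∀ m ∈ S, m.on x → res m g = 0) → Q.card ≤ K) :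
    S.card ≤ 13 * D ^ 2 := by
  classical
  obtain ⟨G, h1, h2, h3, h4⟩ := exists_factors f hf
  have key : ∀ g ∈ G, (S.filter fun l => res l g = 0).card ≤ 13 * D * g.totalDegree := by
    intro g hg
    set R : Poly := ∏ h ∈ G.erase g, h with hR
    have hgD : g.totalDegree ≤ D :=
      (Finset.single_le_sum (f := fun g : Poly => g.totalDegree) (fun _ _ => Nat.zero_le _) hg).trans (h3.trans hD)
    have hRD : R.totalDegree ≤ D := by
      refine (totalDegree_finsetProd _ _).trans (le_trans ?_ (h3.trans hD))
      exact Finset.sum_le_sum_of_subset (Finset.erase_subset _ _)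
    have hgR : ¬ g ∣ R := by
      intro hd
      obtain ⟨h, hh, hdv⟩ := ((h1 g hg).prime).exists_mem_finset_dvd hd
      rw [Finset.mem_erase] at hh
      exact h2 g hg h hh.2 hh.1.symm hdv
    have hA : ((S.filter fun l => res l g = 0).filter fun l => res l R = 0).card ≤ g.totalDegree * D := by
      refine (bez g R (h1 g hg) hgR _ ?_ ?_).trans (Nat.mul_le_mul_left _ hRD)
      · intro l hl; simp at hl; exact hl.1.2
      · intro l hl; simp at hl; exact hl.2
    set Bs := (S.filter fun l => res l g = 0).filter fun l => ¬ res l R = 0 with hBs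
    have hQ : ∀ l ∈ Bs, 12 * D + K < ((P l).filter fun x => eval x R ≠ 0).card ∧
        ∀ x ∈ (P l).filter (fun x => eval x R ≠ 0), ∀ m ∈ S, m.on x → res m g = 0 := by
      intro l hl
      simp only [hBs, Finset.mem_filter] at hl
      obtain ⟨⟨hlS, hlg⟩, hlR⟩ := hl
      constructor
      · have := hτ l hlS
        have hz : ((P l).filter fun x => ¬ eval x R ≠ 0).card ≤ D := by
          by_contra hc
          push Not at hc
          apply hlR
          refine res_zero_of_pts l R _ ?_ ?_ (lt_of_le_of_lt hRD hc)
          · intro x hx; rw [Finset.mem_filter] at hx; exact (hP l hlS x hx.1).1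
          · intro x hx; rw [Finset.mem_filter] at hx; exact hx.2
        have := Finset.card_filter_add_card_filter_not (s := P l) (fun x => eval x R ≠ 0)
        omega
      · intro x hx m hm hmx
        rw [Finset.mem_filter] at hx
        obtain ⟨h, hh, hmh⟩ := h4 m (hS m hm)
        by_cases hhg : h = g
        · rw [← hhg]; exact hmh
        · exfalso
          apply hx.2
          have : h ∣ R := Finset.dvd_prod_of_mem _ (Finset.mem_erase.2 ⟨hhg, hh⟩)
          obtain ⟨c, hc⟩ := this
          rw [hc, map_mul, eval_of_res hmh hmx, zero_mul]
    have hB : Bs.card ≤ 12 * g.totalDegree ^ 2 := by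
      by_contra hc
      push Not at hc
      have hr : rich g Bs := by
        refine ⟨hc, ?_⟩
        intro l hl
        obtain ⟨hc1, hc2⟩ := hQ l hl
        simp only [hBs, Finset.mem_filter] at hl
        refine ⟨hl.1.2, (P l).filter (fun x => eval x R ≠ 0), ?_, ?_⟩
        · refine lt_of_le_of_lt ?_ hc1
          omega
        · intro x hx
          have hx' := (Finset.mem_filter.1 hx).1
          obtain ⟨ho, m, hm, hml, hmx⟩ := hP l hl.1.1 x hx'
          exact ⟨ho, m, hml, hc2 x hx m hm hmx, hmx⟩
      have hdeg := lemY (h1 g hg) hr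
      obtain ⟨l, hl⟩ := Finset.card_pos.1 (lt_of_le_of_lt (Nat.zero_le _) hc)
      obtain ⟨hc1, hc2⟩ := hQ l hl
      simp only [hBs, Finset.mem_filter] at hl
      have := hK g (h1 g hg) hdeg l hl.1.1 hl.1.2 _ (Finset.filter_subset _ _) hc2
      omega
    have := Finset.card_filter_add_card_filter_not (s := S.filter fun l => res l g = 0) (fun l => res l R = 0)
    rw [← hBs] at this
    nlinarith [Nat.mul_le_mul_left g.totalDegree hgD]
  have hcov : S ⊆ G.biUnion fun g => S.filter fun l => res l g = 0 := by
    intro l hl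
    obtain ⟨g, hg, h⟩ := h4 l (hS l hl)
    exact Finset.mem_biUnion.2 ⟨g, hg, Finset.mem_filter.2 ⟨hl, h⟩⟩
  calc S.card ≤ _ := Finset.card_le_card hcov
    _ ≤ ∑ g ∈ G, (S.filter fun l => res l g = 0).card := Finset.card_biUnion_le
    _ ≤ ∑ g ∈ G, 13 * D * g.totalDegree := Finset.sum_le_sum key
    _ = 13 * D * ∑ g ∈ G, g.totalDegree := by rw [Finset.mul_sum]
    _ ≤ 13 * D * D := Nat.mul_le_mul_left _ (h3.trans hD)
    _ = 13 * D ^ 2 := by ring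

/-- Few crossings inside a surface of degree at most two. -/
def Hyp (S : Finset Ln) (B : ℕ) : Prop :=
  ∀ l ∈ S, ∀ g : Poly, Irreducible g → g.totalDegree ≤ 2 → res l g = 0 →
    ∀ M ⊆ S, (∀ m ∈ M, m ≠ l ∧ res m g = 0 ∧ ∃ x, l.on x ∧ m.on x) → M.card ≤ B

lemma Hyp.mono {S T : Finset Ln} {B : ℕ} (h : Hyp S B) (hT : T ⊆ S) : Hyp T B :=
  fun l hl g hg hd hr M hM hm => h l (hT hl) g hg hd hr M (hM.trans hT) hm

/-- If the points of `Q` on `l` each lie on at least `r` other lines, then these are distinct. -/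
lemma fan_card (l : Ln) (Q : Finset (Fin 3 → ℝ)) (hQ : ∀ x ∈ Q, l.on x) (r : ℕ)
    (F : (Fin 3 → ℝ) → Finset Ln) (hF : ∀ x ∈ Q, r ≤ (F x).card ∧ ∀ m ∈ F x, m ≠ l ∧ m.on x)
    [DecidableEq Ln] :
    Q.card * r ≤ (Q.biUnion F).card := by
  rw [Finset.card_biUnion]
  · rw [← smul_eq_mul, ← Finset.sum_const]
    exact Finset.sum_le_sum fun x hx => (hF x hx).1
  · intro x hx y hy hxy
    rw [Function.onFun, Finset.disjoint_left]
    intro m hm hm'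
    exact hxy (on_unique ((hF x hx).2 m hm).1 ((hF x hx).2 m hm).2 ((hF y hy).2 m hm').2 (hQ x hx) (hQ y hy))

lemma Hyp.pts {S : Finset Ln} {B : ℕ} (h : Hyp S B) (l : Ln) (hl : l ∈ S) (g : Poly) (hg : Irreducible g)
    (hd : g.totalDegree ≤ 2) (hr : res l g = 0) (Q : Finset (Fin 3 → ℝ)) (hQ : ∀ x ∈ Q, l.on x) (r : ℕ)
    (F : (Fin 3 → ℝ) → Finset Ln)
    (hF : ∀ x ∈ Q, r ≤ (F x).card ∧ ∀ m ∈ F x, m ≠ l ∧ m.on x) (hF' : ∀ x ∈ Q, ∀ m ∈ F x, m ∈ S ∧ res m g = 0) :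
    Q.card * r ≤ B := by
  classical
  refine (fan_card l Q hQ r F hF).trans (h l hl g hg hd hr _ ?_ ?_)
  · intro m hm
    obtain ⟨x, hx, hm⟩ := Finset.mem_biUnion.1 hm
    exact (hF' x hx m hm).1
  · intro m hm
    obtain ⟨x, hx, hm⟩ := Finset.mem_biUnion.1 hm
    exact ⟨((hF x hx).2 m hm).1, (hF' x hx m hm).2, x, hQ x hx, ((hF x hx).2 m hm).2⟩

end GK
end
end

section
open MvPolynomial
noncomputable section
namespace GK

lemma dred (S : Finset Ln) (D h w : ℕ) (P : Ln → Finset (Fin 3 → ℝ))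
    (hP : ∀ l ∈ S, ∀ x ∈ P l, l.on x ∧ ∃ m ∈ S, m ≠ l ∧ m.on x)
    (hc : ∀ l ∈ S, h + D ≤ (P l).card) :
    ∃ M ⊆ S, ∃ U ⊆ S, w * M.card ≤ S.card * (D + 1) ∧ U.card * h ≤ w * S.card ∧
      ∀ l ∈ S, l ∉ U → ∃ Q ⊆ P l, D < Q.card ∧ ∀ x ∈ Q, ∃ m ∈ M, m.on x := by
  classical
  set hit : Finset Ln → Ln → Finset (Fin 3 → ℝ) := fun M l => (P l).filter fun x => ∃ m ∈ M, m.on x with hhit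
  set Φ : Finset Ln → ℕ := fun M => ∑ l ∈ S, (D + 1 - (hit M l).card) with hΦ
  obtain ⟨M, hM, hmin⟩ := Finset.exists_min_image S.powerset (fun M => Φ M + w * M.card) ⟨∅, by simp⟩
  rw [Finset.mem_powerset] at hM
  set U := S.filter fun l => (hit M l).card ≤ D with hU
  refine ⟨M, hM, U, Finset.filter_subset _ _, ?_, ?_, ?_⟩
  · have h1 := hmin ∅ (by simp)
    have h2 : Φ ∅ ≤ S.card * (D + 1) := by
      rw [← smul_eq_mul, ← Finset.sum_const]
      exact Finset.sum_le_sum fun l _ => Nat.sub_le _ _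
    simp only [Finset.card_empty] at h1
    omega
  · set good : Ln → Ln → Prop := fun m l => ∃ x ∈ P l, x ∉ hit M l ∧ m.on x with hgood
    have h1 : ∀ m ∈ S, (U.filter fun l => good m l).card ≤ w := by
      intro m hm
      have h2 := hmin (insert m M) (Finset.mem_powerset.2 (Finset.insert_subset hm hM))
      have h3 := Finset.card_insert_le m M
      have h3' := Nat.mul_le_mul_left w h3
      have h4 : Φ (insert m M) + (U.filter fun l => good m l).card ≤ Φ M := by
        rw [hU, Finset.filter_filter, Finset.card_filter, hΦ, ← Finset.sum_add_distrib]
        refine Finset.sum_le_sum fun l hl => ?_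
        have hsub : hit M l ⊆ hit (insert m M) l := by
          intro x hx
          simp only [hhit, Finset.mem_filter] at hx ⊢
          obtain ⟨hx, n, hn, hnx⟩ := hx
          exact ⟨hx, n, Finset.mem_insert_of_mem hn, hnx⟩
        have hle := Finset.card_le_card hsub
        split_ifs with hif
        · obtain ⟨hD, x, hx, hxn, hmx⟩ := hif
          have : (hit M l).card < (hit (insert m M) l).card := by
            refine Finset.card_lt_card ⟨hsub, fun hs => hxn (hs ?_)⟩
            simp only [hhit, Finset.mem_filter]
            exact ⟨hx, m, Finset.mem_insert_self _ _, hmx⟩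
          omega
        · omega
      rw [mul_add, mul_one] at h3'
      omega
    have h2 : ∀ l ∈ U, h ≤ (S.filter fun m => good m l).card := by
      intro l hl
      rw [hU, Finset.mem_filter] at hl
      have h3 : h ≤ (P l \ hit M l).card := by
        have := Finset.card_sdiff_add_card_eq_card (s := hit M l) (t := P l) (Finset.filter_subset _ _)
        have := hc l hl.1
        omega
      have h4 := fan_card l (P l \ hit M l) (fun x hx => (hP l hl.1 x (Finset.mem_sdiff.1 hx).1).1) 1
        (fun x => S.filter fun m => m ≠ l ∧ m.on x) (by
          intro x hx
          obtain ⟨m, hm, hml, hmx⟩ := (hP l hl.1 x (Finset.mem_sdiff.1 hx).1).2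
          refine ⟨Finset.card_pos.2 ⟨m, Finset.mem_filter.2 ⟨hm, hml, hmx⟩⟩, ?_⟩
          intro m hm
          exact (Finset.mem_filter.1 hm).2)
      refine le_trans (by omega) (h4.trans (Finset.card_le_card ?_))
      intro m hm
      obtain ⟨x, hx, hm⟩ := Finset.mem_biUnion.1 hm
      rw [Finset.mem_filter] at hm
      rw [Finset.mem_sdiff] at hx
      exact Finset.mem_filter.2 ⟨hm.1, x, hx.1, hx.2, hm.2.2⟩
    calc U.card * h ≤ ∑ l ∈ U, (S.filter fun m => good m l).card := by
          rw [← smul_eq_mul, ← Finset.sum_const]; exact Finset.sum_le_sum h2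
      _ = ∑ m ∈ S, (U.filter fun l => good m l).card :=
          (Finset.sum_card_bipartiteAbove_eq_sum_card_bipartiteBelow (fun l m => good m l))
      _ ≤ ∑ m ∈ S, w := Finset.sum_le_sum h1
      _ = w * S.card := by rw [Finset.sum_const, smul_eq_mul, mul_comm]
  · intro l hl hlU
    refine ⟨hit M l, Finset.filter_subset _ _, ?_, ?_⟩
    · by_contra hcon
      exact hlU (Finset.mem_filter.2 ⟨hl, not_lt.1 hcon⟩)
    · intro x hx
      exact (Finset.mem_filter.1 hx).2

lemma t2_num (L B D M U : ℕ) (hB : 0 < B) (hL : L ≤ B ^ 2) (h1 : L < (4 * (D + 1)) ^ 2)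
    (h2 : 48 * B * M ≤ L * (D + 1)) (h3 : U * (9216 * B) ≤ 48 * B * L) :
    6 * ((M + U) * (D + 1)) < (D + 1) * (D + 2) * (D + 3) := by
  have hL2 : L ≤ B * (4 * (D + 1)) := by
    by_contra hc
    push Not at hc
    have h4 : (B * (4 * (D + 1))) * (B * (4 * (D + 1))) < L * L := Nat.mul_self_lt_mul_self hc
    have h5 : L * L ≤ B ^ 2 * (4 * (D + 1)) ^ 2 := Nat.mul_le_mul hL h1.le
    nlinarith
  have hM : 12 * M ≤ (D + 1) ^ 2 := by
    have : (4 * B) * (12 * M) ≤ (4 * B) * (D + 1) ^ 2 := by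
      nlinarith [Nat.mul_le_mul_right (D + 1) hL2]
    exact Nat.le_of_mul_le_mul_left this (by omega)
  have hU : 12 * U ≤ (D + 1) ^ 2 := by
    have : (48 * B) * (192 * U) ≤ (48 * B) * (16 * (D + 1) ^ 2) := by
      nlinarith [Nat.mul_le_mul_left (48 * B) h1.le]
    have := Nat.le_of_mul_le_mul_left this (by omega)
    omega
  have : 6 * (M + U) ≤ (D + 1) ^ 2 := by omega
  nlinarith [Nat.mul_le_mul_right (D + 1) this]

theorem T2 (B : ℕ) (hB : 0 < B) (n : ℕ) : ∀ (S : Finset Ln), S.card = n → S.card ≤ B ^ 2 → Hyp S B →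
    ∀ (P : Finset (Fin 3 → ℝ)), (∀ x ∈ P, ∃ l ∈ S, ∃ m ∈ S, l ≠ m ∧ l.on x ∧ m.on x) →
    P.card ≤ 10000 * B * n := by
  classical
  induction n with
  | zero =>
    intro S hS _ _ P hP
    rw [Finset.card_eq_zero] at hS
    subst hS
    have : P = ∅ := Finset.eq_empty_of_forall_notMem fun x hx => by
      obtain ⟨l, hl, _⟩ := hP x hx
      simp at hl
    simp [this]
  | succ n ih =>
    intro S hS hSB hH P hP
    by_cases hl : ∃ l ∈ S, (P.filter fun x => l.on x).card ≤ 10000 * B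
    · obtain ⟨l, hl, hlc⟩ := hl
      have h1 := ih (S.erase l) (by rw [Finset.card_erase_of_mem hl, hS]; rfl)
        ((Finset.card_le_card (Finset.erase_subset _ _)).trans hSB) (hH.mono (Finset.erase_subset _ _))
        (P.filter fun x => ¬ l.on x) (by
          intro x hx
          rw [Finset.mem_filter] at hx
          obtain ⟨a, ha, b, hb, hab, hax, hbx⟩ := hP x hx.1
          refine ⟨a, Finset.mem_erase.2 ⟨?_, ha⟩, b, Finset.mem_erase.2 ⟨?_, hb⟩, hab, hax, hbx⟩
          · rintro rfl; exact hx.2 hax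
          · rintro rfl; exact hx.2 hbx)
      have := Finset.card_filter_add_card_filter_not (s := P) (fun x => l.on x)
      rw [mul_add, mul_one]
      omega
    · exfalso
      push Not at hl
      set L := S.card with hLdef
      set D := Nat.sqrt L / 4 with hDdef
      have hs1 : Nat.sqrt L * Nat.sqrt L ≤ L := Nat.sqrt_le L
      have hs2 : L < (Nat.sqrt L + 1) * (Nat.sqrt L + 1) := Nat.lt_succ_sqrt L
      have hD1 : 4 * D ≤ Nat.sqrt L := by omega
      have hD2 : Nat.sqrt L + 1 ≤ 4 * (D + 1) := by omega
      have hDB : Nat.sqrt L ≤ B := by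
        by_contra hcc
        push Not at hcc
        have := Nat.mul_self_lt_mul_self hcc
        nlinarith
      set Pl : Ln → Finset (Fin 3 → ℝ) := fun l => P.filter fun x => l.on x with hPl
      have hPP : ∀ l ∈ S, ∀ x ∈ Pl l, l.on x ∧ ∃ m ∈ S, m ≠ l ∧ m.on x := by
        intro l _ x hx
        simp only [hPl, Finset.mem_filter] at hx
        obtain ⟨a, ha, b, hb, hab, hax, hbx⟩ := hP x hx.1
        refine ⟨hx.2, ?_⟩
        by_cases hal : a = l
        · exact ⟨b, hb, fun h => hab (hal.trans h.symm), hbx⟩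
        · exact ⟨a, ha, hal, hax⟩
      obtain ⟨M, hM, U, hU, hMc, hUc, hQ⟩ := dred S D (9216 * B) (48 * B) Pl hPP (by
        intro l hl'
        have := hl l hl'
        simp only [hPl]
        omega)
      have hL1 : L < (4 * (D + 1)) ^ 2 := by
        rw [pow_two]
        exact lt_of_lt_of_le hs2 (Nat.mul_le_mul hD2 hD2)
      obtain ⟨f, hf, hfd, hfv⟩ := exists_vanish (M ∪ U) D (by
        refine lt_of_le_of_lt ?_ (t2_num L B D M.card U.card hB hSB hL1 hMc hUc)
        exact Nat.mul_le_mul_left _ (Nat.mul_le_mul_right _ (Finset.card_union_le _ _)))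
      have hall : ∀ l ∈ S, res l f = 0 := by
        intro l hl'
        by_cases hlU : l ∈ U
        · exact hfv l (Finset.mem_union_right _ hlU)
        · obtain ⟨Q, hQP, hQc, hQm⟩ := hQ l hl' hlU
          refine res_zero_of_pts l f Q (fun x hx => (hPP l hl' x (hQP hx)).1) ?_ (lt_of_le_of_lt hfd hQc)
          intro x hx
          obtain ⟨m, hm, hmx⟩ := hQm x hx
          exact eval_of_res (hfv m (Finset.mem_union_left _ hm)) hmx
      have hfin := lemX f hf D B hfd S hall Pl hPP (by
        intro l hl'
        have := hl l hl'
        simp only [hPl]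
        omega) (by
        intro g hg hd l hl' hr Q hQP hQm
        have := hH.pts l hl' g hg hd hr Q (fun x hx => (hPP l hl' x (hQP hx)).1) 1
          (fun x => S.filter fun m => m ≠ l ∧ m.on x) (by
            intro x hx
            obtain ⟨m, hm, hml, hmx⟩ := (hPP l hl' x (hQP hx)).2
            refine ⟨Finset.card_pos.2 ⟨m, Finset.mem_filter.2 ⟨hm, hml, hmx⟩⟩, ?_⟩
            intro m hm
            exact (Finset.mem_filter.1 hm).2) (by
            intro x hx m hm
            rw [Finset.mem_filter] at hm
            exact ⟨hm.1, hQm x hx m hm.1 hm.2.2⟩)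
        omega)
      have h16 : 16 * D ^ 2 ≤ L := by
        have := Nat.mul_le_mul hD1 hD1
        nlinarith
      change L ≤ 13 * D ^ 2 at hfin
      omega

end GK
end
end

section
open MvPolynomial
noncomputable section
namespace GK

lemma many_lines [DecidableEq Ln] (k t : ℕ) (F : (Fin 3 → ℝ) → Finset Ln) (T : Finset (Fin 3 → ℝ))
    (hF : ∀ x ∈ T, k ≤ (F x).card ∧ ∀ m ∈ F x, m.on x) : T.card ≤ t →
    T.card * (k - t) ≤ (T.biUnion F).card := by
  classical
  induction T using Finset.induction_on with
  | empty => simp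
  | insert x T hx ih =>
    intro hc
    rw [Finset.card_insert_of_notMem hx] at hc ⊢
    have h1 := ih (fun y hy => hF y (Finset.mem_insert_of_mem hy)) (by omega)
    have hFx := hF x (Finset.mem_insert_self _ _)
    have h2 : (F x ∩ T.biUnion F).card ≤ T.card := by
      rw [Finset.inter_biUnion]
      refine (Finset.card_biUnion_le).trans ?_
      rw [← mul_one T.card, ← smul_eq_mul, ← Finset.sum_const]
      refine Finset.sum_le_sum fun y hy => ?_
      rw [Finset.card_le_one]
      intro a ha b hb
      rw [Finset.mem_inter] at ha hb
      by_contra hab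
      have hFy := hF y (Finset.mem_insert_of_mem hy)
      have := on_unique hab (hFx.2 a ha.1) (hFy.2 a ha.2) (hFx.2 b hb.1) (hFy.2 b hb.2)
      exact hx (this ▸ hy)
    rw [Finset.biUnion_insert]
    have h3 := Finset.card_union_add_card_inter (F x) (T.biUnion F)
    have h4 : (T.card + 1) * (k - t) = T.card * (k - t) + (k - t) := by ring
    have h5 := Finset.card_le_card (Finset.subset_union_right (s₁ := F x) (s₂ := T.biUnion F))
    rw [h4]
    generalize T.card * (k - t) = z at *
    omega

lemma off_bound (S : Finset Ln) (P : Finset (Fin 3 → ℝ)) (k m : ℕ) (f : Poly)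
    (cl : (Fin 3 → ℝ) → (Fin (3 * m) → Bool)) (hk : ∀ x ∈ P, ∃ J ⊆ S, J.card = k ∧ ∀ l ∈ J, l.on x)
    (hq : 2 * P.card ≤ k * 8 ^ m)
    (h1 : ∀ σ, (P.filter fun x => eval x f ≠ 0 ∧ cl x = σ).card * 8 ^ m ≤ P.card)
    (h2 : ∀ (l : Ln) (T : Finset (Fin 3 → ℝ)), (∀ x ∈ T, l.on x) → (∀ x ∈ T, eval x f ≠ 0) →
      (T.image cl).card ≤ 12 * 2 ^ m + 1) :
    (P.filter fun x => eval x f ≠ 0).card * k ≤ 2 * (S.card * (12 * 2 ^ m + 1)) := by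
  classical
  set F : (Fin 3 → ℝ) → Finset Ln := fun x => S.filter fun l => l.on x with hF
  set cell : (Fin (3 * m) → Bool) → Finset (Fin 3 → ℝ) := fun σ => P.filter fun x => eval x f ≠ 0 ∧ cl x = σ with hcell
  obtain ⟨r, hr⟩ : ∃ r : (Fin (3 * m) → Bool) → Ln → Prop, ∀ σ l, r σ l ↔ ∃ x ∈ cell σ, l.on x :=
    ⟨_, fun _ _ => Iff.rfl⟩
  have hc : ∀ σ, (cell σ).card * (k - k / 2) ≤ (S.filter fun l => r σ l).card := by
    intro σ
    refine (many_lines k (k / 2) F (cell σ) ?_ ?_).trans (Finset.card_le_card ?_)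
    · intro x hx
      obtain ⟨J, hJ, hJk, hJx⟩ := hk x (Finset.mem_filter.1 hx).1
      refine ⟨?_, fun m hm => (Finset.mem_filter.1 hm).2⟩
      rw [← hJk]
      exact Finset.card_le_card fun l hl => Finset.mem_filter.2 ⟨hJ hl, hJx l hl⟩
    · have h3 := h1 σ
      have h4 : (2 * (cell σ).card) * 8 ^ m ≤ k * 8 ^ m := by
        simp only [hcell]; nlinarith
      have := Nat.le_of_mul_le_mul_right h4 (by positivity)
      omega
    · intro l hl
      obtain ⟨x, hx, hl⟩ := Finset.mem_biUnion.1 hl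
      rw [hF, Finset.mem_filter] at hl
      exact Finset.mem_filter.2 ⟨hl.1, (hr _ _).2 ⟨x, hx, hl.2⟩⟩
  have hsum : (P.filter fun x => eval x f ≠ 0).card = ∑ σ, (cell σ).card := by
    rw [Finset.card_eq_sum_card_fiberwise (f := cl) (t := Finset.univ) (by simp [Set.MapsTo])]
    refine Finset.sum_congr rfl fun σ _ => ?_
    rw [hcell, Finset.filter_filter]
  have hfin : (∑ σ, (cell σ).card) * (k - k / 2) ≤ S.card * (12 * 2 ^ m + 1) := by
    calc (∑ σ, (cell σ).card) * (k - k / 2) = ∑ σ, (cell σ).card * (k - k / 2) := Finset.sum_mul _ _ _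
      _ ≤ ∑ σ, (S.filter fun l => r σ l).card := Finset.sum_le_sum fun σ _ => hc σ
      _ = ∑ l ∈ S, (Finset.univ.filter fun σ => r σ l).card :=
          Finset.sum_card_bipartiteAbove_eq_sum_card_bipartiteBelow r
      _ ≤ ∑ l ∈ S, (12 * 2 ^ m + 1) := by
          refine Finset.sum_le_sum fun l _ => ?_
          refine le_trans (Finset.card_le_card ?_) (h2 l (P.filter fun x => eval x f ≠ 0 ∧ l.on x)
            (fun x hx => (Finset.mem_filter.1 hx).2.2) (fun x hx => (Finset.mem_filter.1 hx).2.1))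
          intro σ hσ
          obtain ⟨x, hx, hlx⟩ := (hr _ _).1 (Finset.mem_filter.1 hσ).2
          obtain ⟨hxP, hxf, hxσ⟩ := Finset.mem_filter.1 hx
          exact Finset.mem_image.2 ⟨x, Finset.mem_filter.2 ⟨hxP, hxf, hlx⟩, hxσ⟩
      _ = _ := by rw [Finset.sum_const, smul_eq_mul]
  rw [hsum]
  have : k ≤ 2 * (k - k / 2) := by omega
  calc (∑ σ, (cell σ).card) * k ≤ (∑ σ, (cell σ).card) * (2 * (k - k / 2)) := Nat.mul_le_mul_left _ this
    _ = 2 * ((∑ σ, (cell σ).card) * (k - k / 2)) := by ring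
    _ ≤ _ := Nat.mul_le_mul_left _ hfin

lemma prune (S : Finset Ln) (P : Finset (Fin 3 → ℝ)) (J : (Fin 3 → ℝ) → Finset Ln) (k τ : ℕ)
    [DecidableEq Ln] (hJ : ∀ x ∈ P, J x ⊆ S ∧ (J x).card = k) :
    ∃ S' ⊆ S, ∃ P' ⊆ P, (∀ l ∈ S', τ ≤ (P'.filter fun x => l ∈ J x).card) ∧
      (∀ x ∈ P', k ≤ 2 * (S'.filter fun l => l ∈ J x).card) ∧
      P.card * k ≤ P'.card * k + 2 * (τ * S.card) := by
  classical
  set I : Finset Ln → Finset (Fin 3 → ℝ) → ℕ := fun S' P' => ∑ x ∈ P', (S'.filter fun l => l ∈ J x).card with hI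
  have hI' : ∀ S' P', I S' P' = ∑ l ∈ S', (P'.filter fun x => l ∈ J x).card := by
    intro S' P'
    exact Finset.sum_card_bipartiteAbove_eq_sum_card_bipartiteBelow (fun x l => l ∈ J x)
  obtain ⟨⟨S', P'⟩, hm, hmax⟩ := Finset.exists_max_image (S.powerset ×ˢ P.powerset)
    (fun q => (2 * (I q.1 q.2 : ℤ) - 2 * τ * q.1.card - k * q.2.card)) ⟨(∅, ∅), by simp⟩
  rw [Finset.mem_product, Finset.mem_powerset, Finset.mem_powerset] at hm
  obtain ⟨hS', hP'⟩ := hm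
  simp only at hS' hP' hmax
  refine ⟨S', hS', P', hP', ?_, ?_, ?_⟩
  · intro l hl
    have h1 := hmax (S'.erase l, P') (by
      rw [Finset.mem_product, Finset.mem_powerset, Finset.mem_powerset]
      exact ⟨(Finset.erase_subset _ _).trans hS', hP'⟩)
    have h2 : I S' P' = (P'.filter fun x => l ∈ J x).card + I (S'.erase l) P' := by
      rw [hI', hI', Finset.add_sum_erase _ (fun l => (P'.filter fun x => l ∈ J x).card) hl]
    have h3 := Finset.card_erase_add_one hl
    simp only at h1
    rw [h2, ← h3] at h1
    push_cast at h1
    have : (τ : ℤ) ≤ (P'.filter fun x => l ∈ J x).card := by nlinarith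
    exact_mod_cast this
  · intro x hx
    have h1 := hmax (S', P'.erase x) (by
      rw [Finset.mem_product, Finset.mem_powerset, Finset.mem_powerset]
      exact ⟨hS', (Finset.erase_subset _ _).trans hP'⟩)
    have h2 : I S' P' = (S'.filter fun l => l ∈ J x).card + I S' (P'.erase x) := by
      simp only [hI]; rw [Finset.add_sum_erase _ (fun x => (S'.filter fun l => l ∈ J x).card) hx]
    have h3 := Finset.card_erase_add_one hx
    simp only at h1
    rw [h2, ← h3] at h1
    push_cast at h1
    have : (k : ℤ) ≤ 2 * ((S'.filter fun l => l ∈ J x).card : ℤ) := by nlinarith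
    exact_mod_cast this
  · have h1 := hmax (S, P) (by simp)
    simp only at h1
    have h2 : I S P = P.card * k := by
      rw [hI, ← smul_eq_mul, ← Finset.sum_const]
      refine Finset.sum_congr rfl fun x hx => ?_
      rw [← (hJ x hx).2, Finset.filter_mem_eq_inter, Finset.inter_eq_right.2 (hJ x hx).1]
    have h3 : I S' P' ≤ P'.card * k := by
      rw [hI, ← smul_eq_mul, ← Finset.sum_const]
      refine Finset.sum_le_sum fun x hx => ?_
      rw [← (hJ x (hP' hx)).2]
      exact Finset.card_le_card fun l hl => (Finset.mem_filter.1 hl).2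
    rw [h2] at h1
    push_cast at h1
    have h3' : (I S' P' : ℤ) ≤ P'.card * k := by exact_mod_cast h3
    have h4 : (0 : ℤ) ≤ 2 * τ * S'.card := by positivity
    have : (P.card : ℤ) * k ≤ P'.card * k + 2 * (τ * S.card) := by nlinarith
    exact_mod_cast this

end GK
end
end

section
open MvPolynomial
noncomputable section
namespace GK

lemma tk_num (B k E off p0 ps : ℕ) (hB : 0 < B) (h1 : 2 ^ 28 * B ≤ 2 * (k * E))
    (h2 : off + p0 = 2 * k * E ^ 3) (h3 : off * k ≤ 2 * (B ^ 2 * (24 * E + 1)))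
    (h4 : p0 * k ≤ ps * k + 2 * (314 * E * B ^ 2)) (h5 : ps ≤ 10000 * B * (13 * (24 * E) ^ 2)) : False := by
  have hE : 0 < E := by
    rcases Nat.eq_zero_or_pos E with h | h
    · subst h; omega
    · exact h
  have hy : 2 ^ 27 * B ≤ k * E := by omega
  have e1 : 2 * E * (k * E) ^ 2 ≤ 678 * (B ^ 2 * E) + 74880000 * (B * E * (k * E)) := by
    have a1 : (off + p0) * k = 2 * E * (k * E) ^ 2 := by rw [h2]; ring
    have a2 : ps * k ≤ 74880000 * (B * E * (k * E)) := by
      refine (Nat.mul_le_mul_right k h5).trans (le_of_eq ?_); ring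
    have a3 : 2 * (B ^ 2 * (24 * E + 1)) ≤ 50 * (B ^ 2 * E) := by
      have : B ^ 2 * (24 * E + 1) ≤ B ^ 2 * (25 * E) := Nat.mul_le_mul_left _ (by omega)
      nlinarith
    nlinarith
  generalize k * E = y at *
  have e2 : 2 * y ^ 2 ≤ 678 * B ^ 2 + 74880000 * (B * y) := by
    have : E * (2 * y ^ 2) ≤ E * (678 * B ^ 2 + 74880000 * (B * y)) := by linarith
    exact Nat.le_of_mul_le_mul_left this hE
  have e3 : 2 ^ 27 * B * y ≤ y * y := Nat.mul_le_mul_right y hy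
  have e4 : 2 ^ 27 * B * B ≤ y * B := Nat.mul_le_mul_right B hy
  have e5 : 0 < B * B := Nat.mul_pos hB hB
  norm_num at e3 e4
  nlinarith

theorem Tk (B : ℕ) (hB : 0 < B) (k : ℕ) (hk : 4 ≤ k) (hkB : k ≤ B) (S : Finset Ln) (hSB : S.card ≤ B ^ 2)
    (hH : Hyp S B) (P : Finset (Fin 3 → ℝ)) (hP : ∀ x ∈ P, ∃ J ⊆ S, J.card = k ∧ ∀ l ∈ J, l.on x) :
    P.card * k ^ 2 ≤ 2 ^ 85 * B ^ 3 := by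
  classical
  have hex : ∃ m : ℕ, 2 ^ 28 * B ≤ k * 2 ^ m := by
    refine ⟨28 + B, ?_⟩
    rw [pow_add]
    have : B < 2 ^ B := Nat.lt_two_pow_self
    have h1 : 2 ^ 28 * B ≤ 1 * (2 ^ 28 * 2 ^ B) := by
      rw [one_mul]; exact Nat.mul_le_mul_left _ this.le
    exact h1.trans (Nat.mul_le_mul_right _ (by omega))
  obtain ⟨m, hm1, hm2⟩ : ∃ m : ℕ, 2 ^ 28 * B ≤ 2 * (k * 2 ^ m) ∧ k * 2 ^ m < 2 ^ 28 * B := by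
    have h1 := Nat.find_spec hex
    have h2 : Nat.find hex ≠ 0 := by
      intro h0
      rw [h0] at h1
      norm_num at h1
      omega
    obtain ⟨m, hm⟩ := Nat.exists_eq_succ_of_ne_zero h2
    refine ⟨m, ?_, ?_⟩
    · rw [hm, Nat.succ_eq_add_one, pow_succ] at h1
      calc _ ≤ _ := h1
        _ = _ := by ring
    · have := Nat.find_min hex (m := m) (by omega)
      omega
  set E := 2 ^ m with hE
  have hE0 : 0 < E := by positivity
  by_cases hle : P.card ≤ 2 * k * E ^ 3
  · calc P.card * k ^ 2 ≤ 2 * k * E ^ 3 * k ^ 2 := Nat.mul_le_mul_right _ hle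
      _ = 2 * (k * E) ^ 3 := by ring
      _ ≤ 2 * (2 ^ 28 * B) ^ 3 := Nat.mul_le_mul_left _ (Nat.pow_le_pow_left hm2.le 3)
      _ = 2 ^ 85 * B ^ 3 := by ring
  exfalso
  push Not at hle
  obtain ⟨P', hP'P, hP'c⟩ := Finset.exists_subset_card_eq hle.le
  obtain ⟨f, cl, hf, hfd, hcl1, hcl2⟩ := partition_thm P' (m + 1)
  have hE2 : 2 ^ (m + 1) = 2 * E := by rw [pow_succ, mul_comm]
  have hE8 : 8 ^ (m + 1) = 8 * E ^ 3 := by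
    rw [hE, ← pow_mul, mul_comm m 3, pow_mul, pow_succ, mul_comm]; norm_num
  have hoff := off_bound S P' k (m + 1) f cl (fun x hx => hP x (hP'P hx)) (by
    rw [hP'c, hE8]; nlinarith [Nat.zero_le (k * E ^ 3)]) hcl1 hcl2
  rw [hE2] at hoff hfd
  have hP2 : ∀ x : (Fin 3 → ℝ), ∃ J : Finset Ln, x ∈ P → J ⊆ S ∧ J.card = k ∧ ∀ l ∈ J, l.on x := by
    intro x
    by_cases hx : x ∈ P
    · obtain ⟨J, h⟩ := hP x hx
      exact ⟨J, fun _ => h⟩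
    · exact ⟨∅, fun h => absurd h hx⟩
  choose J hJ using hP2
  set P0 := P'.filter fun x => ¬ eval x f ≠ 0 with hP0
  have hP0P : P0 ⊆ P := (Finset.filter_subset _ _).trans hP'P
  obtain ⟨Ss, hSs, Ps, hPs, hl, hx, hcnt⟩ := prune S P0 J k (314 * E) (fun x hx => ⟨(hJ x (hP0P hx)).1, (hJ x (hP0P hx)).2.1⟩)
  set Pl : Ln → Finset (Fin 3 → ℝ) := fun l => Ps.filter fun x => l ∈ J x with hPl
  have hPlon : ∀ l, ∀ x ∈ Pl l, l.on x := by
    intro l x hx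
    rw [hPl, Finset.mem_filter] at hx
    exact (hJ x (hP0P (hPs hx.1))).2.2 l hx.2
  have hother : ∀ l, ∀ x ∈ Pl l, k ≤ 4 * (Ss.filter fun m => m ∈ J x ∧ m ≠ l).card := by
    intro l x hxl
    rw [hPl, Finset.mem_filter] at hxl
    have h1 := hx x hxl.1
    have h2 : (Ss.filter fun m => m ∈ J x).card ≤ (Ss.filter fun m => m ∈ J x ∧ m ≠ l).card + 1 := by
      have e : (Ss.filter fun m => m ∈ J x ∧ m ≠ l) = (Ss.filter fun m => m ∈ J x).erase l := by
        ext m; simp only [Finset.mem_filter, Finset.mem_erase]; tauto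
      have := Finset.pred_card_le_card_erase (s := Ss.filter fun m => m ∈ J x) (a := l)
      rw [e]
      omega
    omega
  have hres : ∀ l ∈ Ss, res l f = 0 := by
    intro l hl'
    refine res_zero_of_pts l f (Pl l) (hPlon l) ?_ (lt_of_lt_of_le ?_ (hl l hl'))
    · intro x hx
      have := hPs (Finset.mem_filter.1 hx).1
      exact not_not.1 (Finset.mem_filter.1 this).2
    · omega
  have hX := lemX f hf (24 * E) E (by omega) Ss hres Pl (by
      intro l hl' x hx'
      refine ⟨hPlon l x hx', ?_⟩
      have h1 := hother l x hx'
      obtain ⟨m, hm⟩ := Finset.card_pos.1 (show 0 < (Ss.filter fun m => m ∈ J x ∧ m ≠ l).card by omega)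
      rw [Finset.mem_filter] at hm
      exact ⟨m, hm.1, hm.2.2, (hJ x (hP0P (hPs (Finset.mem_filter.1 hx').1))).2.2 m hm.2.1⟩)
    (fun l hl' => lt_of_lt_of_le (by omega) (hl l hl')) (by
      intro g hg hd l hl' hr Q hQ hQm
      have h1 := (hH.mono hSs).pts l hl' g hg hd hr Q (fun x hx => hPlon l x (hQ hx)) ((k + 3) / 4)
        (fun x => Ss.filter fun m => m ∈ J x ∧ m ≠ l) (by
          intro x hx'
          have h1 := hother l x (hQ hx')
          refine ⟨by omega, ?_⟩
          intro m hm
          rw [Finset.mem_filter] at hm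
          exact ⟨hm.2.2, (hJ x (hP0P (hPs (Finset.mem_filter.1 (hQ hx')).1))).2.2 m hm.2.1⟩) (by
          intro x hx' m hm
          rw [Finset.mem_filter] at hm
          exact ⟨hm.1, hQm x hx' m hm.1 ((hJ x (hP0P (hPs (Finset.mem_filter.1 (hQ hx')).1))).2.2 m hm.2.1)⟩)
      have h2 : Q.card * k ≤ 4 * B := by
        have : k ≤ 4 * ((k + 3) / 4) := by omega
        have := Nat.mul_le_mul_left Q.card this
        nlinarith
      have h3 : Q.card * k ≤ E * k := by
        have : E * k = k * E := mul_comm _ _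
        omega
      exact Nat.le_of_mul_le_mul_right h3 (by omega))
  have hT := T2 B hB Ss.card Ss rfl ((Finset.card_le_card hSs).trans hSB) (hH.mono hSs) Ps (by
    intro x hx'
    have h1 := hx x hx'
    obtain ⟨a, ha, b, hb, hab⟩ := Finset.one_lt_card.1 (show 1 < (Ss.filter fun l => l ∈ J x).card by omega)
    rw [Finset.mem_filter] at ha hb
    have h2 := (hJ x (hP0P (hPs hx'))).2.2
    exact ⟨a, ha.1, b, hb.1, hab, h2 a ha.2, h2 b hb.2⟩)
  refine tk_num B k E _ _ Ps.card hB hm1 ?_ (hoff.trans ?_) (hcnt.trans ?_) (hT.trans ?_)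
  · rw [← hP'c]
    exact Finset.card_filter_add_card_filter_not (s := P') (fun x => eval x f ≠ 0)
  · refine Nat.mul_le_mul_left _ (Nat.mul_le_mul hSB (le_of_eq (by ring)))
  · exact Nat.add_le_add_left (Nat.mul_le_mul_left _ (Nat.mul_le_mul_left _ hSB)) _
  · exact Nat.mul_le_mul_left _ hX

end GK
end
end

section
open MvPolynomial
noncomputable section
namespace GK

/-- The line of rigid motions taking `p` to `q`. -/
def ln (p q : ℝ × ℝ) : Ln := ⟨(p.1 + q.1) / 2, (p.2 + q.2) / 2, (q.2 - p.2) / 2, (p.1 - q.1) / 2⟩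

lemma ln_inj {p q p' q' : ℝ × ℝ} (h : ln p q = ln p' q') : p = p' ∧ q = q' := by
  have h1 := congrArg Ln.a0 h
  have h2 := congrArg Ln.a1 h
  have h3 := congrArg Ln.b0 h
  have h4 := congrArg Ln.b1 h
  simp only [ln] at h1 h2 h3 h4
  refine ⟨Prod.ext ?_ ?_, Prod.ext ?_ ?_⟩ <;> linarith

def sqd (p q : ℝ × ℝ) : ℝ := (p.1 - q.1) ^ 2 + (p.2 - q.2) ^ 2

lemma ln_meet_sq {p q p' q' : ℝ × ℝ} {x : Fin 3 → ℝ} (h : (ln p q).on x) (h' : (ln p' q').on x) :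
    sqd p p' = sqd q q' := by
  rw [on_iff] at h h'
  simp only [ln] at h h'
  obtain ⟨h1, h2⟩ := h
  obtain ⟨h3, h4⟩ := h'
  unfold sqd
  rw [h1] at h3
  rw [h2] at h4
  linear_combination (-2 * ((q.1 - q'.1) - (p.1 - p'.1))) * h3 + (-2 * ((q.2 - q'.2) - (p.2 - p'.2))) * h4

lemma ln_meet_left {p q q' : ℝ × ℝ} {x : Fin 3 → ℝ} (h : (ln p q).on x) (h' : (ln p q').on x) : q = q' := by
  have h0 := ln_meet_sq h h'
  unfold sqd at h0
  refine Prod.ext ?_ ?_ <;> nlinarith [sq_nonneg (q.1 - q'.1), sq_nonneg (q.2 - q'.2)]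

lemma ln_meet {p q p' q' : ℝ × ℝ} (h : sqd p p' = sqd q q') (hne : p - p' ≠ q - q') :
    ∃ x, (ln p q).on x ∧ (ln p' q').on x := by
  set u1 := p.1 - p'.1 with hu1
  set u2 := p.2 - p'.2 with hu2
  set v1 := q.1 - q'.1 with hv1
  set v2 := q.2 - q'.2 with hv2
  have hs : u1 ^ 2 + u2 ^ 2 = v1 ^ 2 + v2 ^ 2 := h
  have hn : (v1 - u1) ^ 2 + (v2 - u2) ^ 2 ≠ 0 := by
    intro h0
    apply hne
    refine Prod.ext ?_ ?_
    · change u1 = v1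
      nlinarith [sq_nonneg (v1 - u1), sq_nonneg (v2 - u2)]
    · change u2 = v2
      nlinarith [sq_nonneg (v1 - u1), sq_nonneg (v2 - u2)]
  set n := (v1 - u1) ^ 2 + (v2 - u2) ^ 2 with hndef
  set z : ℝ := -((u1 + v1) * (v2 - u2) - (u2 + v2) * (v1 - u1)) / n with hz
  have hzn : z * n = -((u1 + v1) * (v2 - u2) - (u2 + v2) * (v1 - u1)) := by
    rw [hz]; field_simp
  have e1 : u1 + v1 + z * (v2 - u2) = 0 := by
    have : n * (u1 + v1 + z * (v2 - u2)) = 0 := by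
      have : n * (u1 + v1 + z * (v2 - u2)) = n * (u1 + v1) + (z * n) * (v2 - u2) := by ring
      rw [this, hzn, hndef]
      linear_combination (-(v1 - u1)) * hs
    exact (mul_eq_zero.1 this).resolve_left hn
  have e2 : u2 + v2 - z * (v1 - u1) = 0 := by
    have : n * (u2 + v2 - z * (v1 - u1)) = 0 := by
      have : n * (u2 + v2 - z * (v1 - u1)) = n * (u2 + v2) - (z * n) * (v1 - u1) := by ring
      rw [this, hzn, hndef]
      linear_combination (-(v2 - u2)) * hs
    exact (mul_eq_zero.1 this).resolve_left hn
  refine ⟨(ln p q).pt z, on_pt _ _, ?_⟩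
  rw [on_iff]
  simp only [Ln.pt, ln, Matrix.cons_val]
  constructor
  · linear_combination (1 / 2) * e1
  · linear_combination (1 / 2) * e2

/-- The regulus quadric. -/
def rq (l : Ln) (w : ℝ × ℝ) : Poly :=
  (X 0 - C l.a0 - X 2 * C l.b0) * (X 0 - C l.a0 - X 2 * C l.b0) +
  (X 1 - C l.a1 - X 2 * C l.b1) * (X 1 - C l.a1 - X 2 * C l.b1) -
  ((X 0 - C l.a0 - X 2 * C l.b0) * C w.1 + (X 1 - C l.a1 - X 2 * C l.b1) * C w.2) -
  X 2 * ((X 1 - C l.a1 - X 2 * C l.b1) * C w.1 - (X 0 - C l.a0 - X 2 * C l.b0) * C w.2)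

lemma rq_deg (l : Ln) (w : ℝ × ℝ) : (rq l w).totalDegree ≤ 2 := by
  have h0 := plane_deg 0 l.a0 l.b0
  have h1 := plane_deg 1 l.a1 l.b1
  have hc : ∀ r : ℝ, (C r : Poly).totalDegree ≤ 0 := fun r => (totalDegree_C r).le
  have hx : (X 2 : Poly).totalDegree ≤ 1 := (totalDegree_X _).le
  have a0 := td_mul h0 (hc w.1)
  have a1 := td_mul h1 (hc w.2)
  have b1 := td_mul h1 (hc w.1)
  have b0 := td_mul h0 (hc w.2)
  exact td_sub (td_sub (td_add (td_mul h0 h0) (td_mul h1 h1)) ((td_add a0 a1).trans (by norm_num)))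
    (td_mul hx (td_sub b1 b0))

lemma rq_eval (l : Ln) (w : ℝ × ℝ) (e f : ℝ) : eval ![l.a0 + e, l.a1 + f, 0] (rq l w) =
    e ^ 2 + f ^ 2 - (e * w.1 + f * w.2) := by
  simp only [rq, map_sub, map_add, map_mul, eval_X, eval_C, Matrix.cons_val]
  ring

lemma rq_res {p q p' q' : ℝ × ℝ} (h : sqd p p' = sqd q q') : res (ln p' q') (rq (ln p q) (p' - p)) = 0 := by
  apply Polynomial.funext
  intro t
  rw [eval_res, Polynomial.eval_zero]
  unfold sqd at h
  simp only [rq, map_sub, map_add, map_mul, eval_X, eval_C, Ln.pt, ln, Matrix.cons_val, Prod.fst_sub, Prod.snd_sub]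
  linear_combination (-(1 + t ^ 2) / 4) * h

lemma rq_ne (l : Ln) (w : ℝ × ℝ) : rq l w ≠ 0 := by
  intro h
  have h1 := rq_eval l w 1 0
  have h2 := rq_eval l w (-1) 0
  rw [h, map_zero] at h1 h2
  linarith

lemma rq_dvd (g : Poly) (hg : g ≠ 0) (hd : g.totalDegree = 2) (l : Ln) (w : ℝ × ℝ) (h : g ∣ rq l w) :
    ∃ c : ℝ, rq l w = g * C c := by
  obtain ⟨k, hk⟩ := h
  have hk0 : k ≠ 0 := by
    rintro rfl
    exact rq_ne l w (by rw [hk, mul_zero])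
  have h1 := rq_deg l w
  rw [hk, totalDegree_mul_of_isDomain hg hk0, hd] at h1
  have h2 : k.totalDegree = 0 := by omega
  exact ⟨_, by rw [hk]; congr 1; exact totalDegree_eq_zero_iff_eq_C.1 h2⟩

lemma rq_unique (g : Poly) (hg : g ≠ 0) (hd : g.totalDegree = 2) (l : Ln) (w w' : ℝ × ℝ) (h : g ∣ rq l w)
    (h' : g ∣ rq l w') : w = w' := by
  obtain ⟨c, hc⟩ := rq_dvd g hg hd l w h
  obtain ⟨d, hd⟩ := rq_dvd g hg hd l w' h'
  have key : ∀ e f : ℝ, ∃ y : ℝ, y * c = e ^ 2 + f ^ 2 - (e * w.1 + f * w.2) ∧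
      y * d = e ^ 2 + f ^ 2 - (e * w'.1 + f * w'.2) := by
    intro e f
    have h1 := rq_eval l w e f
    have h2 := rq_eval l w' e f
    rw [hc, map_mul, eval_C] at h1
    rw [hd, map_mul, eval_C] at h2
    exact ⟨_, h1, h2⟩
  obtain ⟨y1, a1, b1⟩ := key 1 0
  obtain ⟨y2, a2, b2⟩ := key (-1) 0
  obtain ⟨y3, a3, b3⟩ := key 0 1
  have hcd : c = d := by
    have e1 : (y1 + y2) * c = 2 := by linear_combination a1 + a2
    have e2 : (y1 + y2) * d = 2 := by linear_combination b1 + b2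
    have hy : y1 + y2 ≠ 0 := by
      intro h0; rw [h0] at e1; norm_num at e1
    exact mul_left_cancel₀ hy (e1.trans e2.symm)
  subst hcd
  refine Prod.ext ?_ ?_
  · linarith
  · linarith

lemma plane_unique (g : Poly) (hg : Irreducible g) (hd : g.totalDegree ≤ 1) (p q q' : ℝ × ℝ)
    (h : res (ln p q) g = 0) (h' : res (ln p q') g = 0) : q = q' := by
  have hc : ∀ i, ∃ c, pderiv i g = C c := by
    intro i
    have := pd_deg' g i
    exact ⟨_, totalDegree_eq_zero_iff_eq_C.1 (by omega)⟩
  choose c hc using hc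
  have hdir : ∀ l : Ln, res l g = 0 → l.b0 * c 0 + l.b1 * c 1 + c 2 = 0 := by
    intro l hl
    have h1 := derivative_res l g
    rw [hl, Polynomial.derivative_zero] at h1
    have h2 := congrArg (Polynomial.eval 0) h1
    rw [eval_res] at h2
    simp only [Fin.sum_univ_three, hc, map_add, map_mul, eval_C, Ln.dir, Matrix.cons_val, Polynomial.eval_zero] at h2
    linarith
  have e1 := hdir _ h
  have e2 := hdir _ h'
  have e3 : ((ln p q').a0 + (ln p q').b0 - (ln p q).a0) * c 0 + ((ln p q').a1 + (ln p q').b1 - (ln p q).a1) * c 1 + c 2 = 0 := by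
    refine hdir ⟨(ln p q).a0, (ln p q).a1, (ln p q').a0 + (ln p q').b0 - (ln p q).a0, (ln p q').a1 + (ln p q').b1 - (ln p q).a1⟩ ?_
    refine res_zero_of_roots _ g {0, 1} ?_ ?_
    · intro t ht
      simp only [Finset.mem_insert, Finset.mem_singleton] at ht
      rcases ht with rfl | rfl
      · have := eval_of_res h (on_pt (ln p q) 0)
        convert this using 2
        simp [Ln.pt]
      · have := eval_of_res h' (on_pt (ln p q') 1)
        convert this using 2
        simp [Ln.pt]
    · rw [Finset.card_pair (by norm_num)]; omega
  simp only [ln] at e1 e2 e3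
  set v1 := q.1 - q'.1 with hv1
  set v2 := q.2 - q'.2 with hv2
  have f1 : v2 * c 0 - v1 * c 1 = 0 := by linear_combination 2 * e1 - 2 * e2
  have f2 : v1 * c 0 + v2 * c 1 = 0 := by linear_combination 2 * e2 - 2 * e3
  by_contra hne
  have hn : v1 ^ 2 + v2 ^ 2 ≠ 0 := by
    intro h0
    apply hne
    refine Prod.ext ?_ ?_
    · nlinarith [sq_nonneg v1, sq_nonneg v2]
    · nlinarith [sq_nonneg v1, sq_nonneg v2]
  have c0 : c 0 = 0 := by
    have : (v1 ^ 2 + v2 ^ 2) * c 0 = 0 := by linear_combination v2 * f1 + v1 * f2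
    exact (mul_eq_zero.1 this).resolve_left hn
  have c1 : c 1 = 0 := by
    have : (v1 ^ 2 + v2 ^ 2) * c 1 = 0 := by linear_combination -v1 * f1 + v2 * f2
    exact (mul_eq_zero.1 this).resolve_left hn
  have c2 : c 2 = 0 := by rw [c0, c1] at e1; linarith
  obtain ⟨i, hi⟩ := exists_pd hg
  apply hi
  rw [hc i]
  fin_cases i <;> simp [c0, c1, c2]

end GK
end
end

section
open MvPolynomial
noncomputable section
namespace GK

def lns (P : Finset (ℝ × ℝ)) : Finset Ln := by
  classical
  exact (P ×ˢ P).image fun a => ln a.1 a.2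

lemma mem_lns {P : Finset (ℝ × ℝ)} {l : Ln} : l ∈ lns P ↔ ∃ p ∈ P, ∃ q ∈ P, ln p q = l := by
  classical
  simp only [lns, Finset.mem_image, Finset.mem_product]
  constructor
  · rintro ⟨⟨p, q⟩, ⟨hp, hq⟩, h⟩; exact ⟨p, hp, q, hq, h⟩
  · rintro ⟨p, hp, q, hq, h⟩; exact ⟨(p, q), ⟨hp, hq⟩, h⟩

lemma lns_card (P : Finset (ℝ × ℝ)) : (lns P).card ≤ P.card ^ 2 := by
  classical
  refine Finset.card_image_le.trans ?_
  rw [Finset.card_product, pow_two]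

lemma fib_card (P : Finset (ℝ × ℝ)) (M : Finset Ln) (hM : M ⊆ lns P) (F : (ℝ × ℝ) → ℕ)
    (hF : ∀ p ∈ P, ∀ M' ⊆ M, (∀ l ∈ M', ∃ q ∈ P, ln p q = l) → M'.card ≤ F p) : M.card ≤ ∑ p ∈ P, F p := by
  classical
  have h1 : M ⊆ P.biUnion fun p => M.filter fun l => ∃ q ∈ P, ln p q = l := by
    intro l hl
    obtain ⟨p, hp, q, hq, h⟩ := mem_lns.1 (hM hl)
    exact Finset.mem_biUnion.2 ⟨p, hp, Finset.mem_filter.2 ⟨hl, q, hq, h⟩⟩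
  refine (Finset.card_le_card h1).trans (Finset.card_biUnion_le.trans (Finset.sum_le_sum fun p hp => ?_))
  exact hF p hp _ (Finset.filter_subset _ _) fun l hl => (Finset.mem_filter.1 hl).2

lemma conc (P : Finset (ℝ × ℝ)) (x : Fin 3 → ℝ) (M : Finset Ln) (hM : M ⊆ lns P) (hx : ∀ l ∈ M, l.on x) :
    M.card ≤ P.card := by
  have := fib_card P M hM (fun _ => 1) (by
    intro p _ M' hM' h
    rw [Finset.card_le_one]
    intro a ha b hb
    obtain ⟨q, _, rfl⟩ := h a ha
    obtain ⟨q', _, rfl⟩ := h b hb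
    rw [ln_meet_left (hx _ (hM' ha)) (hx _ (hM' hb))])
  simpa using this

lemma hypS (P : Finset (ℝ × ℝ)) : Hyp (lns P) (5 * P.card) := by
  classical
  intro l hl g hg hd hr M hM hm
  obtain ⟨p, hp, q, hq, rfl⟩ := mem_lns.1 hl
  by_cases hd1 : g.totalDegree ≤ 1
  · have := fib_card P M hM (fun _ => 1) (by
      intro p _ M' hM' h
      rw [Finset.card_le_one]
      intro a ha b hb
      obtain ⟨q, _, rfl⟩ := h a ha
      obtain ⟨q', _, rfl⟩ := h b hb
      rw [plane_unique g hg hd1 p q q' (hm _ (hM' ha)).2.1 (hm _ (hM' hb)).2.1])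
    simp only [Finset.sum_const, smul_eq_mul, mul_one] at this
    omega
  · have hd2 : g.totalDegree = 2 := by omega
    have h1 := fib_card P M hM (fun p' => 4 + if g ∣ rq (ln p q) (p' - p) then P.card else 0) (by
      intro p' _ M' hM' h
      split_ifs with hif
      · have : M' ⊆ P.image fun q => ln p' q := by
          intro l hl
          obtain ⟨q, hq, rfl⟩ := h l hl
          exact Finset.mem_image_of_mem _ hq
        have := (Finset.card_le_card this).trans Finset.card_image_le
        omega
      · have := bez g _ hg hif M' (fun l hl => (hm l (hM' hl)).2.1) (by
          intro l hl
          obtain ⟨q', _, rfl⟩ := h l hl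
          obtain ⟨_, _, x, hx, hx'⟩ := hm _ (hM' hl)
          exact rq_res (ln_meet_sq hx hx'))
        have h2 := Nat.mul_le_mul_left g.totalDegree (rq_deg (ln p q) (p' - p))
        rw [hd2] at h2 this
        omega)
    have h2 : ∑ p' ∈ P, (4 + if g ∣ rq (ln p q) (p' - p) then P.card else 0) ≤ 4 * P.card + P.card := by
      rw [Finset.sum_add_distrib, ← Finset.sum_filter]
      simp only [Finset.sum_const, smul_eq_mul]
      have h3 : (P.filter fun p' => g ∣ rq (ln p q) (p' - p)).card ≤ 1 := by
        rw [Finset.card_le_one]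
        intro a ha b hb
        rw [Finset.mem_filter] at ha hb
        have := rq_unique g hg.ne_zero hd2 _ _ _ ha.2 hb.2
        exact sub_left_injective this
      have := Nat.mul_le_mul_right P.card h3
      omega
    omega

/-- Number of lines through a point. -/
def mult (P : Finset (ℝ × ℝ)) (x : Fin 3 → ℝ) : ℕ := by
  classical
  exact ((lns P).filter fun l => l.on x).card

lemma rich_bound (P : Finset (ℝ × ℝ)) (hP : 0 < P.card) (X : Finset (Fin 3 → ℝ)) (k : ℕ) (hk : 2 ≤ k) (hkP : k ≤ P.card)
    (hX : ∀ x ∈ X, k ≤ mult P x) : X.card * k ^ 2 ≤ 2 ^ 92 * P.card ^ 3 := by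
  classical
  have hS : (lns P).card ≤ (5 * P.card) ^ 2 := (lns_card P).trans (Nat.pow_le_pow_left (by omega) 2)
  by_cases h4 : 4 ≤ k
  · have := Tk (5 * P.card) (by omega) k h4 (by omega) (lns P) hS (hypS P) X (by
      intro x hx
      have := hX x hx
      unfold mult at this
      obtain ⟨J, hJ, hJc⟩ := Finset.exists_subset_card_eq this
      exact ⟨J, hJ.trans (Finset.filter_subset _ _), hJc, fun l hl => (Finset.mem_filter.1 (hJ hl)).2⟩)
    refine this.trans ?_
    rw [mul_pow, ← mul_assoc]
    exact Nat.mul_le_mul_right _ (by norm_num)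
  · have := T2 (5 * P.card) (by omega) _ (lns P) rfl hS (hypS P) X (by
      intro x hx
      have := hX x hx
      unfold mult at this
      obtain ⟨a, ha, b, hb, hab⟩ := Finset.one_lt_card.1 (lt_of_lt_of_le (by omega : 1 < k) this)
      rw [Finset.mem_filter] at ha hb
      exact ⟨a, ha.1, b, hb.1, hab, ha.2, hb.2⟩)
    have h2 := this.trans (Nat.mul_le_mul_left _ (lns_card P))
    have hk2 : k ^ 2 ≤ 9 := by
      have : k ≤ 3 := by omega
      nlinarith
    calc X.card * k ^ 2 ≤ (10000 * (5 * P.card) * P.card ^ 2) * 9 := Nat.mul_le_mul h2 hk2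
      _ = 450000 * P.card ^ 3 := by ring
      _ ≤ _ := Nat.mul_le_mul_right _ (by norm_num)

end GK
end
end

section
open MvPolynomial
noncomputable section
namespace GK

lemma cs {α : Type*} [DecidableEq α] (O : Finset α) (f : α → ℝ) :
    O.card ^ 2 ≤ (O.image f).card * ((O ×ˢ O).filter fun a => f a.1 = f a.2).card := by
  have h1 : O.card = ∑ d ∈ O.image f, (O.filter fun a => f a = d).card :=
    Finset.card_eq_sum_card_image f O
  have h2 : ((O ×ˢ O).filter fun a => f a.1 = f a.2).card = ∑ d ∈ O.image f, (O.filter fun a => f a = d).card ^ 2 := by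
    rw [Finset.card_eq_sum_card_fiberwise (f := fun a => f a.1) (t := O.image f)]
    · refine Finset.sum_congr rfl fun d _ => ?_
      rw [pow_two, ← Finset.card_product]
      congr 1
      ext ⟨a, b⟩
      simp only [Finset.mem_filter, Finset.mem_product]
      constructor
      · rintro ⟨⟨⟨ha, hb⟩, h⟩, hd⟩
        exact ⟨⟨ha, hd⟩, hb, h ▸ hd⟩
      · rintro ⟨⟨ha, hd⟩, hb, hd'⟩
        exact ⟨⟨⟨ha, hb⟩, hd.trans hd'.symm⟩, hd⟩
    · intro a ha
      simp only [Finset.coe_filter, Finset.mem_product, Set.mem_setOf_eq] at ha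
      exact Finset.mem_coe.2 (Finset.mem_image_of_mem f ha.1.1)
  rw [h2, h1]
  exact sq_sum_le_card_mul_sum_sq

lemma tri (r : ℕ) : r * r - r ≤ ∑ k ∈ Finset.Icc 2 r, 2 * k := by
  induction r with
  | zero => simp
  | succ n ih =>
    rcases Nat.eq_zero_or_pos n with h | h
    · subst h; simp
    · rw [Finset.sum_Icc_succ_top (by omega)]
      have : (n + 1) * (n + 1) = n * n + 2 * n + 1 := by ring
      omega

lemma harm (n : ℕ) (hn : 1 ≤ n) : ∑ k ∈ Finset.Icc 2 n, (1 : ℝ) / k ≤ Real.log n := by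
  induction n, hn using Nat.le_induction with
  | base => simp
  | succ n hn ih =>
    rw [Finset.sum_Icc_succ_top (by omega)]
    have hn0 : (0 : ℝ) < n := by exact_mod_cast hn
    have h1 := Real.log_le_sub_one_of_pos (x := (n : ℝ) / (n + 1)) (by positivity)
    rw [Real.log_div (by positivity) (by positivity)] at h1
    have h2 : (n : ℝ) / (n + 1) - 1 = - (1 / (n + 1)) := by field_simp; ring
    push_cast
    linarith

lemma W_bound (P : Finset (ℝ × ℝ)) (hP : 0 < P.card) (W : Finset (Ln × Ln))
    (hW : ∀ a ∈ W, a.1 ∈ lns P ∧ a.2 ∈ lns P ∧ a.1 ≠ a.2 ∧ ∃ x, a.1.on x ∧ a.2.on x) :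
    (W.card : ℝ) ≤ 2 ^ 93 * (P.card : ℝ) ^ 3 * Real.log P.card := by
  classical
  set N := P.card with hN
  have hch : ∀ a : Ln × Ln, ∃ x, a ∈ W → a.1.on x ∧ a.2.on x := by
    intro a
    by_cases ha : a ∈ W
    · obtain ⟨x, hx⟩ := (hW a ha).2.2.2
      exact ⟨x, fun _ => hx⟩
    · exact ⟨0, fun h => absurd h ha⟩
  choose cr hcr using hch
  set X := W.image cr with hX
  have hmN : ∀ x, mult P x ≤ N := fun x =>
    conc P x _ (Finset.filter_subset _ _) fun l hl => (Finset.mem_filter.1 hl).2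
  have h1 : W.card ≤ ∑ x ∈ X, (mult P x * mult P x - mult P x) := by
    rw [Finset.card_eq_sum_card_image cr W]
    refine Finset.sum_le_sum fun x _ => ?_
    unfold mult
    rw [← Finset.offDiag_card]
    refine Finset.card_le_card ?_
    intro a ha
    rw [Finset.mem_filter] at ha
    obtain ⟨haW, rfl⟩ := ha
    obtain ⟨h1, h2, h3, _⟩ := hW a haW
    rw [Finset.mem_offDiag, Finset.mem_filter, Finset.mem_filter]
    exact ⟨⟨h1, (hcr a haW).1⟩, ⟨h2, (hcr a haW).2⟩, h3⟩
  have h2 : ∑ x ∈ X, (mult P x * mult P x - mult P x) ≤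
      ∑ k ∈ Finset.Icc 2 N, (X.filter fun x => k ≤ mult P x).card * (2 * k) := by
    calc _ ≤ ∑ x ∈ X, ∑ k ∈ Finset.Icc 2 N, (if k ≤ mult P x then 2 * k else 0) := by
          refine Finset.sum_le_sum fun x _ => (tri _).trans ?_
          rw [← Finset.sum_filter]
          refine Finset.sum_le_sum_of_subset ?_
          intro k hk
          rw [Finset.mem_Icc] at hk
          rw [Finset.mem_filter, Finset.mem_Icc]
          exact ⟨⟨hk.1, hk.2.trans (hmN x)⟩, hk.2⟩
      _ = _ := by
          rw [Finset.sum_comm]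
          refine Finset.sum_congr rfl fun k _ => ?_
          rw [← Finset.sum_filter, Finset.sum_const, smul_eq_mul]
  have h3 : (W.card : ℝ) ≤ ∑ k ∈ Finset.Icc 2 N, 2 ^ 93 * (N : ℝ) ^ 3 * (1 / k) := by
    have h4 : (W.card : ℝ) ≤ ((∑ k ∈ Finset.Icc 2 N, (X.filter fun x => k ≤ mult P x).card * (2 * k) : ℕ) : ℝ) := by
      exact_mod_cast h1.trans h2
    refine h4.trans ?_
    rw [Nat.cast_sum]
    refine Finset.sum_le_sum fun k hk => ?_
    rw [Finset.mem_Icc] at hk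
    have h5 := rich_bound P hP (X.filter fun x => k ≤ mult P x) k hk.1 hk.2 fun x hx => (Finset.mem_filter.1 hx).2
    have h6 : ((X.filter fun x => k ≤ mult P x).card : ℝ) * (k : ℝ) ^ 2 ≤ 2 ^ 92 * (N : ℝ) ^ 3 := by exact_mod_cast h5
    have hk0 : (0 : ℝ) < k := by exact_mod_cast (by omega : 0 < k)
    push_cast
    rw [mul_one_div, le_div_iff₀ hk0]
    calc _ = 2 * (((X.filter fun x => k ≤ mult P x).card : ℝ) * (k : ℝ) ^ 2) := by ring
      _ ≤ 2 * (2 ^ 92 * (N : ℝ) ^ 3) := by linarith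
      _ = _ := by ring
  rw [← Finset.mul_sum] at h3
  exact h3.trans (mul_le_mul_of_nonneg_left (harm N hP) (by positivity))

lemma energy (P : Finset (ℝ × ℝ)) (hP : 0 < P.card) [DecidableEq (ℝ × ℝ)] :
    (((P.offDiag ×ˢ P.offDiag).filter fun a => sqd a.1.1 a.1.2 = sqd a.2.1 a.2.2).card : ℝ) ≤
      (P.card : ℝ) ^ 3 + 2 ^ 93 * (P.card : ℝ) ^ 3 * Real.log P.card := by
  classical
  set Q := (P.offDiag ×ˢ P.offDiag).filter fun a => sqd a.1.1 a.1.2 = sqd a.2.1 a.2.2 with hQ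
  have hmem : ∀ a ∈ Q, (a.1.1 ∈ P ∧ a.1.2 ∈ P ∧ a.1.1 ≠ a.1.2) ∧ (a.2.1 ∈ P ∧ a.2.2 ∈ P ∧ a.2.1 ≠ a.2.2) ∧
      sqd a.1.1 a.1.2 = sqd a.2.1 a.2.2 := by
    intro a ha
    rw [hQ, Finset.mem_filter, Finset.mem_product, Finset.mem_offDiag, Finset.mem_offDiag] at ha
    exact ⟨ha.1.1, ha.1.2, ha.2⟩
  have h1 : (Q.filter fun a => a.1.1 - a.1.2 = a.2.1 - a.2.2).card ≤ P.card ^ 3 := by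
    have : P.card ^ 3 = (P ×ˢ (P ×ˢ P)).card := by
      rw [Finset.card_product, Finset.card_product]; ring
    rw [this]
    refine Finset.card_le_card_of_injOn (fun a => (a.1.1, a.1.2, a.2.1)) ?_ ?_
    · intro a ha
      have h := hmem a (Finset.mem_filter.1 (Finset.mem_coe.1 ha)).1
      exact Finset.mem_coe.2 (Finset.mem_product.2 ⟨h.1.1, Finset.mem_product.2 ⟨h.1.2.1, h.2.1.1⟩⟩)
    · rintro ⟨⟨p, p'⟩, q, q'⟩ ha ⟨⟨s, s'⟩, t, t'⟩ hb hab
      have ha' := (Finset.mem_filter.1 (Finset.mem_coe.1 ha)).2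
      have hb' := (Finset.mem_filter.1 (Finset.mem_coe.1 hb)).2
      simp only [Prod.mk.injEq] at hab ha' hb'
      obtain ⟨rfl, rfl, rfl⟩ := hab
      have : q' = t' := sub_right_injective (ha'.symm.trans hb')
      rw [this]
  set W := (Q.filter fun a => ¬ a.1.1 - a.1.2 = a.2.1 - a.2.2).image
    fun a => (ln a.1.1 a.2.1, ln a.1.2 a.2.2) with hW
  have h2 : W.card = (Q.filter fun a => ¬ a.1.1 - a.1.2 = a.2.1 - a.2.2).card := by
    refine Finset.card_image_of_injOn ?_
    rintro ⟨⟨p, p'⟩, q, q'⟩ _ ⟨⟨s, s'⟩, t, t'⟩ _ hab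
    simp only [Prod.mk.injEq] at hab
    obtain ⟨rfl, rfl⟩ := ln_inj hab.1
    obtain ⟨rfl, rfl⟩ := ln_inj hab.2
    rfl
  have h3 := W_bound P hP W (by
    intro b hb
    obtain ⟨a, ha, rfl⟩ := Finset.mem_image.1 hb
    rw [Finset.mem_filter] at ha
    obtain ⟨g1, g2, g3⟩ := hmem a ha.1
    refine ⟨mem_lns.2 ⟨_, g1.1, _, g2.1, rfl⟩, mem_lns.2 ⟨_, g1.2.1, _, g2.2.1, rfl⟩, ?_, ln_meet g3 ha.2⟩
    intro h
    exact g1.2.2 (ln_inj h).1)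
  have h4 := Finset.card_filter_add_card_filter_not (s := Q) (fun a => a.1.1 - a.1.2 = a.2.1 - a.2.2)
  rw [h2] at h3
  rw [← h4]
  push_cast
  have h1' : ((Q.filter fun a => a.1.1 - a.1.2 = a.2.1 - a.2.2).card : ℝ) ≤ (P.card : ℝ) ^ 3 := by exact_mod_cast h1
  linarith

lemma gk_num (N d q L : ℝ) (hN : 2 ≤ N) (hd : 0 ≤ d) (hL : 1 / 2 ≤ L) (h1 : (N * N - N) ^ 2 ≤ d * q)
    (h2 : q ≤ N ^ 3 + 2 ^ 93 * N ^ 3 * L) : N ≤ 2 ^ 97 * L * d := by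
  have e1 : N ^ 2 / 2 ≤ N * N - N := by nlinarith
  have e2 : (N ^ 2 / 2) ^ 2 ≤ (N * N - N) ^ 2 := pow_le_pow_left₀ (by positivity) e1 2
  have hN3 : 0 < N ^ 3 := by positivity
  have e3 : q ≤ N ^ 3 * (2 ^ 94 * L) := by
    have : N ^ 3 ≤ N ^ 3 * (2 ^ 93 * L) := by
      refine le_mul_of_one_le_right hN3.le ?_
      norm_num; linarith
    linarith
  have e4 : d * q ≤ d * (N ^ 3 * (2 ^ 94 * L)) := mul_le_mul_of_nonneg_left e3 hd
  have e5 : N ^ 3 * (N / 4) ≤ N ^ 3 * (d * (2 ^ 94 * L)) := by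
    have : N ^ 3 * (N / 4) = (N ^ 2 / 2) ^ 2 := by ring
    rw [this]
    linarith
  have e6 := le_of_mul_le_mul_left e5 hN3
  have hdL : 0 ≤ d * L := mul_nonneg hd (by linarith)
  linarith

/-- Guth-Katz. -/
theorem guth_katz (P : Finset (ℝ × ℝ)) (hP : 2 ≤ P.card) [DecidableEq (ℝ × ℝ)] :
    (P.card : ℝ) ≤ 2 ^ 97 * Real.log P.card * ((P.offDiag.image fun a => sqd a.1 a.2).card : ℝ) := by
  have h1 := cs P.offDiag (fun a => sqd a.1 a.2)
  have h2 := energy P (by omega)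
  have hN : (2 : ℝ) ≤ P.card := by exact_mod_cast hP
  have hL : 1 / 2 ≤ Real.log P.card := by
    have := Real.log_two_gt_d9
    have := Real.log_le_log (by norm_num) hN
    linarith
  refine gk_num _ _ _ _ hN (Nat.cast_nonneg _) hL ?_ h2
  have h3 : ((P.offDiag.card : ℕ) : ℝ) = (P.card : ℝ) * P.card - P.card := by
    rw [Finset.offDiag_card, Nat.cast_sub (Nat.le_mul_self _)]
    push_cast; ring
  rw [← h3]
  exact_mod_cast h1

end GK
end
end

noncomputable section
/-- The quotient distance on the flat torus `ℝ²/Λ`, computed on representatives: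
`d_T(x,y) = inf_{λ ∈ Λ} ‖x − y − λ‖`. -/
def torusDist (v₁ v₂ : EuclideanSpace ℝ (Fin 2)) (x y : EuclideanSpace ℝ (Fin 2)) : ℝ :=
  ⨅ l : Submodule.span ℤ ({v₁, v₂} : Set (EuclideanSpace ℝ (Fin 2))),
    ‖x - y - (l : EuclideanSpace ℝ (Fin 2))‖

namespace GK

lemma coords (v₁ v₂ : EuclideanSpace ℝ (Fin 2)) (hv : LinearIndependent ℝ ![v₁, v₂]) :
    ∃ C : ℝ, 0 < C ∧ ∃ s t : EuclideanSpace ℝ (Fin 2) →ₗ[ℝ] ℝ,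
      (∀ x, x = s x • v₁ + t x • v₂) ∧ (∀ x, |s x| ≤ C * ‖x‖ ∧ |t x| ≤ C * ‖x‖) ∧
      s v₁ = 1 ∧ s v₂ = 0 ∧ t v₁ = 0 ∧ t v₂ = 1 := by
  let b := basisOfLinearIndependentOfCardEqFinrank hv (by simp)
  have hb : ∀ i, b i = ![v₁, v₂] i := fun i => by simp [b]
  have h0 : b 0 = v₁ := hb 0
  have h1 : b 1 = v₂ := hb 1
  let L := (LinearMap.toContinuousLinearMap (b.coord 0))
  let M := (LinearMap.toContinuousLinearMap (b.coord 1))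
  refine ⟨‖L‖ + ‖M‖ + 1, by positivity, b.coord 0, b.coord 1, ?_, ?_, ?_, ?_, ?_, ?_⟩
  · intro x
    have := b.sum_repr x
    rw [Fin.sum_univ_two, h0, h1] at this
    exact this.symm
  · intro x
    have a1 : |b.coord 0 x| ≤ ‖L‖ * ‖x‖ := L.le_opNorm x
    have a2 : |b.coord 1 x| ≤ ‖M‖ * ‖x‖ := M.le_opNorm x
    constructor <;> nlinarith [norm_nonneg x, norm_nonneg L, norm_nonneg M, mul_nonneg (norm_nonneg L) (norm_nonneg x), mul_nonneg (norm_nonneg M) (norm_nonneg x)]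
  · rw [← h0]; simp
  · rw [← h1]; simp
  · rw [← h0]; simp
  · rw [← h1]; simp

lemma torus_eq (v₁ v₂ : EuclideanSpace ℝ (Fin 2)) (C : ℝ) (hC : 0 < C)
    (hlat : ∀ m ∈ Submodule.span ℤ ({v₁, v₂} : Set (EuclideanSpace ℝ (Fin 2))), m ≠ 0 → 1 ≤ C * ‖m‖)
    (x y l0 : EuclideanSpace ℝ (Fin 2))
    (hl : l0 ∈ Submodule.span ℤ ({v₁, v₂} : Set (EuclideanSpace ℝ (Fin 2))))
    (hd : 2 * C * ‖x - y - l0‖ ≤ 1) : torusDist v₁ v₂ x y = ‖x - y - l0‖ := by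
  unfold torusDist
  apply le_antisymm
  · exact ciInf_le ⟨0, by rintro _ ⟨l, rfl⟩; positivity⟩ (⟨l0, hl⟩ : Submodule.span ℤ ({v₁, v₂} : Set (EuclideanSpace ℝ (Fin 2))))
  · apply le_ciInf
    rintro ⟨l, hl'⟩
    by_cases h : l = l0
    · simp [h]
    · have h1 := hlat (l - l0) (Submodule.sub_mem _ hl' hl) (sub_ne_zero.2 h)
      have h2 : ‖l - l0‖ ≤ ‖x - y - l0‖ + ‖x - y - l‖ := by
        have : l - l0 = (x - y - l0) - (x - y - l) := by abel
        rw [this]; exact norm_sub_le _ _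
      show ‖x - y - l0‖ ≤ ‖x - y - l‖
      have h3 : C * ‖l - l0‖ ≤ C * (‖x - y - l0‖ + ‖x - y - l‖) := by gcongr
      have h4 : C * ‖x - y - l0‖ ≤ C * ‖x - y - l‖ := by nlinarith
      exact le_of_mul_le_mul_left h4 hC

lemma cell_close (n : ℕ) (hn : 0 < n) (a b : ℝ)
    (h : ⌊n * Int.fract a⌋₊ = ⌊n * Int.fract b⌋₊) : n * |Int.fract a - Int.fract b| ≤ 1 := by
  have ha : 0 ≤ n * Int.fract a := mul_nonneg (by positivity) (Int.fract_nonneg a)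
  have hb : 0 ≤ n * Int.fract b := mul_nonneg (by positivity) (Int.fract_nonneg b)
  have h1 := Nat.floor_le ha
  have h2 := Nat.lt_floor_add_one (n * Int.fract a)
  have h3 := Nat.floor_le hb
  have h4 := Nat.lt_floor_add_one (n * Int.fract b)
  rw [h] at h1 h2
  have : (n : ℝ) * |Int.fract a - Int.fract b| = |n * Int.fract a - n * Int.fract b| := by
    rw [← mul_sub, abs_mul, Nat.abs_cast]
  rw [this, abs_le]; constructor <;> linarith

lemma norm_sqd (x y : EuclideanSpace ℝ (Fin 2)) :
    sqd (x 0, x 1) (y 0, y 1) = ‖x - y‖ ^ 2 := by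
  rw [EuclideanSpace.norm_sq_eq, Fin.sum_univ_two]
  simp [sqd, sq_abs]

lemma fin1 (K n l2 lP lQ N Q D S : ℝ) (hK : 0 < K) (hn : 0 < n) (hl : lQ ≤ lP) (h0 : 0 ≤ lP) (hD : 0 ≤ D)
    (hDS : D ≤ S) (hN : N ≤ n ^ 2 * Q) (hN0 : 0 ≤ N) (hQ : Q ≤ K * lQ * D) :
    min (1 / (K * n ^ 2)) (l2 / n ^ 2) * N ≤ S * lP := by
  have hQ1 : Q ≤ K * lP * S := hQ.trans (by gcongr)
  calc min (1 / (K * n ^ 2)) (l2 / n ^ 2) * N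
      ≤ 1 / (K * n ^ 2) * (n ^ 2 * (K * lP * S)) := by
        gcongr
        · exact min_le_left _ _
        · exact hN.trans (by gcongr)
    _ = S * lP := by field_simp

lemma fin2 (K n l2 lP N Q S : ℝ) (hn : 0 < n) (hl2 : 0 < l2) (hl : l2 ≤ lP)
    (hS : 1 ≤ S) (hN : N ≤ n ^ 2 * Q) (hN0 : 0 ≤ N) (hQ : Q ≤ 1) :
    min (1 / (K * n ^ 2)) (l2 / n ^ 2) * N ≤ S * lP := by
  calc min (1 / (K * n ^ 2)) (l2 / n ^ 2) * N
      ≤ l2 / n ^ 2 * (n ^ 2 * 1) := by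
        gcongr
        · exact min_le_right _ _
        · exact hN.trans (by gcongr)
    _ = 1 * l2 := by field_simp
    _ ≤ S * lP := by gcongr

end GK

open GK

/-- Let `Λ = ℤ·v₁ + ℤ·v₂` be a lattice spanned by an `ℝ`-basis `v₁, v₂` of `ℝ²`.
Then there is `c(Λ) > 0` such that any `N ≥ 2` points of `ℝ²` which are pairwise
distinct modulo `Λ` determine at least `c(Λ) · N / log N` distinct torus distances. -/
theorem distinct_distances_flat_torus (v₁ v₂ : EuclideanSpace ℝ (Fin 2))
    (hv : LinearIndependent ℝ ![v₁, v₂]) :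
    ∃ c : ℝ, 0 < c ∧
      ∀ P : Finset (EuclideanSpace ℝ (Fin 2)), 2 ≤ P.card →
        (∀ p ∈ P, ∀ q ∈ P, p ≠ q →
          p - q ∉ Submodule.span ℤ ({v₁, v₂} : Set (EuclideanSpace ℝ (Fin 2)))) →
        c * (P.card : ℝ) / Real.log P.card ≤
          ({t : ℝ | ∃ p ∈ P, ∃ q ∈ P, p ≠ q ∧ torusDist v₁ v₂ p q = t}.ncard : ℝ) := by
  classical
  obtain ⟨K, hK, hGK⟩ : ∃ K : ℝ, 0 < K ∧ ∀ R : Finset (ℝ × ℝ), 2 ≤ R.card →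
      (R.card : ℝ) ≤ K * Real.log R.card * ((R.offDiag.image fun a => sqd a.1 a.2).card : ℝ) :=
    ⟨2 ^ 97, by positivity, fun R hR => guth_katz R hR⟩
  obtain ⟨C, hC, s, t, hst, hbd, hs1, hs2, ht1, ht2⟩ := coords v₁ v₂ hv
  have hlat : ∀ m ∈ Submodule.span ℤ ({v₁, v₂} : Set (EuclideanSpace ℝ (Fin 2))), m ≠ 0 → 1 ≤ C * ‖m‖ := by
    intro m hm hm0
    obtain ⟨a, b, rfl⟩ := Submodule.mem_span_pair.1 hm
    have e1 : s (a • v₁ + b • v₂) = a := by simp [hs1, hs2]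
    have e2 : t (a • v₁ + b • v₂) = b := by simp [ht1, ht2]
    obtain ⟨q1, q2⟩ := hbd (a • v₁ + b • v₂)
    rw [e1] at q1; rw [e2] at q2
    by_cases ha : a = 0
    · have hb : b ≠ 0 := by rintro rfl; simp [ha] at hm0
      refine le_trans ?_ q2
      exact_mod_cast Int.one_le_abs hb
    · refine le_trans ?_ q1
      exact_mod_cast Int.one_le_abs ha
  obtain ⟨n, hn⟩ := exists_nat_gt (2 * C * (‖v₁‖ + ‖v₂‖))
  have hn0 : 0 < n := by
    have : (0:ℝ) < n := lt_of_le_of_lt (by positivity) hn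
    exact_mod_cast this
  have hnr : (0:ℝ) < n := by exact_mod_cast hn0
  let red : EuclideanSpace ℝ (Fin 2) → EuclideanSpace ℝ (Fin 2) := fun x => Int.fract (s x) • v₁ + Int.fract (t x) • v₂
  let lam : EuclideanSpace ℝ (Fin 2) → EuclideanSpace ℝ (Fin 2) := fun x => ⌊s x⌋ • v₁ + ⌊t x⌋ • v₂
  have hlam : ∀ x, lam x ∈ Submodule.span ℤ ({v₁, v₂} : Set (EuclideanSpace ℝ (Fin 2))) :=
    fun x => Submodule.mem_span_pair.2 ⟨_, _, rfl⟩
  have hred : ∀ x, x = red x + lam x := by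
    intro x
    conv_lhs => rw [hst x]
    simp only [red, lam, ← Int.cast_smul_eq_zsmul ℝ]
    conv_lhs => rw [← Int.fract_add_floor (s x), ← Int.fract_add_floor (t x)]
    rw [add_smul, add_smul]; abel
  have hsub : ∀ x y, x - y - (lam x - lam y) = red x - red y := by
    intro x y
    conv_lhs => rw [show x - y = red x + lam x - (red y + lam y) by rw [← hred, ← hred]]
    abel
  let cell : EuclideanSpace ℝ (Fin 2) → ℕ × ℕ := fun x => (⌊n * Int.fract (s x)⌋₊, ⌊n * Int.fract (t x)⌋₊)
  have hfl : ∀ a : ℝ, ⌊n * Int.fract a⌋₊ < n := by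
    intro a
    rw [Nat.floor_lt (mul_nonneg hnr.le (Int.fract_nonneg a))]
    have := Int.fract_lt_one a
    nlinarith
  have hcell : ∀ x y, cell x = cell y → torusDist v₁ v₂ x y = ‖red x - red y‖ := by
    intro x y hxy
    rw [← hsub]
    apply torus_eq v₁ v₂ C hC hlat _ _ _ (Submodule.sub_mem _ (hlam x) (hlam y))
    rw [hsub]
    have h1 := cell_close n hn0 _ _ (congrArg Prod.fst hxy)
    have h2 := cell_close n hn0 _ _ (congrArg Prod.snd hxy)
    have h3 : ‖red x - red y‖ ≤ |Int.fract (s x) - Int.fract (s y)| * ‖v₁‖ + |Int.fract (t x) - Int.fract (t y)| * ‖v₂‖ := by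
      have : red x - red y = (Int.fract (s x) - Int.fract (s y)) • v₁ + (Int.fract (t x) - Int.fract (t y)) • v₂ := by
        simp only [red, sub_smul]; abel
      rw [this]
      refine (norm_add_le _ _).trans ?_
      rw [norm_smul, norm_smul, Real.norm_eq_abs, Real.norm_eq_abs]
    have h4 : n * ‖red x - red y‖ ≤ ‖v₁‖ + ‖v₂‖ := by
      have := mul_le_mul_of_nonneg_left h3 hnr.le
      have a1 := mul_le_mul_of_nonneg_right h1 (norm_nonneg v₁)
      have a2 := mul_le_mul_of_nonneg_right h2 (norm_nonneg v₂)
      linarith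
    have h5 : n * (2 * C * ‖red x - red y‖) ≤ n * 1 := by
      have := mul_le_mul_of_nonneg_left h4 (by positivity : 0 ≤ 2 * C)
      linarith
    exact le_of_mul_le_mul_left h5 hnr
  have hl2 : 0 < Real.log 2 := Real.log_pos (by norm_num)
  refine ⟨min (1 / (K * n ^ 2)) (Real.log 2 / n ^ 2), by positivity, ?_⟩
  intro P hP hdist
  set S : Set ℝ := {t : ℝ | ∃ p ∈ P, ∃ q ∈ P, p ≠ q ∧ torusDist v₁ v₂ p q = t} with hS
  have hSf : S.Finite := by
    refine (P.offDiag.image fun a => torusDist v₁ v₂ a.1 a.2).finite_toSet.subset ?_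
    rintro _ ⟨p, hp, q, hq, hpq, rfl⟩
    exact Finset.mem_coe.2 (Finset.mem_image.2 ⟨(p, q), Finset.mem_offDiag.2 ⟨hp, hq, hpq⟩, rfl⟩)
  have hN2 : (2:ℝ) ≤ P.card := by exact_mod_cast hP
  have hlogN : Real.log 2 ≤ Real.log P.card := Real.log_le_log (by norm_num) hN2
  have hlogN0 : 0 < Real.log P.card := hl2.trans_le hlogN
  rw [div_le_iff₀ hlogN0]
  obtain ⟨κ, hκ, hcard⟩ : ∃ κ ∈ Finset.range n ×ˢ Finset.range n,
      P.card ≤ n ^ 2 * (P.filter fun x => cell x = κ).card := by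
    by_contra! hcon
    have h1 : P.card = ∑ κ ∈ Finset.range n ×ˢ Finset.range n, (P.filter fun x => cell x = κ).card :=
      Finset.card_eq_sum_card_fiberwise (fun x _ => by
        simp only [Finset.coe_product, Finset.coe_range, Set.mem_prod, Set.mem_Iio]
        exact ⟨hfl _, hfl _⟩)
    have h2 : ∑ κ ∈ Finset.range n ×ˢ Finset.range n, n ^ 2 * (P.filter fun x => cell x = κ).card
        < ∑ κ ∈ Finset.range n ×ˢ Finset.range n, P.card :=
      Finset.sum_lt_sum_of_nonempty ⟨(0, 0), by simp [hn0]⟩ (fun κ hκ => hcon κ hκ)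
    rw [← Finset.mul_sum, ← h1] at h2
    simp [sq] at h2
  set Q := P.filter fun x => cell x = κ with hQ
  have hcr : (P.card : ℝ) ≤ n ^ 2 * Q.card := by exact_mod_cast hcard
  by_cases hQ2 : 2 ≤ Q.card
  · let f : EuclideanSpace ℝ (Fin 2) → ℝ × ℝ := fun x => (red x 0, red x 1)
    have hfinj : Set.InjOn f Q := by
      intro x hx y hy hxy
      by_contra hne
      refine hdist x (Finset.mem_filter.1 hx).1 y (Finset.mem_filter.1 hy).1 hne ?_
      have h0 := congrArg Prod.fst hxy
      have h1 := congrArg Prod.snd hxy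
      have : red x = red y := by
        ext i
        fin_cases i
        · exact h0
        · exact h1
      have h := hsub x y
      rw [this, sub_self, sub_eq_zero] at h
      rw [h]; exact Submodule.sub_mem _ (hlam x) (hlam y)
    have hcf : (Q.image f).card = Q.card := Finset.card_image_of_injOn hfinj
    have hgk := hGK (Q.image f) (by rw [hcf]; exact hQ2)
    rw [hcf] at hgk
    have hle : (((Q.image f).offDiag.image fun a => sqd a.1 a.2).card) ≤ S.ncard := by
      have h1 : (((Q.image f).offDiag.image fun a => sqd a.1 a.2) : Set ℝ) ⊆ (fun r => r ^ 2) '' S := by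
        intro r hr
        obtain ⟨⟨a, b⟩, hab, rfl⟩ := Finset.mem_image.1 (Finset.mem_coe.1 hr)
        obtain ⟨ha, hb, hne⟩ := Finset.mem_offDiag.1 hab
        obtain ⟨x, hx, rfl⟩ := Finset.mem_image.1 ha
        obtain ⟨y, hy, rfl⟩ := Finset.mem_image.1 hb
        obtain ⟨hxP, hxc⟩ := Finset.mem_filter.1 hx
        obtain ⟨hyP, hyc⟩ := Finset.mem_filter.1 hy
        refine ⟨_, ⟨x, hxP, y, hyP, fun h => hne (by simp [h]), rfl⟩, ?_⟩
        show torusDist v₁ v₂ x y ^ 2 = sqd (red x 0, red x 1) (red y 0, red y 1)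
        rw [norm_sqd, hcell x y (hxc.trans hyc.symm)]
      rw [← Set.ncard_coe_finset]
      exact (Set.ncard_le_ncard h1 (hSf.image _)).trans (Set.ncard_image_le hSf)
    have hler : ((((Q.image f).offDiag.image fun a => sqd a.1 a.2).card : ℕ) : ℝ) ≤ S.ncard := by
      exact_mod_cast hle
    have hQP : Q.card ≤ P.card := Finset.card_le_card (Finset.filter_subset _ _)
    have hQ0 : (0:ℝ) < Q.card := by exact_mod_cast (by omega : 0 < Q.card)
    have hlog : Real.log Q.card ≤ Real.log P.card := Real.log_le_log hQ0 (by exact_mod_cast hQP)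
    exact fin1 K n _ _ _ _ _ _ _ hK hnr hlog hlogN0.le (Nat.cast_nonneg _) hler hcr (Nat.cast_nonneg _) hgk
  · have hQ1 : (Q.card : ℝ) ≤ 1 := by exact_mod_cast (by omega : Q.card ≤ 1)
    have hS1 : (1:ℝ) ≤ S.ncard := by
      obtain ⟨x, hx, y, hy, hxy⟩ := Finset.one_lt_card.1 (by omega : 1 < P.card)
      have : 0 < S.ncard := (Set.ncard_pos hSf).2 ⟨_, x, hx, y, hy, hxy, rfl⟩
      exact_mod_cast this
    exact fin2 K n _ _ _ _ _ hnr hl2 hlogN hS1 hcr (Nat.cast_nonneg _) hQ1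

end
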